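/- There exist absolute constants c, C > 0 with the following property. Let E, A > 0, set ε = c E^{−1/14}, T = C A² E^{13/6} ε^{−4}, and 𝒯 = exp(C E^{85/6} E^{13/14} A^{11}). Let u be a smooth global solution of the defocusing quintic nonlinear wave equation with E(u(t)) ≤ E for all t ∈ ℝ, satisfying the a priori bounds with constant A. Then for every interval [a, b] with a ≥ T and b − a ≥ 𝒯, there exists t₀ with 0 < t₀ − a ≤ 𝒯 + T such that the Duhamel integral satisfies ‖ D_{[t₀ − T, t₀]}u ‖_{L⁸_{t,x}([t₀, b]×ℝ³)} ≤ ε/2. -/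

import Mathlib

open MeasureTheory Real Set Function
open scoped ENNReal NNReal FourierTransform

noncomputable section

/-- Three-dimensional Euclidean space `ℝ³`. -/
abbrev E3 : Type := EuclideanSpace ℝ (Fin 3)

/-- The time derivative `∂ₜ u` of a function `u : ℝ × ℝ³ → ℝ` (curried). -/
def tderiv (u : ℝ → E3 → ℝ) (t : ℝ) (x : E3) : ℝ := deriv (fun s => u s x) t

/-- The second time derivative `∂ₜ² u`. -/
def tderiv2 (u : ℝ → E3 → ℝ) (t : ℝ) (x : E3) : ℝ := deriv (fun s => tderiv u s x) t

/-- The spatial Laplacian `Δ f = ∑ᵢ ∂ᵢ² f` of `f : ℝ³ → ℝ`. -/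
def lap (f : E3 → ℝ) (x : E3) : ℝ :=
  ∑ i : Fin 3, iteratedFDeriv ℝ 2 f x ![EuclideanSpace.single i 1, EuclideanSpace.single i 1]

/-- `f : ℝ³ → ℝ` is a Schwartz function: it is smooth and all of its derivatives decay
faster than any polynomial. -/
def IsSchwartz (f : E3 → ℝ) : Prop :=
  ContDiff ℝ (⊤ : ℕ∞) f ∧ ∀ k n : ℕ, ∃ C : ℝ, ∀ x, ‖x‖ ^ k * ‖iteratedFDeriv ℝ n f x‖ ≤ C

/-- `u` is a smooth solution of the defocusing quintic nonlinear wave equation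
`∂ₜ²u − Δu + u⁵ = 0` on the time interval `I`, Schwartz in the space variable at each time. -/
def IsNLWOn (u : ℝ → E3 → ℝ) (I : Set ℝ) : Prop :=
  ContDiffOn ℝ (⊤ : ℕ∞) (uncurry u) (I ×ˢ univ) ∧
  (∀ t ∈ I, IsSchwartz (u t) ∧ IsSchwartz (tderiv u t)) ∧
  (∀ t ∈ I, ∀ x, tderiv2 u t x - lap (u t) x + (u t x) ^ 5 = 0)

/-- `u` is a smooth global solution of the defocusing quintic nonlinear wave equation. -/
def IsNLW (u : ℝ → E3 → ℝ) : Prop := IsNLWOn u univ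

/-- The energy `E(u(t)) = ∫ (1/2)|∂ₜu|² + (1/2)|∇ₓu|² + (1/6)u⁶ dx`. -/
def energy (u : ℝ → E3 → ℝ) (t : ℝ) : ℝ :=
  ∫ x : E3, ((1/2) * (tderiv u t x) ^ 2 + (1/2) * ‖gradient (u t) x‖ ^ 2 + (1/6) * (u t x) ^ 6)

/-- The spatial `L^q` norm (`q` finite), valued in `ℝ≥0∞`. -/
def xNorm {F : Type*} [NormedAddCommGroup F] (q : ℝ) (f : E3 → F) : ℝ≥0∞ :=
  (∫⁻ x : E3, (‖f x‖₊ : ℝ≥0∞) ^ q) ^ (1/q)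

/-- The mixed norm `‖u‖_{L^p_t L^q_x (I × ℝ³)}` for finite `p, q`. -/
def mixNorm (p q : ℝ) (I : Set ℝ) (u : ℝ → E3 → ℝ) : ℝ≥0∞ :=
  (∫⁻ t in I, (xNorm q (u t)) ^ p) ^ (1/p)

/-- The mixed norm `‖u‖_{L^∞_t L^q_x (I × ℝ³)}` (essential supremum in time). -/
def supNorm (q : ℝ) (I : Set ℝ) (u : ℝ → E3 → ℝ) : ℝ≥0∞ :=
  essSup (fun t => xNorm q (u t)) (volume.restrict I)

/-- The homogeneous Sobolev norm `‖f‖_{Ḣ^s} = (∫ |ξ|^{2s} |𝓕f(ξ)|² dξ)^{1/2}`. -/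
def sobNorm (s : ℝ) (f : E3 → ℝ) : ℝ≥0∞ :=
  (∫⁻ ξ : E3, (‖ξ‖₊ : ℝ≥0∞) ^ (2*s) *
    (‖𝓕 (fun x => (f x : ℂ)) ξ‖₊ : ℝ≥0∞) ^ (2:ℝ)) ^ ((1:ℝ)/2)

/-- The a priori bounds with constant `A`:
`‖u(t)‖_{L²} ≤ A`, `‖∂ₜu(t)‖_{Ḣ⁻¹} ≤ A`, `‖u(t)‖_{Ḣ²} ≤ A`, `‖∂ₜu(t)‖_{Ḣ¹} ≤ A` for all `t`. -/
def APriori (u : ℝ → E3 → ℝ) (A : ℝ) : Prop :=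
  ∀ t : ℝ, xNorm 2 (u t) ≤ ENNReal.ofReal A ∧ sobNorm (-1) (tderiv u t) ≤ ENNReal.ofReal A ∧
    sobNorm 2 (u t) ≤ ENNReal.ofReal A ∧ sobNorm 1 (tderiv u t) ≤ ENNReal.ofReal A

/-- The integral of `f` over the sphere of radius `r` about `x`, with respect to
two-dimensional Hausdorff (surface) measure. -/
def sphInt (x : E3) (r : ℝ) (f : E3 → ℝ) : ℝ := ∫ y in Metric.sphere x r, f y ∂(μH[2])

/-- The free wave evolution `S(t)(g, h)` given by Kirchhoff's formula. -/
def freeWave (g h : E3 → ℝ) (t : ℝ) (x : E3) : ℝ :=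
  if t = 0 then g x
  else deriv (fun s => (1/(4*π*s)) * sphInt x s g) t + (1/(4*π*t)) * sphInt x t h

/-- The Duhamel integral `D_{[s₁,s₂]}u(t,x) = ∫_{s₁}^{s₂} S(t−τ)(0, u(τ)⁵) dτ`,
written via Kirchhoff's formula. -/
def duh (u : ℝ → E3 → ℝ) (s₁ s₂ : ℝ) (t : ℝ) (x : E3) : ℝ :=
  ∫ τ in s₁..s₂, (1/(4*π*(t - τ))) * sphInt x (t - τ) (fun y => (u τ y) ^ 5)

/-- The unit coordinate vectors of `ℝ³`. -/
def bv (i : Fin 3) : E3 := EuclideanSpace.single i 1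

/-- The directional derivative of a function on spacetime. -/
def pd (v : ℝ × E3) (f : ℝ × E3 → ℝ) (p : ℝ × E3) : ℝ := fderiv ℝ f p v

/-- The time direction in spacetime. -/
def et : ℝ × E3 := (1, 0)

/-- The spatial coordinate directions in spacetime. -/
def ex (i : Fin 3) : ℝ × E3 := (0, bv i)

lemma contDiff_pd {f : ℝ × E3 → ℝ} (hf : ContDiff ℝ (⊤ : ℕ∞) f) (v : ℝ × E3) :
    ContDiff ℝ (⊤ : ℕ∞) (pd v f) := by
  unfold pd
  exact (hf.fderiv_right (m := (⊤ : ℕ∞)) (by simp)).clm_apply contDiff_const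

lemma pd_comm {f : ℝ × E3 → ℝ} (hf : ContDiff ℝ (⊤ : ℕ∞) f) (v w : ℝ × E3) (p : ℝ × E3) :
    pd v (pd w f) p = pd w (pd v f) p := by
  have hsymm : IsSymmSndFDerivAt ℝ f p :=
    (hf.contDiffAt).isSymmSndFDerivAt (by
      rw [minSmoothness_of_isRCLikeNormedField]
      exact WithTop.coe_le_coe.2 (le_top : (2 : ℕ∞) ≤ ⊤))
  have hd : DifferentiableAt ℝ (fderiv ℝ f) p :=
    (hf.fderiv_right (m := (⊤ : ℕ∞)) (by simp)).differentiable (by simp) p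
  have key : ∀ a b : ℝ × E3, pd a (pd b f) p = fderiv ℝ (fderiv ℝ f) p a b := by
    intro a b
    unfold pd
    rw [fderiv_clm_apply hd (by fun_prop)]
    simp
  rw [key, key]
  exact hsymm.eq v w

lemma hasFDerivAt_of_smooth {f : ℝ × E3 → ℝ} (hf : ContDiff ℝ (⊤ : ℕ∞) f) (p : ℝ × E3) :
    HasFDerivAt f (fderiv ℝ f p) p := (hf.differentiable (by simp) p).hasFDerivAt

lemma hasDerivAt_line {f : ℝ × E3 → ℝ} (hf : ContDiff ℝ (⊤ : ℕ∞) f) (v p : ℝ × E3) :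
    HasDerivAt (fun s : ℝ => f (p + s • v)) (pd v f p) 0 := by
  have h1 : HasDerivAt (fun s : ℝ => p + s • v) v 0 := by
    simpa using ((hasDerivAt_id (0:ℝ)).smul_const v).const_add p
  have h2 : HasFDerivAt f (fderiv ℝ f p) (p + (0:ℝ) • v) := by
    simpa using hasFDerivAt_of_smooth hf p
  exact h2.comp_hasDerivAt (0:ℝ) h1

lemma hasDerivAt_time {f : ℝ × E3 → ℝ} (hf : ContDiff ℝ (⊤ : ℕ∞) f) (t : ℝ) (x : E3) :
    HasDerivAt (fun s : ℝ => f (s, x)) (pd et f (t, x)) t := by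
  have h1 : HasDerivAt (fun s : ℝ => ((s, x) : ℝ × E3)) et t :=
    (hasDerivAt_id t).prodMk (hasDerivAt_const t x)
  exact (hasFDerivAt_of_smooth hf (t, x)).comp_hasDerivAt t h1

lemma hasFDerivAt_space {f : ℝ × E3 → ℝ} (hf : ContDiff ℝ (⊤ : ℕ∞) f) (t : ℝ) (x : E3) :
    HasFDerivAt (fun y : E3 => f (t, y))
      ((fderiv ℝ f (t, x)).comp (ContinuousLinearMap.inr ℝ ℝ E3)) x := by
  have h1 : HasFDerivAt (fun y : E3 => ((t, y) : ℝ × E3)) (ContinuousLinearMap.inr ℝ ℝ E3) x :=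
    hasFDerivAt_prodMk_right t x
  exact (hasFDerivAt_of_smooth hf (t, x)).comp x h1

lemma fderiv_space {f : ℝ × E3 → ℝ} (hf : ContDiff ℝ (⊤ : ℕ∞) f) (t : ℝ) (x : E3) (i : Fin 3) :
    fderiv ℝ (fun y : E3 => f (t, y)) x (bv i) = pd (ex i) f (t, x) := by
  rw [(hasFDerivAt_space hf t x).fderiv]
  simp [pd, ex]

section smooth
variable {u : ℝ → E3 → ℝ}

lemma IsNLW.contDiff (hu : IsNLW u) : ContDiff ℝ (⊤ : ℕ∞) (uncurry u) := by
  have := hu.1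
  rwa [univ_prod_univ, contDiffOn_univ] at this

lemma tderiv_eq (hu : ContDiff ℝ (⊤ : ℕ∞) (uncurry u)) (t : ℝ) (x : E3) :
    tderiv u t x = pd et (uncurry u) (t, x) :=
  (hasDerivAt_time hu t x).deriv

lemma tderiv2_eq (hu : ContDiff ℝ (⊤ : ℕ∞) (uncurry u)) (t : ℝ) (x : E3) :
    tderiv2 u t x = pd et (pd et (uncurry u)) (t, x) := by
  have h : (fun s => tderiv u s x) = fun s => pd et (uncurry u) (s, x) := by
    funext s; exact tderiv_eq hu s x
  unfold tderiv2
  rw [h]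
  exact (hasDerivAt_time (contDiff_pd hu et) t x).deriv

lemma contDiff_slice (hu : ContDiff ℝ (⊤ : ℕ∞) (uncurry u)) (t : ℝ) :
    ContDiff ℝ (⊤ : ℕ∞) (u t) :=
  hu.comp (contDiff_const.prodMk contDiff_id : ContDiff ℝ (⊤ : ℕ∞) fun y : E3 => (t, y))

lemma lap_eq (hu : ContDiff ℝ (⊤ : ℕ∞) (uncurry u)) (t : ℝ) (x : E3) :
    lap (u t) x = ∑ i : Fin 3, pd (ex i) (pd (ex i) (uncurry u)) (t, x) := by
  unfold lap
  refine Finset.sum_congr rfl fun i _ => ?_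
  rw [iteratedFDeriv_two_apply]
  simp only [Matrix.cons_val_zero, Matrix.cons_val_one]
  have hd : DifferentiableAt ℝ (fderiv ℝ (u t)) x :=
    ((contDiff_slice hu t).fderiv_right (m := (⊤ : ℕ∞)) (by simp)).differentiable (by simp) x
  have h1 : fderiv ℝ (fun y => fderiv ℝ (u t) y (bv i)) x (bv i)
      = fderiv ℝ (fderiv ℝ (u t)) x (bv i) (bv i) := by
    rw [fderiv_clm_apply hd (by fun_prop)]
    simp
  have h2 : (fun y => fderiv ℝ (u t) y (bv i)) = fun y => pd (ex i) (uncurry u) (t, y) := by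
    funext y
    exact fderiv_space hu t y i
  rw [h2] at h1
  rw [fderiv_space (contDiff_pd hu _) t x i] at h1
  exact h1.symm

lemma norm_sq_eq_sum (v : E3) : ‖v‖ ^ 2 = ∑ i : Fin 3, (v i) ^ 2 := by
  rw [EuclideanSpace.norm_sq_eq]
  simp

lemma norm_gradient_sq {f : E3 → ℝ} (x : E3) (hf : DifferentiableAt ℝ f x) :
    ‖gradient f x‖ ^ 2 = ∑ i : Fin 3, (fderiv ℝ f x (bv i)) ^ 2 := by
  rw [norm_sq_eq_sum]
  refine Finset.sum_congr rfl fun i _ => ?_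
  congr 1
  have h := hf.hasGradientAt.hasFDerivAt.fderiv
  rw [h, InnerProductSpace.toDual_apply_apply, bv, EuclideanSpace.inner_single_right]
  simp only [one_mul, conj_trivial]

lemma nlw_eq (hu : IsNLW u) (t : ℝ) (x : E3) :
    pd et (pd et (uncurry u)) (t, x) =
      (∑ i : Fin 3, pd (ex i) (pd (ex i) (uncurry u)) (t, x)) - (u t x) ^ 5 := by
  have h := hu.2.2 t (mem_univ _) x
  rw [tderiv2_eq hu.contDiff, lap_eq hu.contDiff] at h
  linarith

/-- The energy density. -/
def edens (u : ℝ → E3 → ℝ) (t : ℝ) (x : E3) : ℝ :=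
  (1/2) * (pd et (uncurry u) (t, x)) ^ 2 + (1/2) * (∑ i : Fin 3, (pd (ex i) (uncurry u) (t, x)) ^ 2)
    + (1/6) * (u t x) ^ 6

lemma edens_nonneg (t : ℝ) (x : E3) : 0 ≤ edens u t x := by
  unfold edens
  have : 0 ≤ ∑ i : Fin 3, (pd (ex i) (uncurry u) (t, x)) ^ 2 :=
    Finset.sum_nonneg fun i _ => sq_nonneg _
  positivity

lemma energy_eq (hu : ContDiff ℝ (⊤ : ℕ∞) (uncurry u)) (t : ℝ) :
    energy u t = ∫ x, edens u t x := by
  unfold energy edens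
  refine integral_congr_ae (Filter.Eventually.of_forall fun x => ?_)
  simp only
  rw [tderiv_eq hu, norm_gradient_sq x ((contDiff_slice hu t).differentiable (by simp) x)]
  congr 4
  funext i
  rw [← fderiv_space hu t x i]
  rfl

lemma continuous_edens (hu : ContDiff ℝ (⊤ : ℕ∞) (uncurry u)) :
    Continuous (uncurry (edens u)) := by
  unfold edens uncurry
  have h0 := (contDiff_pd hu et).continuous
  have h1 := fun i => (contDiff_pd hu (ex i)).continuous
  have h2 : Continuous fun p : ℝ × E3 => u p.1 p.2 := hu.continuous
  simp only [Prod.mk.eta]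
  fun_prop

end smooth

/-- The Schwartz map attached to a function satisfying `IsSchwartz`. -/
def IsSchwartz.toMap {f : E3 → ℝ} (hf : IsSchwartz f) : SchwartzMap E3 ℝ where
  toFun := f
  smooth' := hf.1
  decay' := hf.2

lemma IsSchwartz.integrable_sq {f : E3 → ℝ} (hf : IsSchwartz f) : Integrable fun x => (f x) ^ 2 := by
  have h := (hf.toMap.memLp 2 volume)
  exact h.integrable_sq

lemma IsSchwartz.fderiv_apply {f : E3 → ℝ} (hf : IsSchwartz f) (v : E3) :
    IsSchwartz fun x => fderiv ℝ f x v := by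
  have h : (fun x => fderiv ℝ f x v) = (SchwartzMap.evalCLM ℝ E3 ℝ v (SchwartzMap.fderivCLM ℝ E3 ℝ hf.toMap) : SchwartzMap E3 ℝ) := by
    funext x
    rfl
  rw [h]
  exact ⟨SchwartzMap.smooth _ _, SchwartzMap.decay' _⟩

lemma IsSchwartz.tendsto_zero {f : E3 → ℝ} (hf : IsSchwartz f) :
    Filter.Tendsto f (Filter.cocompact E3) (nhds 0) :=
  zero_at_infty (hf.toMap.toZeroAtInfty)

lemma IsSchwartz.integrable_pow_six {f : E3 → ℝ} (hf : IsSchwartz f) :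
    Integrable fun x => (f x) ^ 6 := by
  have h := (hf.toMap.memLp 6 volume).integrable_norm_rpow (by simp) (by simp)
  refine h.congr (Filter.Eventually.of_forall fun x => ?_)
  simp only [ENNReal.toReal_ofNat]
  have : (6:ℝ) = ((6:ℕ):ℝ) := by norm_num
  rw [this, Real.rpow_natCast, Real.norm_eq_abs, Even.pow_abs (by decide)]
  rfl

section energy
variable {u : ℝ → E3 → ℝ}

lemma IsNLW.isSchwartz_ex (hu : IsNLW u) (t : ℝ) (i : Fin 3) :
    IsSchwartz fun x => pd (ex i) (uncurry u) (t, x) := by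
  have h := (hu.2.1 t (mem_univ _)).1.fderiv_apply (bv i)
  have h2 : (fun y => fderiv ℝ (u t) y (bv i)) = fun y => pd (ex i) (uncurry u) (t, y) := by
    funext y
    exact fderiv_space hu.contDiff t y i
  rwa [h2] at h

lemma IsNLW.isSchwartz_et (hu : IsNLW u) (t : ℝ) :
    IsSchwartz fun x => pd et (uncurry u) (t, x) := by
  have h := (hu.2.1 t (mem_univ _)).2
  have h2 : tderiv u t = fun y => pd et (uncurry u) (t, y) := by
    funext y
    exact tderiv_eq hu.contDiff t y
  rwa [h2] at h

lemma IsNLW.integrable_edens (hu : IsNLW u) (t : ℝ) : Integrable fun x => edens u t x := by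
  unfold edens
  refine ((((hu.isSchwartz_et t).integrable_sq.const_mul _).add
    ((integrable_finsetSum _ fun i _ => (hu.isSchwartz_ex t i).integrable_sq).const_mul _)).add
    (((hu.2.1 t (mem_univ _)).1.integrable_pow_six).const_mul _))

lemma IsNLW.lintegral_edens_le (hu : IsNLW u) {E : ℝ} (hE : ∀ t, energy u t ≤ E) (t : ℝ) :
    ∫⁻ x, ENNReal.ofReal (edens u t x) ≤ ENNReal.ofReal E := by
  rw [← ofReal_integral_eq_lintegral_ofReal (hu.integrable_edens t)
    (Filter.Eventually.of_forall fun x => edens_nonneg t x), ← energy_eq hu.contDiff]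
  exact ENNReal.ofReal_le_ofReal (hE t)

lemma APriori.lintegral_sq_le {A : ℝ} (hA : 0 ≤ A) (h : APriori u A) (t : ℝ) :
    ∫⁻ x, ENNReal.ofReal ((u t x) ^ 2) ≤ ENNReal.ofReal (A ^ 2) := by
  have h1 := (h t).1
  unfold xNorm at h1
  have h2 := ENNReal.rpow_le_rpow h1 (show (0:ℝ) ≤ 2 by norm_num)
  rw [← ENNReal.rpow_mul] at h2
  norm_num at h2
  calc ∫⁻ x, ENNReal.ofReal ((u t x) ^ 2) = ∫⁻ x, (‖u t x‖₊ : ℝ≥0∞) ^ 2 := by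
        refine lintegral_congr fun x => ?_
        rw [← enorm_eq_nnnorm, ← ofReal_norm, ← ENNReal.ofReal_pow (norm_nonneg _),
          Real.norm_eq_abs, sq_abs]
    _ ≤ _ := by
        rw [ENNReal.ofReal_pow hA]
        simpa [enorm_eq_nnnorm] using h2

end energy

/-- The point of `ℝ³` with `i`-th coordinate `s` and remaining coordinates `y`. -/
def ins (i : Fin 3) (s : ℝ) (y : Fin 2 → ℝ) : E3 :=
  WithLp.toLp 2 (Fin.insertNth (α := fun _ => ℝ) i s y)

lemma ins_same (i : Fin 3) (s : ℝ) (y : Fin 2 → ℝ) : ins i s y i = s := by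
  simp [ins]

lemma ins_succAbove (i : Fin 3) (s : ℝ) (y : Fin 2 → ℝ) (j : Fin 2) :
    ins i s y (i.succAbove j) = y j := by
  simp [ins]

lemma ins_self (i : Fin 3) (z : E3) : ins i (z i) (fun j => z (i.succAbove j)) = z := by
  ext k
  rcases Fin.eq_self_or_eq_succAbove i k with h | ⟨j, h⟩
  · rw [h, ins_same]
  · rw [h, ins_succAbove]

lemma norm_sq_succAbove (i : Fin 3) (z : E3) :
    ‖z‖ ^ 2 = (z i) ^ 2 + ((z (i.succAbove 0)) ^ 2 + (z (i.succAbove 1)) ^ 2) := by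
  rw [norm_sq_eq_sum, Fin.sum_univ_succAbove _ i, Fin.sum_univ_two]

lemma continuous_ins (i : Fin 3) : Continuous fun p : ℝ × (Fin 2 → ℝ) => ins i p.1 p.2 := by
  unfold ins
  refine (PiLp.continuous_toLp 2 _).comp (continuous_pi fun k => ?_)
  rcases Fin.eq_self_or_eq_succAbove i k with h | ⟨j, h⟩
  · rw [h]; simpa using continuous_fst
  · rw [h]; simpa using! (continuous_apply j).comp continuous_snd

lemma ins_add_smul (i : Fin 3) (s r : ℝ) (y : Fin 2 → ℝ) :
    ins i s y + r • bv i = ins i (s + r) y := by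
  ext k
  rcases Fin.eq_self_or_eq_succAbove i k with h | ⟨j, h⟩
  · rw [h, ins_same]; simp [ins_same, bv]
  · rw [h, ins_succAbove]; simp [ins_succAbove, bv]

lemma lintegral_eq_ins (i : Fin 3) {f : E3 → ℝ≥0∞} (hf : Measurable f) :
    ∫⁻ z, f z = ∫⁻ y : Fin 2 → ℝ, ∫⁻ s : ℝ, f (ins i s y) := by
  have h1 := (PiLp.volume_preserving_toLp (Fin 3)).lintegral_comp hf
  have h2 := (volume_preserving_piFinSuccAbove (fun _ : Fin 3 => ℝ) i).symm
  have h3 := h2.lintegral_comp (hf.comp (MeasurableEquiv.toLp 2 (Fin 3 → ℝ)).measurable)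
  rw [← h1]
  have h4 : ∫⁻ a : Fin 3 → ℝ, f (WithLp.toLp 2 a) = ∫⁻ p : ℝ × (Fin 2 → ℝ), f (ins i p.1 p.2) :=
    h3.symm
  rw [h4, Measure.volume_eq_prod, lintegral_prod_symm]
  exact (hf.comp (continuous_ins i).measurable).aemeasurable

/-- The disc parametrizing a cap of the sphere of radius `r`. -/
def capDisc (r : ℝ) : Set (Fin 2 → ℝ) := {y | (y 0) ^ 2 + (y 1) ^ 2 ≤ 3 / 4 * r ^ 2}

/-- The graph parametrization of a cap of the sphere of radius `r`. -/
def capMap (r : ℝ) (i : Fin 3) (σ : ℝ) (y : Fin 2 → ℝ) : E3 :=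
  ins i (σ * √(r ^ 2 - ((y 0) ^ 2 + (y 1) ^ 2))) y

lemma continuous_capMap (r : ℝ) (i : Fin 3) (σ : ℝ) : Continuous (capMap r i σ) :=
  (continuous_ins i).comp (f := fun y : Fin 2 → ℝ =>
    (σ * √(r ^ 2 - ((y 0) ^ 2 + (y 1) ^ 2)), y)) (by fun_prop)

lemma volume_capDisc_le {r : ℝ} (hr : 0 < r) :
    volume (capDisc r) ≤ ENNReal.ofReal (4 * r ^ 2) := by
  have hsub : capDisc r ⊆ Metric.closedBall (0 : Fin 2 → ℝ) r := by
    intro y hy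
    simp only [capDisc, Set.mem_ofPred_eq] at hy
    rw [mem_closedBall_zero_iff, pi_norm_le_iff_of_nonneg hr.le]
    intro j
    rw [Real.norm_eq_abs]
    apply abs_le_of_sq_le_sq _ hr.le
    fin_cases j
    · simp only [Fin.zero_eta]; nlinarith [sq_nonneg (y 1), sq_nonneg r]
    · simp only [Fin.mk_one]; nlinarith [sq_nonneg (y 0), sq_nonneg r]
  refine (measure_mono hsub).trans ?_
  rw [Real.volume_pi_closedBall _ hr.le]
  apply ENNReal.ofReal_le_ofReal
  simp
  nlinarith

lemma cap_slope_aux {r σ a b y0 y1 z0 z1 N : ℝ} (hr : 0 < r) (hσ : σ ^ 2 = 1)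
    (ha2 : a ^ 2 = r ^ 2 - (y0 ^ 2 + y1 ^ 2)) (hb2 : b ^ 2 = r ^ 2 - (z0 ^ 2 + z1 ^ 2))
    (ha0 : r / 2 ≤ a) (hb0 : r / 2 ≤ b) (hy : y0 ^ 2 + y1 ^ 2 ≤ 3 / 4 * r ^ 2)
    (hz : z0 ^ 2 + z1 ^ 2 ≤ 3 / 4 * r ^ 2) (e0 : (y0 - z0) ^ 2 ≤ N ^ 2)
    (e1 : (y1 - z1) ^ 2 ≤ N ^ 2) :
    (σ * a - σ * b) ^ 2 + ((y0 - z0) ^ 2 + (y1 - z1) ^ 2) ≤ (3 * N) ^ 2 := by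
  have hprod : (a - b) * (a + b) = (z0 - y0) * (z0 + y0) + (z1 - y1) * (z1 + y1) := by
    linear_combination ha2 - hb2
  have hcs : ((a - b) * (a + b)) ^ 2 ≤
      ((z0 - y0) ^ 2 + (z1 - y1) ^ 2) * ((z0 + y0) ^ 2 + (z1 + y1) ^ 2) := by
    rw [hprod]
    nlinarith [sq_nonneg ((z0 - y0) * (z1 + y1) - (z1 - y1) * (z0 + y0))]
  have hs : (z0 + y0) ^ 2 + (z1 + y1) ^ 2 ≤ 3 * r ^ 2 := by
    linarith [sq_nonneg (z0 - y0), sq_nonneg (z1 - y1)]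
  have hab : r ^ 2 ≤ (a + b) ^ 2 := pow_le_pow_left₀ hr.le (by linarith) 2
  have hD : (z0 - y0) ^ 2 + (z1 - y1) ^ 2 ≤ 2 * N ^ 2 := by linarith
  have h1 : (a - b) ^ 2 * r ^ 2 ≤ (2 * N ^ 2) * (3 * r ^ 2) := by
    calc (a - b) ^ 2 * r ^ 2 ≤ (a - b) ^ 2 * (a + b) ^ 2 := by gcongr
      _ = ((a - b) * (a + b)) ^ 2 := by ring
      _ ≤ _ := hcs
      _ ≤ _ := by gcongr
  have hr2 : 0 < r ^ 2 := by positivity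
  have h2 : (a - b) ^ 2 ≤ 6 * N ^ 2 := le_of_mul_le_mul_right (by linarith) hr2
  have : (σ * a - σ * b) ^ 2 = (a - b) ^ 2 := by
    linear_combination (a - b) ^ 2 * hσ
  rw [this]
  linarith [sq_nonneg N]

lemma lipschitzOnWith_capMap {r : ℝ} (hr : 0 < r) (i : Fin 3) {σ : ℝ} (hσ : σ ^ 2 = 1) :
    LipschitzOnWith 3 (capMap r i σ) (capDisc r) := by
  refine LipschitzOnWith.of_dist_le_mul fun y hy z hz => ?_
  simp only [capDisc, Set.mem_ofPred_eq] at hy hz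
  rw [dist_eq_norm, dist_eq_norm]
  have hd0 : |(y - z) 0| ≤ ‖y - z‖ := norm_le_pi_norm (y - z) 0
  have hd1 : |(y - z) 1| ≤ ‖y - z‖ := norm_le_pi_norm (y - z) 1
  have e0 : ((y - z) 0) ^ 2 ≤ ‖y - z‖ ^ 2 := by
    rw [← sq_abs]; exact pow_le_pow_left₀ (abs_nonneg _) hd0 2
  have e1 : ((y - z) 1) ^ 2 ≤ ‖y - z‖ ^ 2 := by
    rw [← sq_abs]; exact pow_le_pow_left₀ (abs_nonneg _) hd1 2
  simp only [Pi.sub_apply] at e0 e1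
  have hsq : ‖capMap r i σ y - capMap r i σ z‖ ^ 2 ≤ (3 * ‖y - z‖) ^ 2 := by
    rw [norm_sq_succAbove i]
    simp only [PiLp.sub_apply, capMap, ins_same, ins_succAbove]
    set a := √(r ^ 2 - ((y 0) ^ 2 + (y 1) ^ 2)) with ha
    set b := √(r ^ 2 - ((z 0) ^ 2 + (z 1) ^ 2)) with hb
    have ha2 : a ^ 2 = r ^ 2 - ((y 0) ^ 2 + (y 1) ^ 2) := Real.sq_sqrt (by nlinarith [sq_nonneg r])
    have hb2 : b ^ 2 = r ^ 2 - ((z 0) ^ 2 + (z 1) ^ 2) := Real.sq_sqrt (by nlinarith [sq_nonneg r])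
    have ha0 : r / 2 ≤ a := Real.le_sqrt_of_sq_le (by nlinarith)
    have hb0 : r / 2 ≤ b := Real.le_sqrt_of_sq_le (by nlinarith)
    exact cap_slope_aux hr hσ ha2 hb2 ha0 hb0 hy hz e0 e1
  have := abs_le_of_sq_le_sq' hsq (by positivity)
  exact_mod_cast this.2

/-- The part of the sphere of radius `r` about the origin covered by a cap. -/
def sphCap (r : ℝ) (i : Fin 3) (σ : ℝ) : Set E3 :=
  {z | ‖z‖ = r ∧ r / 2 ≤ σ * z i}

lemma capMap_mem {r : ℝ} (hr : 0 < r) {i : Fin 3} {σ : ℝ} (hσ : σ ^ 2 = 1) {z : E3}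
    (hz : z ∈ sphCap r i σ) :
    (fun j => z (i.succAbove j)) ∈ capDisc r ∧ capMap r i σ (fun j => z (i.succAbove j)) = z := by
  obtain ⟨h1, h2⟩ := hz
  have h3 := norm_sq_succAbove i z
  rw [h1] at h3
  have h5 : r ^ 2 - ((z (i.succAbove 0)) ^ 2 + (z (i.succAbove 1)) ^ 2) = (σ * z i) ^ 2 := by
    linear_combination h3 - (z i) ^ 2 * hσ
  constructor
  · simp only [capDisc, Set.mem_ofPred_eq]
    nlinarith
  · unfold capMap
    simp only
    rw [h5, Real.sqrt_sq (by linarith)]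
    have : σ * (σ * z i) = z i := by linear_combination (z i) * hσ
    rw [this]
    exact ins_self i z

lemma sphere_restrict_cap_le {r : ℝ} (hr : 0 < r) (i : Fin 3) {σ : ℝ} (hσ : σ ^ 2 = 1) :
    (μH[2] : Measure E3).restrict (sphCap r i σ) ≤
      (9 : ℝ≥0∞) • ((volume.restrict (capDisc r)).map (capMap r i σ)) := by
  refine Measure.le_iff.2 fun A hA => ?_
  rw [Measure.restrict_apply hA, Measure.smul_apply,
    Measure.map_apply (continuous_capMap r i σ).measurable hA,
    Measure.restrict_apply ((continuous_capMap r i σ).measurable hA), smul_eq_mul]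
  have hsub : A ∩ sphCap r i σ ⊆ capMap r i σ '' (capMap r i σ ⁻¹' A ∩ capDisc r) := by
    rintro z ⟨hzA, hz⟩
    obtain ⟨h1, h2⟩ := capMap_mem hr hσ hz
    exact ⟨_, ⟨by rw [mem_preimage, h2]; exact hzA, h1⟩, h2⟩
  refine (measure_mono hsub).trans ?_
  have h := ((lipschitzOnWith_capMap hr i hσ).mono
    (inter_subset_right (s := capMap r i σ ⁻¹' A))).hausdorffMeasure_image_le
    (d := 2) (by norm_num)
  have hv : (μH[2] : Measure (Fin 2 → ℝ)) = volume := by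
    have := hausdorffMeasure_pi_real (ι := Fin 2)
    simpa using this
  rw [hv] at h
  refine h.trans (le_of_eq ?_)
  norm_num

lemma sphere_subset_caps {r : ℝ} (hr : 0 < r) :
    Metric.sphere (0 : E3) r ⊆ ⋃ i : Fin 3, (sphCap r i 1 ∪ sphCap r i (-1)) := by
  intro z hz
  rw [mem_sphere_zero_iff_norm] at hz
  by_contra hcon
  simp only [mem_iUnion, mem_union, sphCap, Set.mem_ofPred_eq, not_exists, not_or, not_and,
    not_le] at hcon
  have h := norm_sq_eq_sum z
  rw [hz, Fin.sum_univ_three] at h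
  have hb : ∀ i, (z i) ^ 2 ≤ (r / 2) ^ 2 := by
    intro i
    have h1 := (hcon i).1 hz
    have h2 := (hcon i).2 hz
    exact sq_le_sq' (by linarith) (by linarith)
  nlinarith [hb 0, hb 1, hb 2]

lemma lintegral_sphere_le {r : ℝ} (hr : 0 < r) {f : E3 → ℝ≥0∞} (hf : Measurable f) :
    ∫⁻ z in Metric.sphere (0 : E3) r, f z ∂(μH[2]) ≤
      9 * ∑ i : Fin 3, ((∫⁻ y in capDisc r, f (capMap r i 1 y)) +
        ∫⁻ y in capDisc r, f (capMap r i (-1) y)) := by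
  have hcap : ∀ (i : Fin 3) (σ : ℝ), σ ^ 2 = 1 → ∫⁻ z in sphCap r i σ, f z ∂(μH[2]) ≤
      9 * ∫⁻ y in capDisc r, f (capMap r i σ y) := by
    intro i σ hσ
    refine (lintegral_mono' (sphere_restrict_cap_le hr i hσ) le_rfl).trans (le_of_eq ?_)
    rw [lintegral_smul_measure, lintegral_map hf (continuous_capMap r i σ).measurable, smul_eq_mul]
  calc _ ≤ ∫⁻ z in ⋃ i : Fin 3, (sphCap r i 1 ∪ sphCap r i (-1)), f z ∂(μH[2]) :=
        lintegral_mono_set (sphere_subset_caps hr)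
    _ ≤ ∑' i : Fin 3, ∫⁻ z in (sphCap r i 1 ∪ sphCap r i (-1)), f z ∂(μH[2]) :=
        lintegral_iUnion_le _ _
    _ = ∑ i : Fin 3, ∫⁻ z in (sphCap r i 1 ∪ sphCap r i (-1)), f z ∂(μH[2]) := tsum_fintype _
    _ ≤ ∑ i : Fin 3, (9 * (∫⁻ y in capDisc r, f (capMap r i 1 y)) +
        9 * ∫⁻ y in capDisc r, f (capMap r i (-1) y)) := by
        refine Finset.sum_le_sum fun i _ => ?_
        refine (lintegral_union_le _ _ _).trans ?_
        exact add_le_add (hcap i 1 (by norm_num)) (hcap i (-1) (by norm_num))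
    _ = _ := by
        rw [Finset.mul_sum]
        simp only [mul_add]

lemma hausdorffMeasure_sphere_le {r : ℝ} (hr : 0 < r) :
    (μH[2] : Measure E3) (Metric.sphere 0 r) ≤ ENNReal.ofReal (216 * r ^ 2) := by
  have h := lintegral_sphere_le hr (f := fun _ => 1) measurable_const
  simp only [lintegral_const, Measure.restrict_apply_univ, one_mul] at h
  refine h.trans ?_
  have hv := volume_capDisc_le hr
  calc _ ≤ 9 * ∑ i : Fin 3, (ENNReal.ofReal (4 * r ^ 2) + ENNReal.ofReal (4 * r ^ 2)) := by
        gcongr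
    _ = _ := by
        rw [← ENNReal.ofReal_add (by positivity) (by positivity)]
        simp only [Finset.sum_const, Finset.card_univ, Fintype.card_fin, nsmul_eq_mul]
        rw [← mul_assoc]
        have : (9:ℝ≥0∞) * ((3:ℕ):ℝ≥0∞) = ENNReal.ofReal 27 := by norm_num
        rw [this, ← ENNReal.ofReal_mul (by norm_num)]
        congr 1; ring

/-- A function vanishing at infinity is bounded by the integral of a directional derivative. -/
lemma enorm_le_lintegral_line {F : E3 → ℝ} (hF : ContDiff ℝ 1 F)
    (h0 : Filter.Tendsto F (Filter.cocompact E3) (nhds 0)) (i : Fin 3) (s₀ : ℝ) (y : Fin 2 → ℝ) :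
    ‖F (ins i s₀ y)‖ₑ ≤ ∫⁻ s : ℝ, ‖fderiv ℝ F (ins i s y) (bv i)‖ₑ := by
  have hline : ∀ s, HasDerivAt (fun s => ins i s y) (bv i) s := by
    intro s
    have h1 : (fun s => ins i s y) = fun s => ins i 0 y + s • bv i := by
      funext s; rw [ins_add_smul, zero_add]
    rw [h1]
    simpa using ((hasDerivAt_id s).smul_const (bv i)).const_add (ins i 0 y)
  have hd : ∀ s, HasDerivAt (fun s => F (ins i s y)) (fderiv ℝ F (ins i s y) (bv i)) s := fun s =>
    ((hF.differentiable (by simp) _).hasFDerivAt).comp_hasDerivAt s (hline s)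
  have hc : ContDiff ℝ 1 fun s => F (ins i s y) := by
    have h1 : (fun s => F (ins i s y)) = fun s : ℝ => F (ins i 0 y + s • bv i) := by
      funext s; rw [ins_add_smul, zero_add]
    rw [h1]
    fun_prop
  have htend : Filter.Tendsto (fun s => ins i s y) Filter.atTop (Filter.cocompact E3) := by
    rw [← Metric.cobounded_eq_cocompact, ← tendsto_norm_atTop_iff_cobounded]
    refine Filter.tendsto_atTop_mono (fun s => ?_) Filter.tendsto_id
    calc s ≤ |s| := le_abs_self s
      _ = ‖ins i s y i‖ := by rw [ins_same, Real.norm_eq_abs]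
      _ ≤ _ := PiLp.norm_apply_le _ i
  have hlim : Filter.Tendsto (fun b => ‖F (ins i b y) - F (ins i s₀ y)‖ₑ) Filter.atTop
      (nhds ‖0 - F (ins i s₀ y)‖ₑ) :=
    ((h0.comp htend).sub_const _).enorm
  rw [zero_sub, enorm_neg] at hlim
  refine le_of_tendsto hlim ?_
  filter_upwards [Filter.eventually_ge_atTop s₀] with b hb
  refine (enorm_sub_le_lintegral_deriv_of_contDiffOn_Icc hc.contDiffOn hb).trans ?_
  refine (setLIntegral_le_lintegral _ _).trans (le_of_eq ?_)
  exact lintegral_congr fun s => by rw [(hd s).deriv]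

/-- Trace bound on spheres by the full gradient in `L¹`. -/
lemma lintegral_sphere_le_grad {r : ℝ} (hr : 0 < r) {F : E3 → ℝ} (hF : ContDiff ℝ 1 F)
    (h0 : Filter.Tendsto F (Filter.cocompact E3) (nhds 0)) :
    ∫⁻ z in Metric.sphere (0 : E3) r, ‖F z‖ₑ ∂(μH[2]) ≤
      18 * ∑ i : Fin 3, ∫⁻ z, ‖fderiv ℝ F z (bv i)‖ₑ := by
  have hcont : Continuous (fderiv ℝ F) := hF.continuous_fderiv (by simp)
  refine (lintegral_sphere_le hr hF.continuous.enorm.measurable).trans ?_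
  have hb : ∀ (i : Fin 3) (σ : ℝ), ∫⁻ y in capDisc r, ‖F (capMap r i σ y)‖ₑ ≤
      ∫⁻ z, ‖fderiv ℝ F z (bv i)‖ₑ := by
    intro i σ
    rw [lintegral_eq_ins i (by fun_prop)]
    refine (setLIntegral_le_lintegral _ _).trans (lintegral_mono fun y => ?_)
    exact enorm_le_lintegral_line hF h0 i _ y
  calc _ ≤ 9 * ∑ i : Fin 3, ((∫⁻ z, ‖fderiv ℝ F z (bv i)‖ₑ) + ∫⁻ z, ‖fderiv ℝ F z (bv i)‖ₑ) := by
        gcongr 9 * ∑ i : Fin 3, ?_ with i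
        exact add_le_add (hb i 1) (hb i (-1))
    _ = _ := by
        rw [Finset.sum_add_distrib, ← two_mul, ← mul_assoc]
        norm_num

open scoped Pointwise in
/-- Rescaling of surface integrals to the unit sphere. -/
lemma lintegral_sphere_scale {r : ℝ} (hr : 0 < r) (x : E3) (f : E3 → ℝ≥0∞) :
    ∫⁻ y in Metric.sphere x r, f y ∂(μH[2]) =
      ENNReal.ofReal (r ^ 2) * ∫⁻ z in Metric.sphere (0 : E3) 1, f (x + r • z) ∂(μH[2]) := by
  let e : E3 ≃ₜ E3 := (Homeomorph.smulOfNeZero r hr.ne').trans (Homeomorph.addLeft x)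
  have he : ∀ z, e z = x + r • z := fun z => rfl
  have hpre : e ⁻¹' (Metric.sphere x r) = Metric.sphere 0 1 := by
    ext z
    simp only [mem_preimage, he, mem_sphere_iff_norm, add_sub_cancel_left, norm_smul, sub_zero,
      Real.norm_eq_abs, abs_of_pos hr]
    constructor
    · intro h; field_simp at h; exact h
    · intro h; rw [h, mul_one]
  have hμ : (μH[2] : Measure E3) = ENNReal.ofReal (r ^ 2) • (μH[2] : Measure E3).map e := by
    ext s hs
    rw [Measure.smul_apply, Measure.map_apply e.continuous.measurable hs, smul_eq_mul]
    have h1 : s = (IsometryEquiv.addLeft x) '' (r • (e ⁻¹' s)) := by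
      ext z
      constructor
      · intro hz
        refine ⟨z - x, ?_, by simp⟩
        refine ⟨r⁻¹ • (z - x), ?_, ?_⟩
        · simp only [mem_preimage, he, smul_inv_smul₀ hr.ne']
          simpa using hz
        · simp [smul_inv_smul₀ hr.ne']
      · rintro ⟨w, ⟨v, hv, rfl⟩, rfl⟩
        simpa [he] using hv
    conv_lhs => rw [h1]
    rw [IsometryEquiv.hausdorffMeasure_image, Measure.hausdorffMeasure_smul₀ (by norm_num) hr.ne']
    rw [ENNReal.smul_def, smul_eq_mul]
    congr 1
    rw [ENNReal.ofReal, ENNReal.coe_inj]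
    ext
    simp [Real.toNNReal_of_nonneg (sq_nonneg r)]
  conv_lhs => rw [hμ]
  rw [Measure.restrict_smul, lintegral_smul_measure, smul_eq_mul]
  congr 1
  rw [Measure.restrict_map e.continuous.measurable Metric.isClosed_sphere.measurableSet, hpre]
  exact lintegral_map_equiv f e.toMeasurableEquiv

lemma lintegral_mul_sq_le {α : Type*} [MeasurableSpace α] (μ : Measure α) {f g : α → ℝ≥0∞}
    (hf : AEMeasurable f μ) (hg : AEMeasurable g μ) :
    (∫⁻ x, f x * g x ∂μ) ^ 2 ≤ (∫⁻ x, f x ^ 2 ∂μ) * ∫⁻ x, g x ^ 2 ∂μ := by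
  have h := ENNReal.lintegral_mul_le_Lp_mul_Lq μ Real.HolderConjugate.two_two hf hg
  have h2 := pow_le_pow_left' h 2
  refine h2.trans (le_of_eq ?_)
  rw [mul_pow, ← ENNReal.rpow_natCast, ← ENNReal.rpow_mul, ← ENNReal.rpow_natCast (_ ^ _),
    ← ENNReal.rpow_mul]
  norm_num

/-- Minkowski's integral inequality in `L⁸` for a kernel dominated by a product bound. -/
lemma lintegral_lintegral_pow_eight_le {α β : Type*} [MeasurableSpace α] [MeasurableSpace β]
    (μ : Measure α) (ν : Measure β) [IsFiniteMeasure μ] [SFinite ν] {k : α → β → ℝ≥0∞}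
    (hk : Measurable (uncurry k)) {w : α → ℝ≥0∞} (hw : Measurable w) (hw' : ∀ᵐ τ ∂μ, w τ ≠ ⊤)
    {K : ℝ≥0∞} (hK : K ≠ ⊤) (h : ∀ᵐ τ ∂μ, ∫⁻ x, k τ x ^ 8 ∂ν ≤ K * w τ ^ 8) :
    ∫⁻ x, (∫⁻ τ, k τ x ∂μ) ^ 8 ∂ν ≤ K * (∫⁻ τ, w τ ∂μ) ^ 8 := by
  have main : ∀ δ : ℝ≥0, 0 < δ → ∫⁻ x, (∫⁻ τ, k τ x ∂μ) ^ 8 ∂ν ≤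
      K * ((∫⁻ τ, w τ ∂μ) + δ * μ univ) ^ 8 := by
    intro δ hδ
    set v : α → ℝ≥0∞ := fun τ => w τ + δ with hv
    have hvm : Measurable v := hw.add_const _
    have hv0 : ∀ τ, v τ ≠ 0 := fun τ => by
      simp only [hv, ne_eq, add_eq_zero, ENNReal.coe_eq_zero, not_and]
      intro _; exact hδ.ne'
    have hvt : ∀ᵐ τ ∂μ, v τ ≠ ⊤ := by
      filter_upwards [hw'] with τ hτ
      exact ENNReal.add_ne_top.2 ⟨hτ, ENNReal.coe_ne_top⟩
    have hvint : ∫⁻ τ, v τ ∂μ = (∫⁻ τ, w τ ∂μ) + δ * μ univ := by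
      rw [hv, lintegral_add_right _ measurable_const, lintegral_const]
    have hpt : ∀ x, (∫⁻ τ, k τ x ∂μ) ^ 8 ≤
        (∫⁻ τ, v τ ^ (-7 : ℝ) * k τ x ^ 8 ∂μ) * (∫⁻ τ, v τ ∂μ) ^ 7 := by
      intro x
      have hkx : Measurable fun τ => k τ x := hk.comp (measurable_id.prodMk measurable_const)
      have hpq : Real.HolderConjugate 8 (8 / 7) := by
        rw [Real.holderConjugate_iff]; norm_num
      have hH := ENNReal.lintegral_mul_le_Lp_mul_Lq μ hpq
        (f := fun τ => v τ ^ (-(7 / 8) : ℝ) * k τ x) (g := fun τ => v τ ^ (7 / 8 : ℝ))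
        ((hvm.pow_const _).mul hkx).aemeasurable (hvm.pow_const _).aemeasurable
      have e1 : ∫⁻ τ, ((fun τ => v τ ^ (-(7 / 8) : ℝ) * k τ x) * fun τ => v τ ^ (7 / 8 : ℝ)) τ ∂μ
          = ∫⁻ τ, k τ x ∂μ := by
        refine lintegral_congr_ae ?_
        filter_upwards [hvt] with τ hτ
        simp only [Pi.mul_apply]
        rw [mul_right_comm, ← ENNReal.rpow_add _ _ (hv0 τ) hτ]
        simp
      have e2 : ∫⁻ τ, (v τ ^ (-(7 / 8) : ℝ) * k τ x) ^ (8 : ℝ) ∂μ =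
          ∫⁻ τ, v τ ^ (-7 : ℝ) * k τ x ^ 8 ∂μ := by
        refine lintegral_congr fun τ => ?_
        rw [ENNReal.mul_rpow_of_nonneg _ _ (by norm_num), ← ENNReal.rpow_mul,
          ← ENNReal.rpow_natCast (k τ x)]
        norm_num
      have e3 : ∫⁻ τ, (v τ ^ (7 / 8 : ℝ)) ^ (8 / 7 : ℝ) ∂μ = ∫⁻ τ, v τ ∂μ := by
        refine lintegral_congr fun τ => ?_
        rw [← ENNReal.rpow_mul]
        norm_num
      rw [e1, e2, e3] at hH
      refine (pow_le_pow_left' hH 8).trans (le_of_eq ?_)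
      rw [mul_pow, ← ENNReal.rpow_natCast, ← ENNReal.rpow_mul, ← ENNReal.rpow_natCast (_ ^ _),
        ← ENNReal.rpow_mul, ← ENNReal.rpow_natCast (∫⁻ τ, v τ ∂μ) 7]
      norm_num
    have hkm : Measurable fun p : α × β => v p.1 ^ (-7 : ℝ) * k p.1 p.2 ^ 8 :=
      ((hvm.comp measurable_fst).pow_const _).mul (hk.pow_const 8)
    calc ∫⁻ x, (∫⁻ τ, k τ x ∂μ) ^ 8 ∂ν
        ≤ ∫⁻ x, (∫⁻ τ, v τ ^ (-7 : ℝ) * k τ x ^ 8 ∂μ) * (∫⁻ τ, v τ ∂μ) ^ 7 ∂ν :=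
          lintegral_mono hpt
      _ = (∫⁻ x, ∫⁻ τ, v τ ^ (-7 : ℝ) * k τ x ^ 8 ∂μ ∂ν) * (∫⁻ τ, v τ ∂μ) ^ 7 := by
          rw [lintegral_mul_const]
          exact Measurable.lintegral_prod_left' (μ := μ) hkm
      _ = (∫⁻ τ, ∫⁻ x, v τ ^ (-7 : ℝ) * k τ x ^ 8 ∂ν ∂μ) * (∫⁻ τ, v τ ∂μ) ^ 7 := by
          rw [lintegral_lintegral_swap]
          exact (hkm.comp measurable_swap).aemeasurable
      _ ≤ (∫⁻ τ, K * v τ ∂μ) * (∫⁻ τ, v τ ∂μ) ^ 7 := by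
          gcongr ?_ * _
          refine lintegral_mono_ae ?_
          filter_upwards [h, hvt] with τ hτ hvτ
          rw [lintegral_const_mul _ ((hk.of_uncurry_left (x := τ)).pow_const 8)]
          calc v τ ^ (-7 : ℝ) * ∫⁻ x, k τ x ^ 8 ∂ν ≤ v τ ^ (-7 : ℝ) * (K * v τ ^ 8) := by
                gcongr
                exact hτ.trans (by gcongr; exact le_self_add)
            _ = K * (v τ ^ (-7 : ℝ) * v τ ^ (8 : ℝ)) := by
                rw [← ENNReal.rpow_natCast (v τ)]; push_cast; ring
            _ = K * v τ := by
                rw [← ENNReal.rpow_add _ _ (hv0 τ) hvτ]; norm_num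
      _ = K * (∫⁻ τ, v τ ∂μ) ^ 8 := by
          rw [lintegral_const_mul _ hvm]; ring
      _ = _ := by rw [hvint]
  have hcont : Filter.Tendsto (fun δ : ℝ≥0 => K * ((∫⁻ τ, w τ ∂μ) + δ * μ univ) ^ 8)
      (nhdsWithin 0 (Ioi 0)) (nhds (K * ((∫⁻ τ, w τ ∂μ) + (0 : ℝ≥0) * μ univ) ^ 8)) := by
    refine Filter.Tendsto.mono_left ?_ nhdsWithin_le_nhds
    refine Continuous.tendsto ?_ 0
    refine (ENNReal.continuous_const_mul hK).comp ((ENNReal.continuous_pow 8).comp ?_)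
    refine continuous_const.add ?_
    exact (ENNReal.continuous_mul_const (measure_ne_top μ univ)).comp ENNReal.continuous_coe
  simp only [ENNReal.coe_zero, zero_mul, add_zero] at hcont
  refine ge_of_tendsto hcont ?_
  filter_upwards [self_mem_nhdsWithin] with δ hδ
  exact main δ hδ

/-- The potential part `∫ |u(t,x)|⁶ dx` of the energy. -/
def pot (u : ℝ → E3 → ℝ) (t : ℝ) : ℝ≥0∞ := ∫⁻ x, ‖u t x‖ₑ ^ 6

/-- The surface measure of the unit sphere. -/
def sphMeas : Measure E3 := (μH[2]).restrict (Metric.sphere 0 1)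

lemma sphMeas_univ_le : sphMeas univ ≤ 216 := by
  unfold sphMeas
  rw [Measure.restrict_apply_univ]
  refine (hausdorffMeasure_sphere_le one_pos).trans (le_of_eq ?_)
  norm_num

instance : IsFiniteMeasure sphMeas :=
  ⟨sphMeas_univ_le.trans_lt (by norm_num)⟩

/-- Unnormalized spherical mean of `|u(τ)|⁵`. -/
def sphMean (u : ℝ → E3 → ℝ) (τ r : ℝ) (x : E3) : ℝ≥0∞ :=
  ∫⁻ z, ‖u τ (x + r • z)‖ₑ ^ 5 ∂sphMeas

section duhamel
variable {u : ℝ → E3 → ℝ}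

lemma measurable_pot (hu : ContDiff ℝ (⊤ : ℕ∞) (uncurry u)) : Measurable (pot u) := by
  unfold pot
  refine Measurable.lintegral_prod_right' (f := fun p : ℝ × E3 => ‖u p.1 p.2‖ₑ ^ 6) ?_
  have : Continuous fun p : ℝ × E3 => u p.1 p.2 := hu.continuous
  exact this.enorm.measurable.pow_const 6

lemma measurable_sphMean (hu : ContDiff ℝ (⊤ : ℕ∞) (uncurry u)) (t : ℝ) :
    Measurable fun p : ℝ × E3 => sphMean u p.1 (t - p.1) p.2 := by
  unfold sphMean
  refine Measurable.lintegral_prod_right'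
    (f := fun q : (ℝ × E3) × E3 => ‖u q.1.1 (q.1.2 + (t - q.1.1) • q.2)‖ₑ ^ 5) ?_
  have h1 : Continuous fun p : ℝ × E3 => u p.1 p.2 := hu.continuous
  have h2 : Continuous fun q : (ℝ × E3) × E3 => u q.1.1 (q.1.2 + (t - q.1.1) • q.2) :=
    h1.comp (f := fun q : (ℝ × E3) × E3 => (q.1.1, q.1.2 + (t - q.1.1) • q.2)) (by fun_prop)
  exact h2.enorm.measurable.pow_const 5

lemma lintegral_sphMean_sq_le (hu : ContDiff ℝ (⊤ : ℕ∞) (uncurry u)) {M : ℝ≥0∞} (hM : ∀ t x, ‖u t x‖ₑ ≤ M) (τ r : ℝ) :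
    ∫⁻ x, sphMean u τ r x ^ 2 ≤ 216 ^ 2 * M ^ 4 * pot u τ := by
  have hc : Continuous (u τ) := (contDiff_slice hu τ).continuous
  have hm : Measurable fun q : E3 × E3 => ‖u τ (q.1 + r • q.2)‖ₑ ^ 10 :=
    (hc.comp (by fun_prop : Continuous fun q : E3 × E3 => q.1 + r • q.2)).enorm.measurable.pow_const 10
  calc ∫⁻ x, sphMean u τ r x ^ 2 ≤
        ∫⁻ x, (∫⁻ z, ‖u τ (x + r • z)‖ₑ ^ 10 ∂sphMeas) * 216 := by
        refine lintegral_mono fun x => ?_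
        have h := lintegral_mul_sq_le sphMeas (f := fun z => ‖u τ (x + r • z)‖ₑ ^ 5)
          (g := fun _ => 1) (by fun_prop) (by fun_prop)
        simp only [mul_one, one_pow, lintegral_const, one_mul, ← pow_mul] at h
        exact h.trans (mul_le_mul_right sphMeas_univ_le _)
    _ = 216 * ∫⁻ x, ∫⁻ z, ‖u τ (x + r • z)‖ₑ ^ 10 ∂sphMeas := by
        rw [lintegral_mul_const, mul_comm]
        exact hm.lintegral_prod_right'
    _ = 216 * ∫⁻ z, ∫⁻ x, ‖u τ (x + r • z)‖ₑ ^ 10 ∂volume ∂sphMeas := by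
        rw [lintegral_lintegral_swap hm.aemeasurable]
    _ = 216 * ∫⁻ _z, (∫⁻ x, ‖u τ x‖ₑ ^ 10) ∂sphMeas := by
        congr 1
        refine lintegral_congr fun z => ?_
        exact lintegral_add_right_eq_self (fun x => ‖u τ x‖ₑ ^ 10) (r • z)
    _ ≤ 216 * ((∫⁻ x, ‖u τ x‖ₑ ^ 10) * 216) := by
        rw [lintegral_const]
        gcongr
        exact sphMeas_univ_le
    _ ≤ 216 * ((M ^ 4 * pot u τ) * 216) := by
        gcongr
        unfold pot
        rw [← lintegral_const_mul _ (by fun_prop)]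
        refine lintegral_mono fun x => ?_
        calc ‖u τ x‖ₑ ^ 10 = ‖u τ x‖ₑ ^ 4 * ‖u τ x‖ₑ ^ 6 := by ring
          _ ≤ _ := by gcongr; exact hM τ x
    _ = _ := by ring

lemma sphMean_le (hu : ContDiff ℝ (⊤ : ℕ∞) (uncurry u)) (hS : ∀ t, IsSchwartz (u t)) {r : ℝ} (hr : 0 < r) (τ : ℝ) (x : E3) :
    ENNReal.ofReal (r ^ 2) * sphMean u τ r x ≤
      18 * ∑ i : Fin 3, ∫⁻ z, ‖fderiv ℝ (fun y => u τ y ^ 5) z (bv i)‖ₑ := by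
  set F : E3 → ℝ := fun z => u τ (x + z) ^ 5 with hF
  have hsm := contDiff_slice hu τ
  have hFc : ContDiff ℝ 1 F := by
    have : ContDiff ℝ 1 (u τ) := hsm.of_le (by simp)
    fun_prop
  have hF0 : Filter.Tendsto F (Filter.cocompact E3) (nhds 0) := by
    have h1 := ((hS τ).tendsto_zero.comp (Homeomorph.addLeft x).isClosedEmbedding.tendsto_cocompact).pow 5
    simpa using! h1
  have h := lintegral_sphere_le_grad hr hFc hF0
  rw [lintegral_sphere_scale hr] at h
  have e1 : ∫⁻ z in Metric.sphere (0 : E3) 1, ‖F (0 + r • z)‖ₑ ∂(μH[2]) = sphMean u τ r x := by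
    unfold sphMean sphMeas
    refine lintegral_congr fun z => ?_
    rw [hF, zero_add, enorm_pow]
  rw [e1] at h
  refine h.trans (le_of_eq ?_)
  congr 1
  refine Finset.sum_congr rfl fun i _ => ?_
  have e2 : ∀ z, fderiv ℝ F z = fderiv ℝ (fun y => u τ y ^ 5) (x + z) := fun z => by
    rw [hF]
    exact fderiv_comp_add_left (f := fun y => u τ y ^ 5) x
  simp only [e2]
  exact lintegral_add_left_eq_self (fun z => ‖fderiv ℝ (fun y => u τ y ^ 5) z (bv i)‖ₑ) x

lemma lintegral_fderiv_pow_five_sq_le (hu : ContDiff ℝ (⊤ : ℕ∞) (uncurry u)) {M E : ℝ≥0∞} (hM : ∀ t x, ‖u t x‖ₑ ≤ M)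
    (hE : ∀ t, ∫⁻ x, ENNReal.ofReal (edens u t x) ≤ E) (τ : ℝ) (i : Fin 3) :
    (∫⁻ z, ‖fderiv ℝ (fun y => u τ y ^ 5) z (bv i)‖ₑ) ^ 2 ≤ 50 * M ^ 2 * E * pot u τ := by
  have hsm := contDiff_slice hu τ
  have hd : Continuous fun z => fderiv ℝ (u τ) z (bv i) :=
    (hsm.continuous_fderiv (by simp)).clm_apply continuous_const
  have hc : Continuous (u τ) := hsm.continuous
  have e1 : ∀ z, ‖fderiv ℝ (fun y => u τ y ^ 5) z (bv i)‖ₑ ≤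
      5 * M * (‖u τ z‖ₑ ^ 3 * ‖fderiv ℝ (u τ) z (bv i)‖ₑ) := by
    intro z
    have h1 : fderiv ℝ (fun y => u τ y ^ 5) z (bv i) = 5 * u τ z ^ 4 * fderiv ℝ (u τ) z (bv i) := by
      rw [fderiv_fun_pow 5 (hsm.differentiable (by simp) z)]
      simp
    rw [h1, enorm_mul, enorm_mul, enorm_pow]
    have h5 : ‖(5 : ℝ)‖ₑ = 5 := by
      rw [← ofReal_norm]; norm_num
    rw [h5]
    calc 5 * ‖u τ z‖ₑ ^ 4 * ‖fderiv ℝ (u τ) z (bv i)‖ₑ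
        = 5 * ‖u τ z‖ₑ * (‖u τ z‖ₑ ^ 3 * ‖fderiv ℝ (u τ) z (bv i)‖ₑ) := by ring
      _ ≤ _ := by gcongr; exact hM τ z
  have e2 : ∫⁻ z, ‖fderiv ℝ (u τ) z (bv i)‖ₑ ^ 2 ≤ 2 * E := by
    refine le_trans ?_ (mul_le_mul_right (hE τ) 2)
    rw [← lintegral_const_mul']
    · refine lintegral_mono fun z => ?_
      have h2 : (2 : ℝ≥0∞) = ENNReal.ofReal 2 := by norm_num
      have h6 : 2 * ENNReal.ofReal (edens u τ z) = ENNReal.ofReal (2 * edens u τ z) := by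
        rw [ENNReal.ofReal_mul (by norm_num), ← h2]
      rw [h6, ← ofReal_norm, ← ENNReal.ofReal_pow (norm_nonneg _),
        Real.norm_eq_abs, sq_abs]
      refine ENNReal.ofReal_le_ofReal ?_
      have h3 := fderiv_space hu τ z i
      change fderiv ℝ (u τ) z (bv i) = _ at h3
      rw [h3]
      unfold edens
      have h4 : (pd (ex i) (uncurry u) (τ, z)) ^ 2 ≤ ∑ j, (pd (ex j) (uncurry u) (τ, z)) ^ 2 :=
        Finset.single_le_sum (f := fun j => (pd (ex j) (uncurry u) (τ, z)) ^ 2)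
          (fun j _ => sq_nonneg _) (Finset.mem_univ i)
      have h5 : 0 ≤ u τ z ^ 6 := by positivity
      nlinarith [sq_nonneg (pd et (uncurry u) (τ, z))]
    · norm_num
  calc _ ≤ (5 * M * ∫⁻ z, ‖u τ z‖ₑ ^ 3 * ‖fderiv ℝ (u τ) z (bv i)‖ₑ) ^ 2 := by
        rw [← lintegral_const_mul _ (by fun_prop)]
        gcongr with z
        exact e1 z
    _ = 25 * M ^ 2 * (∫⁻ z, ‖u τ z‖ₑ ^ 3 * ‖fderiv ℝ (u τ) z (bv i)‖ₑ) ^ 2 := by ring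
    _ ≤ 25 * M ^ 2 * ((∫⁻ z, (‖u τ z‖ₑ ^ 3) ^ 2) * ∫⁻ z, ‖fderiv ℝ (u τ) z (bv i)‖ₑ ^ 2) := by
        gcongr
        exact lintegral_mul_sq_le volume (by fun_prop) (by fun_prop)
    _ ≤ 25 * M ^ 2 * (pot u τ * (2 * E)) := by
        gcongr
        unfold pot
        simp only [← pow_mul]
        exact le_rfl
    _ = _ := by ring

lemma sphMean_sq_le (hu : ContDiff ℝ (⊤ : ℕ∞) (uncurry u)) (hS : ∀ t, IsSchwartz (u t)) {M E : ℝ≥0∞} (hM : ∀ t x, ‖u t x‖ₑ ≤ M)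
    (hE : ∀ t, ∫⁻ x, ENNReal.ofReal (edens u t x) ≤ E) {r : ℝ} (hr : 0 < r) (τ : ℝ) (x : E3) :
    (ENNReal.ofReal (r ^ 2) * sphMean u τ r x) ^ 2 ≤ 145800 * M ^ 2 * E * pot u τ := by
  set B := 50 * M ^ 2 * E * pot u τ with hB
  have h1 : ∀ i : Fin 3, ∫⁻ z, ‖fderiv ℝ (fun y => u τ y ^ 5) z (bv i)‖ₑ ≤ B ^ (1 / 2 : ℝ) := by
    intro i
    have h := ENNReal.rpow_le_rpow (lintegral_fderiv_pow_five_sq_le hu hM hE τ i)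
      (show (0 : ℝ) ≤ 1 / 2 by norm_num)
    rw [← ENNReal.rpow_natCast, ← ENNReal.rpow_mul] at h
    norm_num at h
    simpa [hB] using h
  have h2 := (sphMean_le hu hS hr τ x).trans
    (mul_le_mul_right (Finset.sum_le_sum fun i _ => h1 i) 18)
  refine (pow_le_pow_left' h2 2).trans (le_of_eq ?_)
  simp only [Finset.sum_const, Finset.card_univ, Fintype.card_fin, nsmul_eq_mul]
  have h3 : (B ^ (1 / 2 : ℝ)) ^ 2 = B := by
    rw [← ENNReal.rpow_natCast, ← ENNReal.rpow_mul]; norm_num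
  calc _ = (18 * 3) ^ 2 * (B ^ (1 / 2 : ℝ)) ^ 2 := by push_cast; ring
    _ = _ := by rw [h3, hB]; ring

end duhamel

/-- The integral of the wave kernel `1/(t-τ)` over the recent past, as a function of `σ = t - t₀`. -/
def kerL (T σ : ℝ) : ℝ≥0∞ := ENNReal.ofReal (Real.log ((σ + T) / σ))

lemma lintegral_inv_sub {T t₀ t : ℝ} (hT : 0 < T) (ht : t₀ < t) :
    ∫⁻ τ in Icc (t₀ - T) t₀, ENNReal.ofReal ((t - τ)⁻¹) = kerL T (t - t₀) := by
  have hpos : ∀ τ ∈ Icc (t₀ - T) t₀, 0 < t - τ := fun τ hτ => by linarith [hτ.2]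
  have hcont : ContinuousOn (fun τ => (t - τ)⁻¹) (Icc (t₀ - T) t₀) :=
    ContinuousOn.inv₀ (by fun_prop) fun τ hτ => (hpos τ hτ).ne'
  rw [← ofReal_integral_eq_lintegral_ofReal (hcont.integrableOn_Icc)
    ((ae_restrict_iff' measurableSet_Icc).2 (Filter.Eventually.of_forall fun τ hτ =>
      (inv_pos.2 (hpos τ hτ)).le)), kerL, integral_Icc_eq_integral_Ioc,
    ← intervalIntegral.integral_of_le (by linarith),
    intervalIntegral.integral_comp_sub_left (fun x => x⁻¹), integral_inv_of_pos (by linarith) (by linarith)]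
  congr 3
  ring

lemma lintegral_kerL_le {T : ℝ} (hT : 0 < T) :
    ∫⁻ σ in Ioi 0, kerL T σ ^ 4 ≤ ENNReal.ofReal (20000 * T) := by
  rw [← Ioc_union_Ioi_eq_Ioi hT.le]
  refine (lintegral_union_le _ _ _).trans ?_
  have h1 : ∫⁻ σ in Ioc 0 T, kerL T σ ^ 4 ≤ ENNReal.ofReal (16384 * T) := by
    have hb : ∀ σ ∈ Ioc 0 T, kerL T σ ^ 4 ≤
        ENNReal.ofReal (8192 * T ^ (1 / 2 : ℝ) * σ ^ (-(1 / 2) : ℝ)) := by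
      intro σ hσ
      have hσ0 := hσ.1
      unfold kerL
      have hz : 1 ≤ (σ + T) / σ := by rw [le_div_iff₀ hσ0]; linarith
      have hz0 : 0 < (σ + T) / σ := by linarith
      rw [← ENNReal.ofReal_pow (Real.log_nonneg hz)]
      apply ENNReal.ofReal_le_ofReal
      have hl := Real.log_le_rpow_div hz0.le (show (0 : ℝ) < 1 / 8 by norm_num)
      have hz2 : (σ + T) / σ ≤ 4 * (T / σ) := by
        rw [div_le_iff₀ hσ0]
        have : 4 * (T / σ) * σ = 4 * T := by field_simp
        rw [this]; linarith [hσ.2]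
      calc Real.log ((σ + T) / σ) ^ 4 ≤ (((σ + T) / σ) ^ (1 / 8 : ℝ) / (1 / 8)) ^ 4 := by
            gcongr
            exact Real.log_nonneg hz
        _ = 4096 * ((σ + T) / σ) ^ (1 / 2 : ℝ) := by
            rw [div_pow, ← Real.rpow_natCast, ← Real.rpow_mul hz0.le]
            norm_num
            ring
        _ ≤ 4096 * (4 * (T / σ)) ^ (1 / 2 : ℝ) := by gcongr
        _ = 8192 * T ^ (1 / 2 : ℝ) * σ ^ (-(1 / 2) : ℝ) := by
            rw [Real.mul_rpow (by norm_num) (by positivity), Real.div_rpow hT.le hσ0.le,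
              Real.rpow_neg hσ0.le]
            have : (4 : ℝ) ^ (1 / 2 : ℝ) = 2 := by
              rw [show (4 : ℝ) = 2 ^ (2 : ℝ) by norm_num, ← Real.rpow_mul (by norm_num)]; norm_num
            rw [this]; ring
    refine (setLIntegral_mono' measurableSet_Ioc hb).trans ?_
    have hintg : IntervalIntegrable (fun σ : ℝ => σ ^ (-(1 / 2) : ℝ)) volume 0 T :=
      intervalIntegral.intervalIntegrable_rpow' (by norm_num)
    rw [← ofReal_integral_eq_lintegral_ofReal]
    · apply ENNReal.ofReal_le_ofReal
      rw [← intervalIntegral.integral_of_le hT.le, intervalIntegral.integral_const_mul,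
        integral_rpow (Or.inl (by norm_num))]
      norm_num
      have : T ^ (1 / 2 : ℝ) * T ^ (1 / 2 : ℝ) = T := by
        rw [← Real.rpow_add hT]; norm_num
      nlinarith
    · exact (hintg.1).const_mul _
    · refine (ae_restrict_iff' measurableSet_Ioc).2 (Filter.Eventually.of_forall fun σ hσ => ?_)
      have := hσ.1
      simp only [Pi.zero_apply]
      positivity
  have h2 : ∫⁻ σ in Ioi T, kerL T σ ^ 4 ≤ ENNReal.ofReal T := by
    have hb : ∀ σ ∈ Ioi T, kerL T σ ^ 4 ≤ ENNReal.ofReal (T ^ 4 * σ ^ (-4 : ℝ)) := by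
      intro σ hσ
      have hσ0 : 0 < σ := hT.trans hσ
      unfold kerL
      have hz : 1 ≤ (σ + T) / σ := by rw [le_div_iff₀ hσ0]; linarith
      rw [← ENNReal.ofReal_pow (Real.log_nonneg hz)]
      apply ENNReal.ofReal_le_ofReal
      have hl : Real.log ((σ + T) / σ) ≤ T / σ := by
        have := Real.log_le_sub_one_of_pos (show 0 < (σ + T) / σ by linarith)
        have h3 : (σ + T) / σ - 1 = T / σ := by field_simp; ring
        linarith
      calc Real.log ((σ + T) / σ) ^ 4 ≤ (T / σ) ^ 4 := by
            gcongr
            exact Real.log_nonneg hz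
        _ = _ := by
            rw [div_pow, Real.rpow_neg hσ0.le]
            norm_cast
    refine (setLIntegral_mono' measurableSet_Ioi hb).trans ?_
    rw [← ofReal_integral_eq_lintegral_ofReal]
    · apply ENNReal.ofReal_le_ofReal
      rw [integral_const_mul, integral_Ioi_rpow_of_lt (by norm_num) hT]
      norm_num
      field_simp
      norm_num
    · exact (integrableOn_Ioi_rpow_of_lt (by norm_num) hT).const_mul _
    · refine (ae_restrict_iff' measurableSet_Ioi).2 (Filter.Eventually.of_forall fun σ hσ => ?_)
      have : 0 < σ := hT.trans hσ
      simp only [Pi.zero_apply]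
      positivity
  refine (add_le_add h1 h2).trans ?_
  rw [← ENNReal.ofReal_add (by positivity) (by positivity)]
  apply ENNReal.ofReal_le_ofReal
  linarith

section duhamel
variable {u : ℝ → E3 → ℝ}

lemma enorm_duh_le {s₁ s₂ t : ℝ} (h : s₁ ≤ s₂) (ht : s₂ < t) (x : E3) :
    ‖duh u s₁ s₂ t x‖ₑ ≤
      ∫⁻ τ in Icc s₁ s₂, ENNReal.ofReal (t - τ) * sphMean u τ (t - τ) x := by
  unfold duh
  rw [intervalIntegral.integral_of_le h]
  refine (enorm_integral_le_lintegral_enorm _).trans ?_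
  refine (lintegral_mono_set Ioc_subset_Icc_self).trans ?_
  refine setLIntegral_mono' measurableSet_Icc fun τ hτ => ?_
  have hr : 0 < t - τ := by linarith [hτ.2]
  rw [enorm_mul]
  have h1 : ‖sphInt x (t - τ) (fun y => u τ y ^ 5)‖ₑ ≤
      ENNReal.ofReal ((t - τ) ^ 2) * sphMean u τ (t - τ) x := by
    unfold sphInt
    refine (enorm_integral_le_lintegral_enorm _).trans (le_of_eq ?_)
    rw [lintegral_sphere_scale hr]
    unfold sphMean sphMeas
    simp only [enorm_pow]
  have h2 : ‖1 / (4 * π * (t - τ))‖ₑ ≤ ENNReal.ofReal ((t - τ)⁻¹) := by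
    rw [← ofReal_norm, Real.norm_of_nonneg (by positivity)]
    apply ENNReal.ofReal_le_ofReal
    rw [one_div]
    apply inv_anti₀ hr
    have := Real.pi_gt_three
    nlinarith
  calc _ ≤ ENNReal.ofReal ((t - τ)⁻¹) *
        (ENNReal.ofReal ((t - τ) ^ 2) * sphMean u τ (t - τ) x) := mul_le_mul' h2 h1
    _ = _ := by
      rw [← mul_assoc, ← ENNReal.ofReal_mul (by positivity)]
      congr 2
      field_simp

lemma lintegral_kernel_pow_eight_le
    (hu : ContDiff ℝ (⊤ : ℕ∞) (uncurry u)) (hS : ∀ t, IsSchwartz (u t))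
    {M E : ℝ≥0∞} (hM : ∀ t x, ‖u t x‖ₑ ≤ M)
    (hE : ∀ t, ∫⁻ x, ENNReal.ofReal (edens u t x) ≤ E)
    {r : ℝ} (hr : 0 < r) (τ : ℝ) :
    ∫⁻ x, (ENNReal.ofReal r * sphMean u τ r x) ^ 8 ≤
      (145800 ^ 3 * 216 ^ 2 * M ^ 10 * E ^ 3) *
        (pot u τ ^ (1 / 2 : ℝ) * ENNReal.ofReal (r⁻¹) ^ (1 / 2 : ℝ)) ^ 8 := by
  have hri : ENNReal.ofReal r = ENNReal.ofReal (r⁻¹) * ENNReal.ofReal (r ^ 2) := by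
    rw [← ENNReal.ofReal_mul (by positivity)]
    congr 1; field_simp
  have hri2 : ENNReal.ofReal (r⁻¹) * ENNReal.ofReal r = 1 := by
    rw [← ENNReal.ofReal_mul (by positivity), inv_mul_cancel₀ hr.ne', ENNReal.ofReal_one]
  have hsm : Measurable fun x => sphMean u τ r x := by
    have h := (measurable_sphMean hu (τ + r)).comp (measurable_prodMk_left (x := τ))
    simpa [Function.comp_def] using! h
  have hpt : ∀ x, (ENNReal.ofReal r * sphMean u τ r x) ^ 8 ≤
      ENNReal.ofReal (r⁻¹) ^ 4 * (145800 * M ^ 2 * E * pot u τ) ^ 3 * sphMean u τ r x ^ 2 := by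
    intro x
    have h1 := pow_le_pow_left' (sphMean_sq_le hu hS hM hE hr τ x) 3
    calc (ENNReal.ofReal r * sphMean u τ r x) ^ 8
        = (ENNReal.ofReal r * sphMean u τ r x) ^ 6 * (ENNReal.ofReal r * sphMean u τ r x) ^ 2 := by
          ring
      _ = (ENNReal.ofReal (r⁻¹) * (ENNReal.ofReal (r ^ 2) * sphMean u τ r x)) ^ 6 *
          (ENNReal.ofReal r * sphMean u τ r x) ^ 2 := by
          rw [← mul_assoc (ENNReal.ofReal r⁻¹), ← hri]
      _ = ENNReal.ofReal (r⁻¹) ^ 4 * (ENNReal.ofReal (r⁻¹) * ENNReal.ofReal r) ^ 2 *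
          ((ENNReal.ofReal (r ^ 2) * sphMean u τ r x) ^ 2) ^ 3 * sphMean u τ r x ^ 2 := by ring
      _ = ENNReal.ofReal (r⁻¹) ^ 4 *
          ((ENNReal.ofReal (r ^ 2) * sphMean u τ r x) ^ 2) ^ 3 * sphMean u τ r x ^ 2 := by
          rw [hri2, one_pow, mul_one]
      _ ≤ _ := by gcongr
  refine (lintegral_mono hpt).trans ?_
  rw [lintegral_const_mul _ (hsm.pow_const 2)]
  have hw : (pot u τ ^ (1 / 2 : ℝ) * ENNReal.ofReal (r⁻¹) ^ (1 / 2 : ℝ)) ^ 8 =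
      pot u τ ^ 4 * ENNReal.ofReal (r⁻¹) ^ 4 := by
    rw [mul_pow, ← ENNReal.rpow_natCast, ← ENNReal.rpow_mul,
      ← ENNReal.rpow_natCast (ENNReal.ofReal (r⁻¹) ^ (1 / 2 : ℝ)), ← ENNReal.rpow_mul,
      ← ENNReal.rpow_natCast (pot u τ) 4, ← ENNReal.rpow_natCast (ENNReal.ofReal (r⁻¹)) 4]
    norm_num
  rw [hw]
  calc _ ≤ ENNReal.ofReal (r⁻¹) ^ 4 * (145800 * M ^ 2 * E * pot u τ) ^ 3 *
        (216 ^ 2 * M ^ 4 * pot u τ) := by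
        gcongr
        exact lintegral_sphMean_sq_le hu hM τ r
    _ = _ := by ring

/-- Spatial `L⁸` bound for the Duhamel integral over the recent past. -/
lemma lintegral_duh_pow_eight_le
    (hu : ContDiff ℝ (⊤ : ℕ∞) (uncurry u)) (hS : ∀ t, IsSchwartz (u t))
    {M E : ℝ≥0∞} (hM : ∀ t x, ‖u t x‖ₑ ≤ M)
    (hE : ∀ t, ∫⁻ x, ENNReal.ofReal (edens u t x) ≤ E)
    (hM' : M ≠ ⊤) (hE' : E ≠ ⊤) {T t₀ t : ℝ} (hT : 0 < T)
    (ht : t₀ < t) :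
    ∫⁻ x, ‖duh u (t₀ - T) t₀ t x‖ₑ ^ 8 ≤ (145800 ^ 3 * 216 ^ 2 * M ^ 10 * E ^ 3) *
      ((∫⁻ τ in Icc (t₀ - T) t₀, pot u τ) ^ 4 * kerL T (t - t₀) ^ 4) := by
  have hpot : ∀ τ, pot u τ ≠ ⊤ := by
    intro τ
    have h6 : ∀ x, ‖u τ x‖ₑ ^ 6 ≤ 6 * ENNReal.ofReal (edens u τ x) := by
      intro x
      rw [← ofReal_norm, ← ENNReal.ofReal_pow (norm_nonneg _), Real.norm_eq_abs,
        Even.pow_abs (by decide)]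
      have : (6 : ℝ≥0∞) = ENNReal.ofReal 6 := by norm_num
      rw [this, ← ENNReal.ofReal_mul (by norm_num)]
      apply ENNReal.ofReal_le_ofReal
      unfold edens
      have : 0 ≤ ∑ j, (pd (ex j) (uncurry u) (τ, x)) ^ 2 := Finset.sum_nonneg fun _ _ => sq_nonneg _
      nlinarith [sq_nonneg (pd et (uncurry u) (τ, x))]
    refine ne_top_of_le_ne_top ?_ (lintegral_mono h6)
    rw [lintegral_const_mul' _ _ (by norm_num)]
    exact ENNReal.mul_ne_top (by norm_num) (ne_top_of_le_ne_top hE' (hE τ))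
  set w : ℝ → ℝ≥0∞ := fun τ => pot u τ ^ (1 / 2 : ℝ) * ENNReal.ofReal ((t - τ)⁻¹) ^ (1 / 2 : ℝ)
    with hw
  have hm1 : Measurable fun τ => pot u τ ^ (1 / 2 : ℝ) := (measurable_pot hu).pow_const _
  have hm2 : Measurable fun τ => ENNReal.ofReal ((t - τ)⁻¹) ^ (1 / 2 : ℝ) := by fun_prop
  have hk : Measurable (uncurry fun τ x => ENNReal.ofReal (t - τ) * sphMean u τ (t - τ) x) :=
    Measurable.mul (by fun_prop) (measurable_sphMean hu t)
  have hmain := lintegral_lintegral_pow_eight_le (volume.restrict (Icc (t₀ - T) t₀)) volume hk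
    (w := w) (hm1.mul hm2) (Filter.Eventually.of_forall fun τ =>
      ENNReal.mul_ne_top (ENNReal.rpow_ne_top_of_nonneg (by norm_num) (hpot τ))
        (ENNReal.rpow_ne_top_of_nonneg (by norm_num) ENNReal.ofReal_ne_top))
    (K := 145800 ^ 3 * 216 ^ 2 * M ^ 10 * E ^ 3)
    (ENNReal.mul_ne_top (ENNReal.mul_ne_top (by norm_num) (ENNReal.pow_ne_top hM'))
      (ENNReal.pow_ne_top hE'))
    ((ae_restrict_iff' measurableSet_Icc).2 (Filter.Eventually.of_forall fun τ hτ =>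
      lintegral_kernel_pow_eight_le hu hS hM hE (by linarith [hτ.2]) τ))
  refine (lintegral_mono fun x => pow_le_pow_left' (enorm_duh_le (by linarith) ht x) 8).trans ?_
  refine hmain.trans ?_
  gcongr
  have hcs := lintegral_mul_sq_le (volume.restrict (Icc (t₀ - T) t₀)) hm1.aemeasurable
    hm2.aemeasurable
  have hsq : ∀ z : ℝ≥0∞, (z ^ (1 / 2 : ℝ)) ^ 2 = z := fun z => by
    rw [← ENNReal.rpow_natCast, ← ENNReal.rpow_mul]; norm_num
  simp only [hsq] at hcs
  rw [lintegral_inv_sub hT ht] at hcs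
  calc _ = ((∫⁻ τ in Icc (t₀ - T) t₀, w τ) ^ 2) ^ 4 := by rw [← pow_mul]
    _ ≤ _ := pow_le_pow_left' hcs 4
    _ = _ := mul_pow _ _ _

/-- Spacetime `L⁸` bound for the Duhamel integral over the recent past. -/
lemma mixNorm_duh_le
    (hu : ContDiff ℝ (⊤ : ℕ∞) (uncurry u)) (hS : ∀ t, IsSchwartz (u t))
    {M E : ℝ≥0∞} (hM : ∀ t x, ‖u t x‖ₑ ≤ M)
    (hE : ∀ t, ∫⁻ x, ENNReal.ofReal (edens u t x) ≤ E)
    (hM' : M ≠ ⊤) (hE' : E ≠ ⊤) {T : ℝ} (hT : 0 < T) (t₀ b : ℝ) :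
    mixNorm 8 8 (Icc t₀ b) (fun t x => duh u (t₀ - T) t₀ t x) ≤
      ((145800 ^ 3 * 216 ^ 2 * M ^ 10 * E ^ 3) * ((∫⁻ τ in Icc (t₀ - T) t₀, pot u τ) ^ 4 *
        ENNReal.ofReal (20000 * T))) ^ (1 / 8 : ℝ) := by
  unfold mixNorm
  gcongr
  have hx : ∀ t, xNorm 8 (duh u (t₀ - T) t₀ t) ^ (8 : ℝ) = ∫⁻ x, ‖duh u (t₀ - T) t₀ t x‖ₑ ^ 8 := by
    intro t
    unfold xNorm
    rw [← ENNReal.rpow_mul]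
    norm_num
    rfl
  calc ∫⁻ t in Icc t₀ b, xNorm 8 (duh u (t₀ - T) t₀ t) ^ (8 : ℝ)
      = ∫⁻ t in Icc t₀ b, ∫⁻ x, ‖duh u (t₀ - T) t₀ t x‖ₑ ^ 8 := lintegral_congr hx
    _ ≤ ∫⁻ t in Ici t₀, ∫⁻ x, ‖duh u (t₀ - T) t₀ t x‖ₑ ^ 8 := lintegral_mono_set Icc_subset_Ici_self
    _ = ∫⁻ t in Ioi t₀, ∫⁻ x, ‖duh u (t₀ - T) t₀ t x‖ₑ ^ 8 := by
        rw [restrict_Ioi_eq_restrict_Ici]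
    _ ≤ ∫⁻ t in Ioi t₀, (145800 ^ 3 * 216 ^ 2 * M ^ 10 * E ^ 3) *
        ((∫⁻ τ in Icc (t₀ - T) t₀, pot u τ) ^ 4 * kerL T (t - t₀) ^ 4) :=
        setLIntegral_mono' measurableSet_Ioi fun t ht =>
          lintegral_duh_pow_eight_le hu hS hM hE hM' hE' hT ht
    _ = (145800 ^ 3 * 216 ^ 2 * M ^ 10 * E ^ 3) * ((∫⁻ τ in Icc (t₀ - T) t₀, pot u τ) ^ 4 *
        ∫⁻ t in Ioi t₀, kerL T (t - t₀) ^ 4) := by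
        have hmk : Measurable fun t => kerL T (t - t₀) ^ 4 := by unfold kerL; fun_prop
        rw [lintegral_const_mul _ (hmk.const_mul _), lintegral_const_mul _ hmk]
    _ = (145800 ^ 3 * 216 ^ 2 * M ^ 10 * E ^ 3) * ((∫⁻ τ in Icc (t₀ - T) t₀, pot u τ) ^ 4 *
        ∫⁻ σ in Ioi 0, kerL T σ ^ 4) := by
        congr 2
        rw [← lintegral_indicator measurableSet_Ioi, ← lintegral_indicator measurableSet_Ioi,
          ← lintegral_sub_right_eq_self (fun σ => (Ioi (0 : ℝ)).indicator (fun σ => kerL T σ ^ 4) σ) t₀]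
        refine lintegral_congr fun t => ?_
        simp only [indicator, mem_Ioi, sub_pos]
    _ ≤ _ := by
        gcongr
        exact lintegral_kerL_le hT

end duhamel

lemma lintegral_inv_weight_le {R : ℝ} (hR : 0 < R) :
    ∫⁻ ξ : E3, ENNReal.ofReal ((R ^ 2 * ‖ξ‖ ^ 2 + ‖ξ‖ ^ 4)⁻¹) ≤ ENNReal.ofReal (20 / R) := by
  have hrad : ∀ y ∈ Ioi (0 : ℝ), y ^ (Module.finrank ℝ E3 - 1) •
      ((R ^ 2 * y ^ 2 + y ^ 4)⁻¹) = (R ^ 2)⁻¹ * (1 + (R⁻¹ * y) ^ 2)⁻¹ := by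
    intro y hy
    have : 0 < y := hy
    simp only [finrank_euclideanSpace, Fintype.card_fin, smul_eq_mul]
    norm_num
    field_simp
  have hintg0 : IntegrableOn (fun y : ℝ => (R ^ 2)⁻¹ * (1 + (R⁻¹ * y) ^ 2)⁻¹) (Ioi 0) :=
    (((integrable_inv_one_add_sq).comp_mul_left' (inv_ne_zero hR.ne')).const_mul _).integrableOn
  have hintg : Integrable (fun ξ : E3 => (R ^ 2 * ‖ξ‖ ^ 2 + ‖ξ‖ ^ 4)⁻¹) := by
    refine (integrable_fun_norm_addHaar (E := E3) volume
      (f := fun y => (R ^ 2 * y ^ 2 + y ^ 4)⁻¹)).2 ?_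
    exact hintg0.congr_fun (fun y hy => (hrad y hy).symm) measurableSet_Ioi
  rw [← ofReal_integral_eq_lintegral_ofReal hintg
    (Filter.Eventually.of_forall fun ξ => by simp only [Pi.zero_apply]; positivity)]
  apply ENNReal.ofReal_le_ofReal
  rw [integral_fun_norm_addHaar (E := E3) volume (fun y => (R ^ 2 * y ^ 2 + y ^ 4)⁻¹),
    setIntegral_congr_fun measurableSet_Ioi hrad, integral_const_mul,
    integral_comp_mul_left_Ioi (fun s => (1 + s ^ 2)⁻¹) 0 (inv_pos.2 hR), mul_zero,
    integral_Ioi_inv_one_add_sq]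
  simp only [finrank_euclideanSpace, Fintype.card_fin, smul_eq_mul, nsmul_eq_mul, inv_inv,
    Real.arctan_zero, sub_zero, measureReal_def, EuclideanSpace.volume_ball_fin_three]
  rw [ENNReal.toReal_mul, ENNReal.toReal_ofReal (by positivity)]
  simp only [ENNReal.ofReal_one, one_pow, ENNReal.toReal_one, one_mul]
  push_cast
  have : 3 * (π * 4 / 3 * ((R ^ 2)⁻¹ * (R * (π / 2)))) = 2 * π ^ 2 / R := by
    field_simp
    norm_num
  rw [this]
  gcongr
  nlinarith [Real.pi_lt_d2, Real.pi_gt_three]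

lemma lintegral_fourier_sq (g : SchwartzMap E3 ℂ) :
    ∫⁻ ξ, ‖𝓕 (g : E3 → ℂ) ξ‖ₑ ^ 2 = ∫⁻ x, ‖g x‖ₑ ^ 2 := by
  have key : ∀ h : SchwartzMap E3 ℂ, ∫⁻ x, ‖h x‖ₑ ^ 2 = ENNReal.ofReal (∫ x, ‖h x‖ ^ 2) := by
    intro h
    have hi : Integrable fun x => ‖h x‖ ^ 2 := (h.memLp 2 volume).integrable_norm_pow (by simp)
    rw [ofReal_integral_eq_lintegral_ofReal hi
      (Filter.Eventually.of_forall fun ξ => by simp only [Pi.zero_apply]; positivity)]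
    refine lintegral_congr fun x => ?_
    rw [ENNReal.ofReal_pow (norm_nonneg _), ofReal_norm]
  rw [key g, ← SchwartzMap.integral_norm_sq_fourier, ← key, SchwartzMap.fourier_coe]

lemma lintegral_coord_mul_fourier_sq_le {f : E3 → ℝ} (hf : IsSchwartz f) (i : Fin 3) :
    ∫⁻ ξ : E3, ENNReal.ofReal ((ξ i) ^ 2) * ‖𝓕 (fun x => (f x : ℂ)) ξ‖ₑ ^ 2 ≤
      ∫⁻ x, ENNReal.ofReal ((fderiv ℝ f x (bv i)) ^ 2) := by
  set g : SchwartzMap E3 ℂ := SchwartzMap.postcompCLM Complex.ofRealCLM hf.toMap with hg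
  have hgx : ∀ x, g x = (f x : ℂ) := fun x => rfl
  have hgf : (g : E3 → ℂ) = fun x => (f x : ℂ) := funext hgx
  have hd : ∀ x, LineDeriv.lineDerivOp (bv i) g x = ((fderiv ℝ f x (bv i) : ℝ) : ℂ) := by
    intro x
    rw [SchwartzMap.lineDerivOp_apply_eq_fderiv, hgf]
    have hdf : DifferentiableAt ℝ f x := hf.1.differentiable (by simp) x
    have := (Complex.ofRealCLM.hasFDerivAt (x := f x)).comp x hdf.hasFDerivAt
    have h2 := this.fderiv
    have h3 : (Complex.ofRealCLM ∘ f) = fun x => (f x : ℂ) := rfl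
    rw [h3] at h2
    rw [h2]
    rfl
  have h := lintegral_fourier_sq (LineDeriv.lineDerivOp (bv i) g)
  have hF : ∀ ξ, 𝓕 ((LineDeriv.lineDerivOp (bv i) g : SchwartzMap E3 ℂ) : E3 → ℂ) ξ =
      (2 * π * Complex.I) * ((ξ i : ℂ) * 𝓕 (fun x => (f x : ℂ)) ξ) := by
    intro ξ
    have h1 := congrArg (fun G : SchwartzMap E3 ℂ => G ξ) (SchwartzMap.fourier_lineDerivOp_eq g (bv i))
    have ht : (fun y : E3 => inner ℝ y (bv i)).HasTemperateGrowth :=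
      ((innerSL ℝ).flip (bv i)).hasTemperateGrowth
    simp only [smul_apply, SchwartzMap.smulLeftCLM_apply_apply ht,
      SchwartzMap.fourier_coe] at h1
    rw [h1, hgf]
    simp [bv, EuclideanSpace.inner_single_right]
  calc _ ≤ ∫⁻ ξ : E3, ‖𝓕 ((LineDeriv.lineDerivOp (bv i) g : SchwartzMap E3 ℂ) : E3 → ℂ) ξ‖ₑ ^ 2 := by
        refine lintegral_mono fun ξ => ?_
        rw [hF, enorm_mul (2 * π * Complex.I : ℂ), enorm_mul (ξ i : ℂ), mul_pow, mul_pow]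
        have h1 : (1 : ℝ≥0∞) ≤ ‖(2 * π * Complex.I : ℂ)‖ₑ ^ 2 := by
          refine one_le_pow₀ ?_
          rw [← ofReal_norm, ← ENNReal.ofReal_one]
          apply ENNReal.ofReal_le_ofReal
          simp only [norm_mul, Complex.norm_ofNat, Complex.norm_real, Complex.norm_I, mul_one]
          rw [Real.norm_of_nonneg Real.pi_pos.le]
          linarith [Real.pi_gt_three]
        have h2 : ‖(ξ i : ℂ)‖ₑ ^ 2 = ENNReal.ofReal ((ξ i) ^ 2) := by
          rw [← ofReal_norm, ← ENNReal.ofReal_pow (norm_nonneg _)]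
          simp
        rw [h2]
        exact le_mul_of_one_le_left' h1
    _ = _ := by
        rw [h]
        refine lintegral_congr fun x => ?_
        rw [hd, ← ofReal_norm, ← ENNReal.ofReal_pow (norm_nonneg _)]
        simp

lemma sobNorm_two_sq (f : E3 → ℝ) :
    sobNorm 2 f ^ 2 = ∫⁻ ξ : E3, ENNReal.ofReal (‖ξ‖ ^ 4) * ‖𝓕 (fun x => (f x : ℂ)) ξ‖ₑ ^ 2 := by
  unfold sobNorm
  rw [← ENNReal.rpow_natCast, ← ENNReal.rpow_mul]
  norm_num
  refine lintegral_congr fun ξ => ?_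
  simp only [enorm_eq_nnnorm]

lemma IsSchwartz.enorm_sq_le {f : E3 → ℝ} (hf : IsSchwartz f) {R : ℝ} (hR : 0 < R) (x : E3) :
    ‖f x‖ₑ ^ 2 ≤ ENNReal.ofReal (20 / R) * (ENNReal.ofReal (R ^ 2) *
      (∫⁻ x, ENNReal.ofReal (∑ i, (fderiv ℝ f x (bv i)) ^ 2)) + sobNorm 2 f ^ 2) := by
  set g : SchwartzMap E3 ℂ := SchwartzMap.postcompCLM Complex.ofRealCLM hf.toMap with hg
  have hgx : ∀ x, g x = (f x : ℂ) := fun x => rfl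
  have hgf : (g : E3 → ℂ) = fun x => (f x : ℂ) := funext hgx
  set G : E3 → ℂ := 𝓕 (fun x => (f x : ℂ)) with hG
  have hGc : Continuous G := by
    rw [hG, ← hgf, ← SchwartzMap.fourier_coe]
    exact SchwartzMap.continuous _
  have hinv : (f x : ℂ) = 𝓕⁻ G x := by
    have h1 : FourierTransformInv.fourierInv (FourierTransform.fourier g) = g := by simp
    have h2 := congrArg (fun h : SchwartzMap E3 ℂ => h x) h1
    simp only [SchwartzMap.fourierInv_coe, SchwartzMap.fourier_coe, hgf] at h2
    exact h2.symm
  have h1 : ‖f x‖ₑ ≤ ∫⁻ ξ, ‖G ξ‖ₑ := by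
    have e : ‖f x‖ₑ = ‖(f x : ℂ)‖ₑ := by rw [← ofReal_norm, ← ofReal_norm, Complex.norm_real]
    rw [e, hinv, Real.fourierInv_eq]
    refine (enorm_integral_le_lintegral_enorm _).trans (le_of_eq (lintegral_congr fun ξ => ?_))
    rw [← ofReal_norm, Circle.norm_smul, ofReal_norm]
  set w : E3 → ℝ := fun ξ => R ^ 2 * ‖ξ‖ ^ 2 + ‖ξ‖ ^ 4 with hw
  have hwpos : ∀ ξ : E3, ξ ≠ 0 → 0 < w ξ := by
    intro ξ hξ
    have : 0 < ‖ξ‖ := norm_pos_iff.2 hξ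
    simp only [hw]; positivity
  have hwm : Measurable w := by simp only [hw]; fun_prop
  have h2 : ∫⁻ ξ, ‖G ξ‖ₑ = ∫⁻ ξ, ENNReal.ofReal (√((w ξ)⁻¹)) *
      (ENNReal.ofReal (√(w ξ)) * ‖G ξ‖ₑ) := by
    have hne : ∀ᵐ ξ : E3, ξ ≠ 0 := by
      have : volume ({0} : Set E3) = 0 := measure_singleton _
      exact compl_mem_ae_iff.2 this
    refine lintegral_congr_ae (hne.mono fun ξ hξ => ?_)
    simp only
    rw [← mul_assoc, ← ENNReal.ofReal_mul (by positivity), ← Real.sqrt_mul (by positivity [hwpos ξ hξ]),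
      inv_mul_cancel₀ (hwpos ξ hξ).ne', Real.sqrt_one, ENNReal.ofReal_one, one_mul]
  have h3 := lintegral_mul_sq_le (μ := (volume : Measure E3))
    (f := fun ξ => ENNReal.ofReal (√((w ξ)⁻¹)))
    (g := fun ξ => ENNReal.ofReal (√(w ξ)) * ‖G ξ‖ₑ) (by fun_prop)
    ((by fun_prop : Measurable fun ξ => ENNReal.ofReal (√(w ξ))).mul
      hGc.enorm.measurable).aemeasurable
  have hw0 : ∀ ξ, 0 ≤ w ξ := fun ξ => by simp only [hw]; positivity
  rw [← h2] at h3
  refine (pow_le_pow_left' h1 2).trans (h3.trans (mul_le_mul' ?_ ?_))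
  · refine le_trans (le_of_eq (lintegral_congr fun ξ => ?_)) (lintegral_inv_weight_le hR)
    rw [← ENNReal.ofReal_pow (by positivity), Real.sq_sqrt (inv_nonneg.2 (hw0 ξ))]
  · have e : ∀ ξ, (ENNReal.ofReal (√(w ξ)) * ‖G ξ‖ₑ) ^ 2 =
        ENNReal.ofReal (R ^ 2) * (∑ i, ENNReal.ofReal ((ξ i) ^ 2) * ‖G ξ‖ₑ ^ 2) +
        ENNReal.ofReal (‖ξ‖ ^ 4) * ‖G ξ‖ₑ ^ 2 := by
      intro ξ
      rw [mul_pow, ← ENNReal.ofReal_pow (by positivity), Real.sq_sqrt (hw0 ξ), hw,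
        ENNReal.ofReal_add (by positivity) (by positivity), add_mul,
        ENNReal.ofReal_mul (by positivity), norm_sq_eq_sum,
        ENNReal.ofReal_sum_of_nonneg (fun i _ => sq_nonneg _), mul_assoc, Finset.sum_mul]
    have hm : ∀ i : Fin 3, Measurable fun ξ : E3 => ENNReal.ofReal ((ξ i) ^ 2) * ‖G ξ‖ₑ ^ 2 :=
      fun i => (by fun_prop : Measurable fun ξ : E3 => ENNReal.ofReal ((ξ i) ^ 2)).mul
        (hGc.enorm.measurable.pow_const 2)
    simp only [e]
    rw [lintegral_add_left ((Finset.measurable_fun_sum _ fun i _ => hm i).const_mul _),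
      lintegral_const_mul _ (Finset.measurable_fun_sum _ fun i _ => hm i),
      lintegral_finsetSum _ (fun i _ => hm i), sobNorm_two_sq]
    gcongr
    have hfd : ∀ i : Fin 3, Measurable fun x => ENNReal.ofReal ((fderiv ℝ f x (bv i)) ^ 2) :=
      fun i => ((hf.fderiv_apply (bv i)).1.continuous.measurable.pow_const 2).ennreal_ofReal
    simp only [ENNReal.ofReal_sum_of_nonneg (fun i _ => sq_nonneg _)]
    rw [lintegral_finsetSum _ (fun i _ => hfd i)]
    exact Finset.sum_le_sum fun i _ => lintegral_coord_mul_fourier_sq_le hf i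

/-- The uniform bound interpolating between the energy and the `Ḣ²` norm. -/
lemma IsNLW.enorm_sq_le {u : ℝ → E3 → ℝ} (hu : IsNLW u) {E A : ℝ} (hE0 : 0 < E) (hA : 0 < A)
    (hE : ∀ t, energy u t ≤ E) (hAP : APriori u A) (t : ℝ) (x : E3) :
    ‖u t x‖ₑ ^ 2 ≤ ENNReal.ofReal (60 * A * √E) := by
  have hs : 0 < √E := Real.sqrt_pos.2 hE0
  have h := (hu.2.1 t (mem_univ _)).1.enorm_sq_le (R := A / √E) (by positivity) x
  refine h.trans ?_
  have h1 : ∫⁻ x, ENNReal.ofReal (∑ i, (fderiv ℝ (u t) x (bv i)) ^ 2) ≤ ENNReal.ofReal (2 * E) := by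
    calc _ ≤ ∫⁻ x, ENNReal.ofReal 2 * ENNReal.ofReal (edens u t x) := by
          refine lintegral_mono fun x => ?_
          rw [← ENNReal.ofReal_mul (by norm_num)]
          apply ENNReal.ofReal_le_ofReal
          have e : ∀ i, fderiv ℝ (u t) x (bv i) = pd (ex i) (uncurry u) (t, x) := fun i =>
            fderiv_space hu.contDiff t x i
          simp only [e, edens]
          have : 0 ≤ (u t x) ^ 6 := by positivity
          nlinarith [sq_nonneg (pd et (uncurry u) (t, x))]
      _ = ENNReal.ofReal 2 * ∫⁻ x, ENNReal.ofReal (edens u t x) :=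
          lintegral_const_mul' _ _ ENNReal.ofReal_ne_top
      _ ≤ _ := by
          rw [ENNReal.ofReal_mul (by norm_num)]
          gcongr
          exact hu.lintegral_edens_le hE t
  have h2 : sobNorm 2 (u t) ^ 2 ≤ ENNReal.ofReal (A ^ 2) := by
    rw [ENNReal.ofReal_pow hA.le]
    exact pow_le_pow_left' (hAP t).2.2.1 2
  calc _ ≤ ENNReal.ofReal (20 / (A / √E)) * (ENNReal.ofReal ((A / √E) ^ 2) * ENNReal.ofReal (2 * E)
        + ENNReal.ofReal (A ^ 2)) :=
        mul_le_mul_right (add_le_add (mul_le_mul_right h1 _) h2) _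
    _ = ENNReal.ofReal (60 * A * √E) := by
        rw [← ENNReal.ofReal_mul (by positivity), ← ENNReal.ofReal_add (by positivity) (by positivity),
          ← ENNReal.ofReal_mul (by positivity)]
        congr 1
        rw [div_pow, Real.sq_sqrt hE0.le]
        field_simp
        norm_num

/-- The divergence theorem on a space-time cylinder outside of which the spatial flux vanishes. -/
lemma integral_ball_sub_eq {g g' : ℝ → E3 → ℝ} {V V' : Fin 3 → ℝ → E3 → ℝ}
    (hgc : Continuous (uncurry g)) (hgc' : Continuous (uncurry g'))
    (hVc : ∀ j, Continuous (uncurry (V j))) (hVc' : ∀ j, Continuous (uncurry (V' j)))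
    (hg : ∀ t x, HasDerivAt (fun s => g s x) (g' t x) t)
    (hV : ∀ j t x, HasLineDerivAt ℝ (V j t) (V' j t x) x (bv j))
    {R t₁ t₂ : ℝ} (z : E3) (h12 : t₁ ≤ t₂)
    (hz : ∀ j, ∀ t ∈ Icc t₁ t₂, ∀ x, R ≤ ‖x - z‖ → V j t x = 0) :
    (∫ x in Metric.closedBall z R, g t₂ x) - ∫ x in Metric.closedBall z R, g t₁ x =
      ∫ t in t₁..t₂, ∫ x in Metric.closedBall z R, (g' t x + ∑ j, V' j t x) := by
  have hB : IsCompact (Metric.closedBall z R) := isCompact_closedBall z R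
  have slice : ∀ {f : ℝ → E3 → ℝ}, Continuous (uncurry f) → ∀ t, Continuous (f t) :=
    fun hf t => hf.comp (by fun_prop : Continuous fun x : E3 => (t, x))
  have hio : ∀ {f : ℝ → E3 → ℝ}, Continuous (uncurry f) → ∀ t,
      IntegrableOn (f t) (Metric.closedBall z R) :=
    fun hf t => (slice hf t).continuousOn.integrableOn_compact hB
  have hdiv : ∀ j, ∀ t ∈ Icc t₁ t₂, ∫ x in Metric.closedBall z R, V' j t x = 0 := by
    intro j t ht
    have hout : ∀ x, x ∉ Metric.closedBall z R → V' j t x = 0 := by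
      intro x hx
      have hev : V j t =ᶠ[nhds x] fun _ => (0 : ℝ) := by
        filter_upwards [(Metric.isClosed_closedBall.isOpen_compl).mem_nhds hx] with y hy
        refine hz j t ht y ?_
        have : ¬ dist y z ≤ R := hy
        rw [← dist_eq_norm]
        linarith
      have h1 : HasLineDerivAt ℝ (V j t) 0 x (bv j) :=
        ((hasFDerivAt_const (0 : ℝ) x).hasLineDerivAt (bv j)).congr_of_eventuallyEq hev
      exact (hV j t x).unique h1
    rw [setIntegral_eq_integral_of_forall_compl_eq_zero hout]
    have hcs : HasCompactSupport (V j t) := HasCompactSupport.intro hB (fun x hx => by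
      refine hz j t ht x ?_
      have : ¬ dist x z ≤ R := hx
      rw [← dist_eq_norm]
      linarith)
    have hcs' : HasCompactSupport (V' j t) := HasCompactSupport.intro hB hout
    have hi := (slice (hVc j) t).integrable_of_hasCompactSupport (μ := volume) hcs
    have hi' := (slice (hVc' j) t).integrable_of_hasCompactSupport (μ := volume) hcs'
    have h := integral_bilinear_hasLineDerivAt_right_eq_neg_left_of_integrable
      (μ := (volume : Measure E3)) (f := fun _ => (1 : ℝ)) (f' := fun _ => (0 : ℝ))
      (g := V j t) (g' := V' j t) (v := bv j) (B := ContinuousLinearMap.mul ℝ ℝ)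
      (by simp) (by simpa using hi') (by simpa using hi)
      (fun x _ => (hasFDerivAt_const (1 : ℝ) x).hasLineDerivAt (bv j)) (fun x _ => hV j t x)
    simpa using h
  have hsub : (∫ x in Metric.closedBall z R, g t₂ x) - ∫ x in Metric.closedBall z R, g t₁ x =
      ∫ x in Metric.closedBall z R, ∫ t in t₁..t₂, g' t x := by
    rw [← integral_sub (hio hgc t₂) (hio hgc t₁)]
    refine integral_congr_ae (Filter.Eventually.of_forall fun x => ?_)
    refine (intervalIntegral.integral_eq_sub_of_hasDerivAt (fun t _ => hg t x) ?_).symm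
    exact (hgc'.comp (by fun_prop : Continuous fun t : ℝ => (t, x))).intervalIntegrable _ _
  rw [hsub]
  have hswap : ∫ x in Metric.closedBall z R, ∫ t in t₁..t₂, g' t x =
      ∫ t in t₁..t₂, ∫ x in Metric.closedBall z R, g' t x := by
    simp only [intervalIntegral.integral_of_le h12]
    refine integral_integral_swap ?_
    rw [Measure.prod_restrict]
    have hK : IsCompact (Metric.closedBall z R ×ˢ Icc t₁ t₂) := hB.prod isCompact_Icc
    have hcont : Continuous (uncurry fun (x : E3) (t : ℝ) => g' t x) :=
      hgc'.comp (continuous_swap)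
    exact (hcont.continuousOn.integrableOn_compact (μ := volume.prod volume) hK).mono_set
      (prod_mono_right Ioc_subset_Icc_self)
  rw [hswap]
  refine intervalIntegral.integral_congr fun t ht => ?_
  rw [uIcc_of_le h12] at ht
  rw [integral_add (hio hgc' t) (integrable_finsetSum _ fun j _ => hio (hVc' j) t),
    integral_finsetSum _ (fun j _ => hio (hVc' j) t)]
  simp [hdiv _ t ht]

lemma hasDerivAt_max_zero_sq (s : ℝ) : HasDerivAt (fun s : ℝ => max 0 s ^ 2) (2 * max 0 s) s := by
  rcases lt_trichotomy s 0 with h | h | h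
  · have : (fun s : ℝ => max 0 s ^ 2) =ᶠ[nhds s] fun _ => 0 := by
      filter_upwards [Iio_mem_nhds h] with y hy
      rw [max_eq_left (le_of_lt hy)]; norm_num
    rw [max_eq_left h.le, mul_zero]
    exact (hasDerivAt_const s (0 : ℝ)).congr_of_eventuallyEq this
  · subst h
    rw [max_self, mul_zero, hasDerivAt_iff_isLittleO_nhds_zero]
    have hb : (fun h : ℝ => max 0 (0 + h) ^ 2 - max 0 0 ^ 2 - h • (0 : ℝ)) =O[nhds 0]
        fun h : ℝ => h ^ 2 := by
      refine Asymptotics.IsBigO.of_bound 1 (Filter.Eventually.of_forall fun h => ?_)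
      simp only [zero_add, max_self, smul_zero, sub_zero, one_mul, norm_pow, Real.norm_eq_abs]
      norm_num
      rw [← sq_abs h]
      gcongr
      exact max_le (abs_nonneg _) (le_abs_self _)
    refine hb.trans_isLittleO ?_
    exact Asymptotics.isLittleO_pow_id (by norm_num)
  · have : (fun s : ℝ => max 0 s ^ 2) =ᶠ[nhds s] fun s => s ^ 2 := by
      filter_upwards [Ioi_mem_nhds h] with y hy
      rw [max_eq_right (le_of_lt hy)]
    rw [max_eq_right h.le]
    exact ((hasDerivAt_pow 2 s).congr_of_eventuallyEq this).congr_deriv (by norm_num)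

lemma hasDerivAt_coord (x : E3) (i j : Fin 3) :
    HasDerivAt (fun s : ℝ => (x + s • bv j) i) (if i = j then 1 else 0) 0 := by
  have : (fun s : ℝ => (x + s • bv j) i) = fun s => x i + s * (if i = j then 1 else 0) := by
    funext s
    simp [bv]
  rw [this]
  simpa using ((hasDerivAt_id (0 : ℝ)).mul_const (if i = j then (1 : ℝ) else 0)).const_add (x i)

/-- Space derivatives along coordinate lines of a smooth function on spacetime. -/
lemma hasDerivAt_coord_line {f : ℝ × E3 → ℝ} (hf : ContDiff ℝ (⊤ : ℕ∞) f) (j : Fin 3) (t : ℝ)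
    (x : E3) : HasDerivAt (fun s : ℝ => f (t, x + s • bv j)) (pd (ex j) f (t, x)) 0 := by
  have h := hasDerivAt_line hf (ex j) (t, x)
  simpa [ex] using! h

lemma norm_sub_sq_eq (x z : E3) :
    ‖x - z‖ ^ 2 = (x 0 - z 0) ^ 2 + (x 1 - z 1) ^ 2 + (x 2 - z 2) ^ 2 := by
  rw [norm_sq_eq_sum, Fin.sum_univ_three]
  simp

/-- The derivative along coordinate lines of the squared distance to a point. -/
lemma hasDerivAt_norm_sub_sq (x z : E3) (j : Fin 3) :
    HasDerivAt (fun s : ℝ => ‖x + s • bv j - z‖ ^ 2) (2 * (x j - z j)) 0 := by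
  simp only [norm_sub_sq_eq]
  have h := fun i => ((hasDerivAt_coord x i j).sub_const (z i)).pow 2
  refine (((h 0).add (h 1)).add (h 2)).congr_deriv ?_
  fin_cases j <;> simp

lemma sum_mul_sq_le (q₀ q₁ q₂ r₀ r₁ r₂ : ℝ) : (q₀ * r₀ + q₁ * r₁ + q₂ * r₂) ^ 2 ≤
    (q₀ ^ 2 + q₁ ^ 2 + q₂ ^ 2) * (r₀ ^ 2 + r₁ ^ 2 + r₂ ^ 2) := by
  nlinarith [sq_nonneg (q₀ * r₁ - q₁ * r₀), sq_nonneg (q₀ * r₂ - q₂ * r₀),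
    sq_nonneg (q₁ * r₂ - q₂ * r₁)]

lemma mul_sum_mul_le {p q₀ q₁ q₂ r₀ r₁ r₂ l : ℝ} (v : ℝ) (hl : 0 ≤ l)
    (h : r₀ ^ 2 + r₁ ^ 2 + r₂ ^ 2 ≤ l ^ 2) :
    p * (q₀ * r₀ + q₁ * r₁ + q₂ * r₂) ≤
      l * ((1/2) * p ^ 2 + (1/2) * (q₀ ^ 2 + q₁ ^ 2 + q₂ ^ 2) + (1/6) * v ^ 6) := by
  have hv : 0 ≤ v ^ 6 := by positivity
  have h1 : (p * (q₀ * r₀ + q₁ * r₁ + q₂ * r₂)) ^ 2 ≤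
      (l * ((1/2) * p ^ 2 + (1/2) * (q₀ ^ 2 + q₁ ^ 2 + q₂ ^ 2))) ^ 2 := by
    have h2 := sum_mul_sq_le q₀ q₁ q₂ r₀ r₁ r₂
    have h3 : (q₀ ^ 2 + q₁ ^ 2 + q₂ ^ 2) * (r₀ ^ 2 + r₁ ^ 2 + r₂ ^ 2) ≤
        (q₀ ^ 2 + q₁ ^ 2 + q₂ ^ 2) * l ^ 2 := by gcongr
    calc _ = p ^ 2 * (q₀ * r₀ + q₁ * r₁ + q₂ * r₂) ^ 2 := by ring
      _ ≤ p ^ 2 * ((q₀ ^ 2 + q₁ ^ 2 + q₂ ^ 2) * l ^ 2) := by gcongr; exact h2.trans h3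
      _ ≤ _ := by
        have : 0 ≤ l ^ 2 * (p ^ 2 - (q₀ ^ 2 + q₁ ^ 2 + q₂ ^ 2)) ^ 2 := by positivity
        nlinarith
  have h4 := (le_abs_self _).trans (abs_le_of_sq_le_sq h1 (by positivity))
  have h5 := mul_nonneg hl hv
  linarith

section propagation
variable {u : ℝ → E3 → ℝ}

lemma pd_et_ex (hu : ContDiff ℝ (⊤ : ℕ∞) (uncurry u)) (j : Fin 3) (p : ℝ × E3) :
    pd et (pd (ex j) (uncurry u)) p = pd (ex j) (pd et (uncurry u)) p := pd_comm hu _ _ _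

/-- Monotonicity of the energy in backward light cones. -/
lemma IsNLW.setIntegral_edens_le (hu : IsNLW u) {a t ρ : ℝ} (hat : a ≤ t) (hρ : 0 < ρ) (z : E3) :
    ∫ x in Metric.closedBall z (3 * ρ), edens u t x ≤
      84 * ∫ x in Metric.closedBall z (2 * (t - a) + 4 * ρ), edens u a x := by
  have hs := hu.contDiff
  set U := uncurry u with hU
  set L := 2 * (t - a) + 4 * ρ with hL
  set m : ℝ → E3 → ℝ := fun s x => max 0 ((L - (s - a)) ^ 2 - ‖x - z‖ ^ 2) with hm
  have hec := continuous_edens hs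
  have hmc : Continuous (uncurry m) := by simp only [hm]; fun_prop
  have c0 := (contDiff_pd hs et).continuous
  have c1 := fun i => (contDiff_pd hs (ex i)).continuous
  have c00 := (contDiff_pd (contDiff_pd hs et) et).continuous
  have c01 := fun i => (contDiff_pd (contDiff_pd hs et) (ex i)).continuous
  have c11 := fun i => (contDiff_pd (contDiff_pd hs (ex i)) (ex i)).continuous
  set g : ℝ → E3 → ℝ := fun s x => edens u s x * m s x ^ 2 with hg
  set e' : ℝ → E3 → ℝ := fun s x => pd et U (s, x) * pd et (pd et U) (s, x) +
    (∑ i, pd (ex i) U (s, x) * pd (ex i) (pd et U) (s, x)) + U (s, x) ^ 5 * pd et U (s, x) with he'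
  set g' : ℝ → E3 → ℝ := fun s x => e' s x * m s x ^ 2 +
    edens u s x * (2 * m s x * (-2 * (L - (s - a)))) with hg'
  set V : Fin 3 → ℝ → E3 → ℝ := fun j s x => -(pd et U (s, x) * pd (ex j) U (s, x)) * m s x ^ 2
    with hV
  set V' : Fin 3 → ℝ → E3 → ℝ := fun j s x =>
    -(pd (ex j) (pd et U) (s, x) * pd (ex j) U (s, x) +
      pd et U (s, x) * pd (ex j) (pd (ex j) U) (s, x)) * m s x ^ 2 +
    -(pd et U (s, x) * pd (ex j) U (s, x)) * (2 * m s x * (-(2 * (x j - z j)))) with hV'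
  have hUc : Continuous U := hs.continuous
  have hed : ∀ s x, HasDerivAt (fun s => edens u s x) (e' s x) s := by
    intro s x
    have h0 := (hasDerivAt_time (contDiff_pd hs et) s x).pow 2
    have h1 := fun i : Fin 3 => (hasDerivAt_time (contDiff_pd hs (ex i)) s x).pow 2
    have h2 := (hasDerivAt_time hs s x).pow 6
    have h3 := ((h0.const_mul (1/2)).add ((HasDerivAt.fun_sum (u := Finset.univ) fun i _ => h1 i).const_mul (1/2))).add
      (h2.const_mul (1/6))
    refine h3.congr_deriv ?_
    have hc : ∀ (j : Fin 3) p, pd et (pd (ex j) U) p = pd (ex j) (pd et U) p :=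
      fun j p => pd_et_ex hs j p
    simp only [he', Fin.sum_univ_three, hc]
    simp only [hU, uncurry]
    push_cast
    ring
  have hflux := integral_ball_sub_eq (g := g) (g' := g') (V := V) (V' := V') (R := L) (t₁ := a)
    (t₂ := t) (by simp only [hg]; exact hec.mul (hmc.pow 2))
    (by
      simp only [hg', he']
      refine Continuous.add (Continuous.mul ?_ (hmc.pow 2)) (hec.mul ?_)
      · simp only [Prod.mk.eta]; fun_prop
      · exact (continuous_const.mul hmc).mul (by fun_prop))
    (fun j => by
      simp only [hV]
      exact Continuous.mul (by fun_prop) (hmc.pow 2))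
    (fun j => by
      simp only [hV']
      refine Continuous.add (Continuous.mul ?_ (hmc.pow 2))
        (Continuous.mul ?_ ((continuous_const.mul hmc).mul ?_)) <;> fun_prop)
    (fun s x => by
      have h1 : HasDerivAt (fun s => (L - (s - a)) ^ 2 - ‖x - z‖ ^ 2) (-2 * (L - (s - a))) s := by
        refine ((((hasDerivAt_id s).sub_const a).const_sub L).pow 2).sub_const _ |>.congr_deriv ?_
        simp
      have h2 := (hasDerivAt_max_zero_sq _).comp s h1
      exact (hed s x).mul h2)
    (fun j s x => by
      have h1 : HasDerivAt (fun σ : ℝ => (L - (s - a)) ^ 2 - ‖x + σ • bv j - z‖ ^ 2)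
          (-(2 * (x j - z j))) 0 := (hasDerivAt_norm_sub_sq x z j).const_sub _
      have h2 := (hasDerivAt_max_zero_sq _).comp (0 : ℝ) h1
      have h3 := ((hasDerivAt_coord_line (contDiff_pd hs et) j s x).mul
        (hasDerivAt_coord_line (contDiff_pd hs (ex j)) j s x)).neg
      have h4 := h3.mul h2
      simp only [zero_smul, add_zero] at h4
      refine h4.congr_deriv ?_
      simp [hV', hm])
    z hat
    (fun j s hs' x hx => by
      have h0 : m s x = 0 := by
        simp only [hm]
        refine max_eq_left ?_
        have h1 : 0 ≤ L - (s - a) := by linarith [hs'.2]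
        have h2 : L - (s - a) ≤ ‖x - z‖ := by linarith [hs'.1]
        nlinarith
      simp [hV, h0])
  have hD : ∀ s ∈ Icc a t, ∀ x, g' s x + ∑ j, V' j s x ≤ 0 := by
    intro s hs' x
    have heq := nlw_eq hu s x
    have hl : 0 ≤ L - (s - a) := by linarith [hs'.2]
    have hm0 : 0 ≤ m s x := le_max_left _ _
    have key : g' s x + ∑ j, V' j s x = 4 * m s x * (pd et U (s, x) *
        (pd (ex 0) U (s, x) * (x 0 - z 0) + pd (ex 1) U (s, x) * (x 1 - z 1) +
          pd (ex 2) U (s, x) * (x 2 - z 2)) - (L - (s - a)) * edens u s x) := by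
      simp only [hg', hV', he', Fin.sum_univ_three]
      rw [Fin.sum_univ_three] at heq
      rw [heq]
      simp only [hU, uncurry]
      ring
    rw [key]
    rcases hm0.eq_or_lt with h | h
    · rw [← h]; simp
    · have hlt : ‖x - z‖ ^ 2 ≤ (L - (s - a)) ^ 2 := by
        by_contra hcon
        have : m s x = 0 := max_eq_left (by linarith)
        linarith
      rw [norm_sub_sq_eq] at hlt
      have := mul_sum_mul_le (p := pd et U (s, x)) (q₀ := pd (ex 0) U (s, x))
        (q₁ := pd (ex 1) U (s, x)) (q₂ := pd (ex 2) U (s, x)) (u s x) hl hlt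
      have h5 : edens u s x = (1/2) * pd et U (s, x) ^ 2 + (1/2) * (pd (ex 0) U (s, x) ^ 2 +
        pd (ex 1) U (s, x) ^ 2 + pd (ex 2) U (s, x) ^ 2) + (1/6) * (u s x) ^ 6 := by
        rw [edens, Fin.sum_univ_three]
      rw [h5]
      exact mul_nonpos_of_nonneg_of_nonpos (by positivity) (by linarith)
  have hle : ∫ x in Metric.closedBall z L, g t x ≤ ∫ x in Metric.closedBall z L, g a x := by
    have : ∫ s in a..t, ∫ x in Metric.closedBall z L, (g' s x + ∑ j, V' j s x) ≤ 0 := by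
      rw [intervalIntegral.integral_of_le hat]
      refine setIntegral_nonpos measurableSet_Ioc fun s hs' => ?_
      exact setIntegral_nonpos measurableSet_closedBall fun x _ =>
        hD s (Ioc_subset_Icc_self hs') x
    linarith
  set d := t - a + 4 * ρ with hd
  have hd0 : 0 < d := by linarith
  have hi : ∀ s, Integrable (edens u s) := fun s => hu.integrable_edens s
  have hgi : ∀ s, IntegrableOn (g s) (Metric.closedBall z L) := fun s =>
    (Continuous.continuousOn (by
      simp only [hg]
      exact (hec.comp (by fun_prop : Continuous fun x : E3 => (s, x))).mul
        ((hmc.comp (by fun_prop : Continuous fun x : E3 => (s, x))).pow 2))).integrableOn_compact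
      (isCompact_closedBall z L)
  have hlow : (7 / 16 * d ^ 2) ^ 2 * ∫ x in Metric.closedBall z (3 * ρ), edens u t x ≤
      ∫ x in Metric.closedBall z L, g t x := by
    rw [← integral_const_mul]
    calc _ ≤ ∫ x in Metric.closedBall z (3 * ρ), g t x := by
          refine setIntegral_mono_on ((hi t).integrableOn.const_mul _)
            ((hgi t).mono_set (Metric.closedBall_subset_closedBall (by linarith)))
            measurableSet_closedBall fun x hx => ?_
          have h1 : ‖x - z‖ ≤ 3 * ρ := by rw [← dist_eq_norm]; exact hx
          have h2 : 7 / 16 * d ^ 2 ≤ m t x := by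
            refine le_trans ?_ (le_max_right _ _)
            have h3 : L - (t - a) = d := by rw [hL, hd]; ring
            rw [h3]
            have h4 : ‖x - z‖ ≤ 3 / 4 * d := by linarith
            nlinarith [norm_nonneg (x - z)]
          simp only [hg]
          rw [mul_comm]
          have := edens_nonneg (u := u) t x
          gcongr
      _ ≤ _ := by
          refine setIntegral_mono_set (hgi t) (Filter.Eventually.of_forall fun x => ?_)
            (Metric.closedBall_subset_closedBall (by linarith)).eventuallyLE
          have := edens_nonneg (u := u) t x
          simp only [hg, Pi.zero_apply]
          positivity
  have hup : ∫ x in Metric.closedBall z L, g a x ≤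
      16 * d ^ 4 * ∫ x in Metric.closedBall z L, edens u a x := by
    rw [← integral_const_mul]
    refine setIntegral_mono_on (hgi a) ((hi a).integrableOn.const_mul _)
      measurableSet_closedBall fun x _ => ?_
    have h2 : m a x ≤ 4 * d ^ 2 := by
      refine max_le (by positivity) ?_
      have : 0 ≤ L := by linarith
      nlinarith [sq_nonneg ‖x - z‖]
    have h3 : m a x ^ 2 ≤ (4 * d ^ 2) ^ 2 := by
      gcongr
    have := edens_nonneg (u := u) a x
    simp only [hg]
    calc edens u a x * m a x ^ 2 ≤ edens u a x * (4 * d ^ 2) ^ 2 := by gcongr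
      _ = _ := by ring
  have h0 : 0 ≤ ∫ x in Metric.closedBall z L, edens u a x :=
    setIntegral_nonneg measurableSet_closedBall fun x _ => edens_nonneg a x
  have hfin : d ^ 4 * (49 / 256 * ∫ x in Metric.closedBall z (3 * ρ), edens u t x) ≤
      d ^ 4 * (16 * ∫ x in Metric.closedBall z L, edens u a x) := by
    calc _ = (7 / 16 * d ^ 2) ^ 2 * ∫ x in Metric.closedBall z (3 * ρ), edens u t x := by ring
      _ ≤ _ := hlow.trans (hle.trans hup)
      _ = _ := by ring
  have := le_of_mul_le_mul_left hfin (by positivity)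
  linarith

end propagation

/-- The weight `(ρ² + |x - y|²)^{-1/2}`. -/
def mw (ρ : ℝ) (y x : E3) : ℝ := (√(ρ ^ 2 + ‖x - y‖ ^ 2))⁻¹

section weight
variable {ρ : ℝ}

lemma mw_pos (hρ : 0 < ρ) (y x : E3) : 0 < mw ρ y x := by
  unfold mw
  positivity

lemma mw_sq_mul (hρ : 0 < ρ) (y x : E3) : mw ρ y x ^ 2 * (ρ ^ 2 + ‖x - y‖ ^ 2) = 1 := by
  unfold mw
  have h : 0 < ρ ^ 2 + ‖x - y‖ ^ 2 := by positivity
  rw [inv_pow, Real.sq_sqrt h.le, inv_mul_cancel₀ h.ne']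

lemma continuous_mw (hρ : 0 < ρ) (y : E3) : Continuous (mw ρ y) := by
  unfold mw
  refine Continuous.inv₀ (by fun_prop) fun x => ?_
  positivity

lemma hasDerivAt_mw (hρ : 0 < ρ) (y x : E3) (j : Fin 3) :
    HasDerivAt (fun s : ℝ => mw ρ y (x + s • bv j)) (-(x j - y j) * mw ρ y x ^ 3) 0 := by
  have h0 : 0 < ρ ^ 2 + ‖x - y‖ ^ 2 := by positivity
  have h1 := (hasDerivAt_norm_sub_sq x y j).const_add (ρ ^ 2)
  have h2 := h1.sqrt (by simpa using h0.ne')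
  have h3 := h2.fun_inv (by simpa using (Real.sqrt_pos.2 h0).ne')
  refine h3.congr_deriv ?_
  simp only [zero_smul, add_zero, mw]
  have h4 := (Real.sqrt_pos.2 h0).ne'
  field_simp

end weight

section algebra

lemma morawetz_identity {ρ w v p pt r₀ r₁ r₂ q₀ q₁ q₂ q₀₀ q₀₁ q₀₂ q₁₁ q₁₂ q₂₂ p₀ p₁ p₂ : ℝ}
    (hw : w ^ 2 * (ρ ^ 2 + (r₀ ^ 2 + r₁ ^ 2 + r₂ ^ 2)) = 1)
    (heq : pt = q₀₀ + q₁₁ + q₂₂ - v ^ 5) :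
    (pt * (r₀ * w * q₀ + r₁ * w * q₁ + r₂ * w * q₂ + (w + ρ ^ 2 / 2 * w ^ 3) * v) +
      p * (r₀ * w * p₀ + r₁ * w * p₁ + r₂ * w * p₂ + (w + ρ ^ 2 / 2 * w ^ 3) * p)) -
    ((q₀₀ * (r₀ * w * q₀ + r₁ * w * q₁ + r₂ * w * q₂ + (w + ρ ^ 2 / 2 * w ^ 3) * v) +
      q₀ * (w * q₀ - r₀ * w ^ 3 * (r₀ * q₀ + r₁ * q₁ + r₂ * q₂) +
        w * (r₀ * q₀₀ + r₁ * q₀₁ + r₂ * q₀₂) + (w + ρ ^ 2 / 2 * w ^ 3) * q₀ +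
        (-r₀ * w ^ 3 - 3 / 2 * ρ ^ 2 * r₀ * w ^ 5) * v) +
      (w - r₀ ^ 2 * w ^ 3) * (p ^ 2 / 2 - (q₀ ^ 2 + q₁ ^ 2 + q₂ ^ 2) / 2 - v ^ 6 / 6) +
      r₀ * w * (p * p₀ - (q₀ * q₀₀ + q₁ * q₀₁ + q₂ * q₀₂) - v ^ 5 * q₀) +
      ((w ^ 3 / 2 + 3 / 4 * ρ ^ 2 * w ^ 5) - r₀ ^ 2 * (3 / 2 * w ^ 5 + 15 / 4 * ρ ^ 2 * w ^ 7)) *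
        v ^ 2 + r₀ * (w ^ 3 / 2 + 3 / 4 * ρ ^ 2 * w ^ 5) * (2 * v * q₀)) +
     (q₁₁ * (r₀ * w * q₀ + r₁ * w * q₁ + r₂ * w * q₂ + (w + ρ ^ 2 / 2 * w ^ 3) * v) +
      q₁ * (w * q₁ - r₁ * w ^ 3 * (r₀ * q₀ + r₁ * q₁ + r₂ * q₂) +
        w * (r₀ * q₀₁ + r₁ * q₁₁ + r₂ * q₁₂) + (w + ρ ^ 2 / 2 * w ^ 3) * q₁ +
        (-r₁ * w ^ 3 - 3 / 2 * ρ ^ 2 * r₁ * w ^ 5) * v) +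
      (w - r₁ ^ 2 * w ^ 3) * (p ^ 2 / 2 - (q₀ ^ 2 + q₁ ^ 2 + q₂ ^ 2) / 2 - v ^ 6 / 6) +
      r₁ * w * (p * p₁ - (q₀ * q₀₁ + q₁ * q₁₁ + q₂ * q₁₂) - v ^ 5 * q₁) +
      ((w ^ 3 / 2 + 3 / 4 * ρ ^ 2 * w ^ 5) - r₁ ^ 2 * (3 / 2 * w ^ 5 + 15 / 4 * ρ ^ 2 * w ^ 7)) *
        v ^ 2 + r₁ * (w ^ 3 / 2 + 3 / 4 * ρ ^ 2 * w ^ 5) * (2 * v * q₁)) +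
     (q₂₂ * (r₀ * w * q₀ + r₁ * w * q₁ + r₂ * w * q₂ + (w + ρ ^ 2 / 2 * w ^ 3) * v) +
      q₂ * (w * q₂ - r₂ * w ^ 3 * (r₀ * q₀ + r₁ * q₁ + r₂ * q₂) +
        w * (r₀ * q₀₂ + r₁ * q₁₂ + r₂ * q₂₂) + (w + ρ ^ 2 / 2 * w ^ 3) * q₂ +
        (-r₂ * w ^ 3 - 3 / 2 * ρ ^ 2 * r₂ * w ^ 5) * v) +
      (w - r₂ ^ 2 * w ^ 3) * (p ^ 2 / 2 - (q₀ ^ 2 + q₁ ^ 2 + q₂ ^ 2) / 2 - v ^ 6 / 6) +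
      r₂ * w * (p * p₂ - (q₀ * q₀₂ + q₁ * q₁₂ + q₂ * q₂₂) - v ^ 5 * q₂) +
      ((w ^ 3 / 2 + 3 / 4 * ρ ^ 2 * w ^ 5) - r₂ ^ 2 * (3 / 2 * w ^ 5 + 15 / 4 * ρ ^ 2 * w ^ 7)) *
        v ^ 2 + r₂ * (w ^ 3 / 2 + 3 / 4 * ρ ^ 2 * w ^ 5) * (2 * v * q₂))) =
    -(w * (q₀ ^ 2 + q₁ ^ 2 + q₂ ^ 2) - w ^ 3 * (r₀ * q₀ + r₁ * q₁ + r₂ * q₂) ^ 2 +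
      15 / 4 * ρ ^ 4 * w ^ 7 * v ^ 2 + (2 / 3 * w + ρ ^ 2 / 3 * w ^ 3) * v ^ 6) := by
  subst heq
  linear_combination (w * (p ^ 2 / 2 - (q₀ ^ 2 + q₁ ^ 2 + q₂ ^ 2) / 2 - v ^ 6 / 6) +
    (3 / 2 * w ^ 3 + 15 / 4 * ρ ^ 2 * w ^ 5) * v ^ 2) * hw

lemma morawetz_potential_le {ρ w v r₀ r₁ r₂ q₀ q₁ q₂ : ℝ} (hw0 : 0 < w)
    (hw : w ^ 2 * (ρ ^ 2 + (r₀ ^ 2 + r₁ ^ 2 + r₂ ^ 2)) = 1) :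
    2 / 3 * (w * v ^ 6) ≤
      w * (q₀ ^ 2 + q₁ ^ 2 + q₂ ^ 2) - w ^ 3 * (r₀ * q₀ + r₁ * q₁ + r₂ * q₂) ^ 2 +
      15 / 4 * ρ ^ 4 * w ^ 7 * v ^ 2 + (2 / 3 * w + ρ ^ 2 / 3 * w ^ 3) * v ^ 6 := by
  have h1 := sum_mul_sq_le r₀ r₁ r₂ q₀ q₁ q₂
  have h2 : w ^ 3 * (r₀ * q₀ + r₁ * q₁ + r₂ * q₂) ^ 2 ≤ w * (q₀ ^ 2 + q₁ ^ 2 + q₂ ^ 2) := by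
    calc _ ≤ w ^ 3 * ((r₀ ^ 2 + r₁ ^ 2 + r₂ ^ 2) * (q₀ ^ 2 + q₁ ^ 2 + q₂ ^ 2)) := by gcongr
      _ = w * (w ^ 2 * (r₀ ^ 2 + r₁ ^ 2 + r₂ ^ 2)) * (q₀ ^ 2 + q₁ ^ 2 + q₂ ^ 2) := by ring
      _ ≤ w * 1 * (q₀ ^ 2 + q₁ ^ 2 + q₂ ^ 2) := by
        gcongr
        have : 0 ≤ w ^ 2 * ρ ^ 2 := by positivity
        linarith
      _ = _ := by ring
  have h3 : 0 ≤ 15 / 4 * ρ ^ 4 * w ^ 7 * v ^ 2 := by positivity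
  have h4 : 0 ≤ ρ ^ 2 / 3 * w ^ 3 * v ^ 6 := by positivity
  linarith

end algebra

section currents

lemma morawetz_multiplier_sq_le {ρ w v k r₀ r₁ r₂ q₀ q₁ q₂ : ℝ}
    (hw : w ^ 2 * (ρ ^ 2 + (r₀ ^ 2 + r₁ ^ 2 + r₂ ^ 2)) = 1) (hk : w ^ 2 * v ^ 2 ≤ k) :
    (r₀ * w * q₀ + r₁ * w * q₁ + r₂ * w * q₂ + (w + ρ ^ 2 / 2 * w ^ 3) * v) ^ 2 ≤
      2 * (q₀ ^ 2 + q₁ ^ 2 + q₂ ^ 2) + 5 * k := by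
  have h1 := sum_mul_sq_le r₀ r₁ r₂ q₀ q₁ q₂
  have h2 : (w * (r₀ * q₀ + r₁ * q₁ + r₂ * q₂)) ^ 2 ≤ q₀ ^ 2 + q₁ ^ 2 + q₂ ^ 2 := by
    calc _ = w ^ 2 * (r₀ * q₀ + r₁ * q₁ + r₂ * q₂) ^ 2 := by ring
      _ ≤ w ^ 2 * ((r₀ ^ 2 + r₁ ^ 2 + r₂ ^ 2) * (q₀ ^ 2 + q₁ ^ 2 + q₂ ^ 2)) := by gcongr
      _ = (w ^ 2 * (r₀ ^ 2 + r₁ ^ 2 + r₂ ^ 2)) * (q₀ ^ 2 + q₁ ^ 2 + q₂ ^ 2) := by ring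
      _ ≤ 1 * (q₀ ^ 2 + q₁ ^ 2 + q₂ ^ 2) := by
        gcongr
        have : 0 ≤ w ^ 2 * ρ ^ 2 := by positivity
        linarith
      _ = _ := by ring
  have h3 : w ^ 2 * ρ ^ 2 ≤ 1 := by
    have : 0 ≤ w ^ 2 * (r₀ ^ 2 + r₁ ^ 2 + r₂ ^ 2) := by positivity
    linarith
  have h4 : ((w + ρ ^ 2 / 2 * w ^ 3) * v) ^ 2 ≤ 9 / 4 * k := by
    calc _ = (1 + w ^ 2 * ρ ^ 2 / 2) ^ 2 * (w ^ 2 * v ^ 2) := by ring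
      _ ≤ (1 + 1 / 2) ^ 2 * k := by gcongr
      _ = _ := by norm_num
  have h5 : 0 ≤ k := le_trans (by positivity) hk
  nlinarith [sq_nonneg (w * (r₀ * q₀ + r₁ * q₁ + r₂ * q₂) - (w + ρ ^ 2 / 2 * w ^ 3) * v)]

lemma abs_morawetz_current_le {ρ w v k p r q s r₀ r₁ r₂ q₀ q₁ q₂ M : ℝ} (hw0 : 0 < w)
    (hw : w ^ 2 * (ρ ^ 2 + (r₀ ^ 2 + r₁ ^ 2 + r₂ ^ 2)) = 1) (hk : w ^ 2 * v ^ 2 ≤ k)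
    (hr : r ^ 2 ≤ r₀ ^ 2 + r₁ ^ 2 + r₂ ^ 2) (hq : q ^ 2 ≤ s) (hs : s = q₀ ^ 2 + q₁ ^ 2 + q₂ ^ 2)
    (hM : M ^ 2 ≤ 2 * s + 5 * k) :
    |q * M + r * w * (p ^ 2 / 2 - s / 2 - v ^ 6 / 6) +
      r * (w ^ 3 / 2 + 3 / 4 * ρ ^ 2 * w ^ 5) * v ^ 2| ≤
      10 * ((1/2) * p ^ 2 + (1/2) * s + (1/6) * v ^ 6 + k) := by
  have hv : 0 ≤ v ^ 6 := by positivity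
  have hs0 : 0 ≤ s := by rw [hs]; positivity
  have h3 : w ^ 2 * ρ ^ 2 ≤ 1 := by
    have : 0 ≤ w ^ 2 * (r₀ ^ 2 + r₁ ^ 2 + r₂ ^ 2) := by positivity
    linarith
  have hrw : |r * w| ≤ 1 := by
    refine abs_le_of_sq_le_sq (b := 1) ?_ one_pos.le
    calc (r * w) ^ 2 = w ^ 2 * r ^ 2 := by ring
      _ ≤ w ^ 2 * (r₀ ^ 2 + r₁ ^ 2 + r₂ ^ 2) := by gcongr
      _ ≤ 1 ^ 2 := by
        have : 0 ≤ w ^ 2 * ρ ^ 2 := by positivity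
        linarith
  have t1 : |q * M| ≤ q ^ 2 + M ^ 2 / 4 := by
    rw [abs_mul, ← sq_abs q, ← sq_abs M]
    nlinarith [sq_nonneg (|q| - |M| / 2)]
  have t2 : |r * w * (p ^ 2 / 2 - s / 2 - v ^ 6 / 6)| ≤ p ^ 2 / 2 + s / 2 + v ^ 6 / 6 := by
    rw [abs_mul]
    calc _ ≤ 1 * |p ^ 2 / 2 - s / 2 - v ^ 6 / 6| := by gcongr
      _ ≤ _ := by
        rw [one_mul, abs_le]
        constructor <;> linarith [sq_nonneg p]
  have t3 : |r * (w ^ 3 / 2 + 3 / 4 * ρ ^ 2 * w ^ 5) * v ^ 2| ≤ 5 / 4 * k := by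
    have : r * (w ^ 3 / 2 + 3 / 4 * ρ ^ 2 * w ^ 5) * v ^ 2 =
        (r * w) * ((1 / 2 + 3 / 4 * (w ^ 2 * ρ ^ 2)) * (w ^ 2 * v ^ 2)) := by ring
    rw [this, abs_mul]
    calc _ ≤ 1 * |(1 / 2 + 3 / 4 * (w ^ 2 * ρ ^ 2)) * (w ^ 2 * v ^ 2)| := by gcongr
      _ = (1 / 2 + 3 / 4 * (w ^ 2 * ρ ^ 2)) * (w ^ 2 * v ^ 2) := by
        rw [one_mul, abs_of_nonneg (by positivity)]
      _ ≤ (1 / 2 + 3 / 4 * 1) * k := by gcongr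
      _ = _ := by norm_num
  have hk0 : 0 ≤ k := le_trans (by positivity) hk
  refine (abs_add_three _ _ _).trans ?_
  linarith [sq_nonneg p]

/-- The Morawetz multiplier applied to `u`. -/
def morM (ρ : ℝ) (y : E3) (u : ℝ → E3 → ℝ) (t : ℝ) (x : E3) : ℝ :=
  (x 0 - y 0) * mw ρ y x * pd (ex 0) (uncurry u) (t, x) +
  (x 1 - y 1) * mw ρ y x * pd (ex 1) (uncurry u) (t, x) +
  (x 2 - y 2) * mw ρ y x * pd (ex 2) (uncurry u) (t, x) +
  (mw ρ y x + ρ ^ 2 / 2 * mw ρ y x ^ 3) * u t x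

/-- The time component of the Morawetz current. -/
def morN (ρ : ℝ) (y : E3) (u : ℝ → E3 → ℝ) (t : ℝ) (x : E3) : ℝ :=
  pd et (uncurry u) (t, x) * morM ρ y u t x

/-- The time derivative of `morN`. -/
def morN' (ρ : ℝ) (y : E3) (u : ℝ → E3 → ℝ) (t : ℝ) (x : E3) : ℝ :=
  pd et (pd et (uncurry u)) (t, x) * morM ρ y u t x +
  pd et (uncurry u) (t, x) * (
    (x 0 - y 0) * mw ρ y x * pd et (pd (ex 0) (uncurry u)) (t, x) +
    (x 1 - y 1) * mw ρ y x * pd et (pd (ex 1) (uncurry u)) (t, x) +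
    (x 2 - y 2) * mw ρ y x * pd et (pd (ex 2) (uncurry u)) (t, x) +
    (mw ρ y x + ρ ^ 2 / 2 * mw ρ y x ^ 3) * pd et (uncurry u) (t, x))

/-- The space components of the Morawetz current. -/
def morJ (ρ : ℝ) (y : E3) (u : ℝ → E3 → ℝ) (j : Fin 3) (t : ℝ) (x : E3) : ℝ :=
  pd (ex j) (uncurry u) (t, x) * morM ρ y u t x +
  (x j - y j) * mw ρ y x * (pd et (uncurry u) (t, x) ^ 2 / 2 -
    (pd (ex 0) (uncurry u) (t, x) ^ 2 + pd (ex 1) (uncurry u) (t, x) ^ 2 +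
      pd (ex 2) (uncurry u) (t, x) ^ 2) / 2 - u t x ^ 6 / 6) +
  (x j - y j) * (mw ρ y x ^ 3 / 2 + 3 / 4 * ρ ^ 2 * mw ρ y x ^ 5) * u t x ^ 2

/-- The derivative of `morJ` in the matching coordinate direction. -/
def morJ' (ρ : ℝ) (y : E3) (u : ℝ → E3 → ℝ) (j : Fin 3) (t : ℝ) (x : E3) : ℝ :=
  pd (ex j) (pd (ex j) (uncurry u)) (t, x) * morM ρ y u t x +
  pd (ex j) (uncurry u) (t, x) * (mw ρ y x * pd (ex j) (uncurry u) (t, x) -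
    (x j - y j) * mw ρ y x ^ 3 * ((x 0 - y 0) * pd (ex 0) (uncurry u) (t, x) +
      (x 1 - y 1) * pd (ex 1) (uncurry u) (t, x) + (x 2 - y 2) * pd (ex 2) (uncurry u) (t, x)) +
    mw ρ y x * ((x 0 - y 0) * pd (ex j) (pd (ex 0) (uncurry u)) (t, x) +
      (x 1 - y 1) * pd (ex j) (pd (ex 1) (uncurry u)) (t, x) +
      (x 2 - y 2) * pd (ex j) (pd (ex 2) (uncurry u)) (t, x)) +
    (mw ρ y x + ρ ^ 2 / 2 * mw ρ y x ^ 3) * pd (ex j) (uncurry u) (t, x) +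
    (-(x j - y j) * mw ρ y x ^ 3 - 3 / 2 * ρ ^ 2 * (x j - y j) * mw ρ y x ^ 5) * u t x) +
  (mw ρ y x - (x j - y j) ^ 2 * mw ρ y x ^ 3) * (pd et (uncurry u) (t, x) ^ 2 / 2 -
    (pd (ex 0) (uncurry u) (t, x) ^ 2 + pd (ex 1) (uncurry u) (t, x) ^ 2 +
      pd (ex 2) (uncurry u) (t, x) ^ 2) / 2 - u t x ^ 6 / 6) +
  (x j - y j) * mw ρ y x * (pd et (uncurry u) (t, x) * pd (ex j) (pd et (uncurry u)) (t, x) -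
    (pd (ex 0) (uncurry u) (t, x) * pd (ex j) (pd (ex 0) (uncurry u)) (t, x) +
      pd (ex 1) (uncurry u) (t, x) * pd (ex j) (pd (ex 1) (uncurry u)) (t, x) +
      pd (ex 2) (uncurry u) (t, x) * pd (ex j) (pd (ex 2) (uncurry u)) (t, x)) -
    u t x ^ 5 * pd (ex j) (uncurry u) (t, x)) +
  ((mw ρ y x ^ 3 / 2 + 3 / 4 * ρ ^ 2 * mw ρ y x ^ 5) -
    (x j - y j) ^ 2 * (3 / 2 * mw ρ y x ^ 5 + 15 / 4 * ρ ^ 2 * mw ρ y x ^ 7)) * u t x ^ 2 +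
  (x j - y j) * (mw ρ y x ^ 3 / 2 + 3 / 4 * ρ ^ 2 * mw ρ y x ^ 5) *
    (2 * u t x * pd (ex j) (uncurry u) (t, x))

variable {u : ℝ → E3 → ℝ} {ρ : ℝ}

lemma hasDerivAt_morN (hs : ContDiff ℝ (⊤ : ℕ∞) (uncurry u)) (y : E3) (t : ℝ) (x : E3) :
    HasDerivAt (fun s => morN ρ y u s x) (morN' ρ y u t x) t := by
  have h0 := hasDerivAt_time (contDiff_pd hs et) t x
  have h1 := fun i : Fin 3 => (hasDerivAt_time (contDiff_pd hs (ex i)) t x).const_mul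
    ((x i - y i) * mw ρ y x)
  have h2 : HasDerivAt (fun s => u s x) _ t := hasDerivAt_time hs t x
  exact h0.mul ((((h1 0).add (h1 1)).add (h1 2)).add
    (h2.const_mul (mw ρ y x + ρ ^ 2 / 2 * mw ρ y x ^ 3)))

lemma hasDerivAt_morJ (hs : ContDiff ℝ (⊤ : ℕ∞) (uncurry u)) (hρ : 0 < ρ) (y : E3) (j : Fin 3)
    (t : ℝ) (x : E3) :
    HasDerivAt (fun s : ℝ => morJ ρ y u j t (x + s • bv j)) (morJ' ρ y u j t x) 0 := by
  have hr := fun i => (hasDerivAt_coord x i j).sub_const (y i)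
  have hw := hasDerivAt_mw hρ y x j
  have hq := fun i : Fin 3 => hasDerivAt_coord_line (contDiff_pd hs (ex i)) j t x
  have hp := hasDerivAt_coord_line (contDiff_pd hs et) j t x
  have hv : HasDerivAt (fun s : ℝ => u t (x + s • bv j)) _ 0 := hasDerivAt_coord_line hs j t x
  have hM := (((((hr 0).mul hw).mul (hq 0)).add (((hr 1).mul hw).mul (hq 1))).add
    (((hr 2).mul hw).mul (hq 2))).add ((hw.add ((hw.pow 3).const_mul (ρ ^ 2 / 2))).mul hv)
  have hJ := (((hq j).mul hM).add (((hr j).mul hw).mul (((hp.pow 2).div_const 2).sub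
    (((((hq 0).pow 2).add ((hq 1).pow 2)).add ((hq 2).pow 2)).div_const 2) |>.sub
      ((hv.pow 6).div_const 6)))).add (((hr j).mul (((hw.pow 3).div_const 2).add
        ((hw.pow 5).const_mul (3 / 4 * ρ ^ 2)))).mul (hv.pow 2))
  refine HasDerivAt.congr_deriv (f := fun s : ℝ => morJ ρ y u j t (x + s • bv j)) hJ ?_
  simp only [morJ', morM, Pi.add_apply, Pi.mul_apply, Pi.sub_apply, Pi.pow_apply, zero_smul,
    add_zero]
  fin_cases j <;> simp <;> ring

lemma morN'_sub_sum_morJ' (hu : IsNLW u) (hρ : 0 < ρ) (y : E3) (t : ℝ) (x : E3) :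
    morN' ρ y u t x - ∑ j, morJ' ρ y u j t x ≤ -(2 / 3 * (mw ρ y x * u t x ^ 6)) := by
  have hs := hu.contDiff
  have hw := mw_sq_mul hρ y x
  rw [norm_sub_sq_eq] at hw
  have heq := nlw_eq hu t x
  rw [Fin.sum_univ_three] at heq
  have h1 := morawetz_potential_le (v := u t x) (q₀ := pd (ex 0) (uncurry u) (t, x))
    (q₁ := pd (ex 1) (uncurry u) (t, x)) (q₂ := pd (ex 2) (uncurry u) (t, x))
    (mw_pos hρ y x) hw
  have h2 := morawetz_identity (v := u t x) (p := pd et (uncurry u) (t, x))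
    (q₀ := pd (ex 0) (uncurry u) (t, x))
    (q₁ := pd (ex 1) (uncurry u) (t, x)) (q₂ := pd (ex 2) (uncurry u) (t, x))
    (q₀₁ := pd (ex 0) (pd (ex 1) (uncurry u)) (t, x))
    (q₀₂ := pd (ex 0) (pd (ex 2) (uncurry u)) (t, x))
    (q₁₂ := pd (ex 1) (pd (ex 2) (uncurry u)) (t, x))
    (p₀ := pd (ex 0) (pd et (uncurry u)) (t, x))
    (p₁ := pd (ex 1) (pd et (uncurry u)) (t, x))
    (p₂ := pd (ex 2) (pd et (uncurry u)) (t, x)) hw heq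
  refine le_trans (le_of_eq ?_) (neg_le_neg h1)
  rw [← h2, Fin.sum_univ_three]
  simp only [morN', morJ', morM, pd_et_ex hs, pd_comm hs (ex 1) (ex 0), pd_comm hs (ex 2) (ex 0),
    pd_comm hs (ex 2) (ex 1)]

lemma morK_le (hρ : 0 < ρ) (y : E3) (t : ℝ) (x : E3) :
    mw ρ y x ^ 2 * u t x ^ 2 ≤ u t x ^ 2 / ρ ^ 2 := by
  have hw := mw_sq_mul hρ y x
  rw [le_div_iff₀ (by positivity)]
  have : 0 ≤ mw ρ y x ^ 2 * ‖x - y‖ ^ 2 := by positivity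
  nlinarith [sq_nonneg (u t x)]

lemma abs_morN_le (hρ : 0 < ρ) (y : E3) (t : ℝ) (x : E3) :
    |morN ρ y u t x| ≤ 3 * (edens u t x + u t x ^ 2 / ρ ^ 2) := by
  have hw := mw_sq_mul hρ y x
  rw [norm_sub_sq_eq] at hw
  have hk := morK_le (u := u) hρ y t x
  have h := morawetz_multiplier_sq_le (q₀ := pd (ex 0) (uncurry u) (t, x))
    (q₁ := pd (ex 1) (uncurry u) (t, x)) (q₂ := pd (ex 2) (uncurry u) (t, x)) hw hk
  have h1 : |morN ρ y u t x| ≤ pd et (uncurry u) (t, x) ^ 2 + morM ρ y u t x ^ 2 / 4 := by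
    unfold morN
    rw [abs_mul, ← sq_abs (pd et (uncurry u) (t, x)), ← sq_abs (morM ρ y u t x)]
    nlinarith [sq_nonneg (|pd et (uncurry u) (t, x)| - |morM ρ y u t x| / 2)]
  have h2 : 0 ≤ u t x ^ 6 := by positivity
  have h3 : 0 ≤ u t x ^ 2 / ρ ^ 2 := by positivity
  unfold morM at h1
  rw [edens, Fin.sum_univ_three]
  nlinarith [sq_nonneg (pd et (uncurry u) (t, x)), sq_nonneg (pd (ex 0) (uncurry u) (t, x)),
    sq_nonneg (pd (ex 1) (uncurry u) (t, x)), sq_nonneg (pd (ex 2) (uncurry u) (t, x))]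

lemma abs_morJ_le (hρ : 0 < ρ) (y : E3) (j : Fin 3) (t : ℝ) (x : E3) :
    |morJ ρ y u j t x| ≤ 10 * (edens u t x + u t x ^ 2 / ρ ^ 2) := by
  have hw := mw_sq_mul hρ y x
  rw [norm_sub_sq_eq] at hw
  have hk := morK_le (u := u) hρ y t x
  have h := morawetz_multiplier_sq_le (q₀ := pd (ex 0) (uncurry u) (t, x))
    (q₁ := pd (ex 1) (uncurry u) (t, x)) (q₂ := pd (ex 2) (uncurry u) (t, x)) hw hk
  rw [edens, Fin.sum_univ_three]
  have hj : ∀ f : Fin 3 → ℝ, f j ^ 2 ≤ f 0 ^ 2 + f 1 ^ 2 + f 2 ^ 2 := by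
    intro f
    rw [← Fin.sum_univ_three fun i => f i ^ 2]
    exact Finset.single_le_sum (f := fun i => f i ^ 2) (fun i _ => sq_nonneg _)
      (Finset.mem_univ j)
  exact abs_morawetz_current_le (mw_pos hρ y x) hw hk (hj fun i => x i - y i)
    (hj fun i => pd (ex i) (uncurry u) (t, x)) rfl h

end currents

section morawetz
variable {u : ℝ → E3 → ℝ} {ρ : ℝ}

lemma continuous_setIntegral_closedBall {f : ℝ → E3 → ℝ} (hf : Continuous (uncurry f)) (z : E3)
    (R : ℝ) : Continuous fun t => ∫ x in Metric.closedBall z R, f t x :=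
  continuous_parametric_integral_of_continuous hf (isCompact_closedBall z R)

lemma continuous_uncurry_morM (hs : ContDiff ℝ (⊤ : ℕ∞) (uncurry u)) (hρ : 0 < ρ) (y : E3) :
    Continuous fun p : ℝ × E3 => morM ρ y u p.1 p.2 := by
  have hw : Continuous fun p : ℝ × E3 => mw ρ y p.2 := (continuous_mw hρ y).comp continuous_snd
  have hU : Continuous fun p : ℝ × E3 => u p.1 p.2 := hs.continuous
  have c1 := fun i => (contDiff_pd hs (ex i)).continuous
  simp only [morM, Prod.mk.eta]
  fun_prop

lemma continuous_morN (hs : ContDiff ℝ (⊤ : ℕ∞) (uncurry u)) (hρ : 0 < ρ) (y : E3) :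
    Continuous (uncurry (morN ρ y u)) := by
  have hM := continuous_uncurry_morM hs hρ y
  have c0 := (contDiff_pd hs et).continuous
  simp only [uncurry_def, morN, Prod.mk.eta]
  fun_prop

lemma continuous_morN' (hs : ContDiff ℝ (⊤ : ℕ∞) (uncurry u)) (hρ : 0 < ρ) (y : E3) :
    Continuous (uncurry (morN' ρ y u)) := by
  have hM := continuous_uncurry_morM hs hρ y
  have hw : Continuous fun p : ℝ × E3 => mw ρ y p.2 := (continuous_mw hρ y).comp continuous_snd
  have c0 := (contDiff_pd hs et).continuous
  have c00 := (contDiff_pd (contDiff_pd hs et) et).continuous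
  have c10 := fun i => (contDiff_pd (contDiff_pd hs (ex i)) et).continuous
  simp only [uncurry_def, morN', Prod.mk.eta]
  fun_prop

lemma continuous_morJ (hs : ContDiff ℝ (⊤ : ℕ∞) (uncurry u)) (hρ : 0 < ρ) (y : E3) (j : Fin 3) :
    Continuous (uncurry (morJ ρ y u j)) := by
  have hM := continuous_uncurry_morM hs hρ y
  have hw : Continuous fun p : ℝ × E3 => mw ρ y p.2 := (continuous_mw hρ y).comp continuous_snd
  have hU : Continuous fun p : ℝ × E3 => u p.1 p.2 := hs.continuous
  have c0 := (contDiff_pd hs et).continuous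
  have c1 := fun i => (contDiff_pd hs (ex i)).continuous
  simp only [uncurry_def, morJ, Prod.mk.eta]
  fun_prop

lemma continuous_morJ' (hs : ContDiff ℝ (⊤ : ℕ∞) (uncurry u)) (hρ : 0 < ρ) (y : E3) (j : Fin 3) :
    Continuous (uncurry (morJ' ρ y u j)) := by
  have hM := continuous_uncurry_morM hs hρ y
  have hw : Continuous fun p : ℝ × E3 => mw ρ y p.2 := (continuous_mw hρ y).comp continuous_snd
  have hU : Continuous fun p : ℝ × E3 => u p.1 p.2 := hs.continuous
  have c0 := (contDiff_pd hs et).continuous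
  have c1 := fun i => (contDiff_pd hs (ex i)).continuous
  have c01 := fun i => (contDiff_pd (contDiff_pd hs et) (ex i)).continuous
  have c11 := fun i j => (contDiff_pd (contDiff_pd hs (ex i)) (ex j)).continuous
  simp only [uncurry_def, morJ', Prod.mk.eta]
  fun_prop

/-- A `C¹` cutoff function adapted to the ball of radius `R` about `y`. -/
def cut (R : ℝ) (y x : E3) : ℝ := max 0 (1 - ‖x - y‖ ^ 2 / R ^ 2)

lemma continuous_cut (R : ℝ) (y : E3) : Continuous (cut R y) := by
  unfold cut
  fun_prop

lemma cut_nonneg (R : ℝ) (y x : E3) : 0 ≤ cut R y x := le_max_left _ _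

lemma cut_le_one (R : ℝ) (y x : E3) : cut R y x ≤ 1 := by
  refine max_le zero_le_one ?_
  have : 0 ≤ ‖x - y‖ ^ 2 / R ^ 2 := by positivity
  linarith

lemma cut_eq_zero {R : ℝ} (hR : 0 < R) {y x : E3} (h : R ≤ ‖x - y‖) : cut R y x = 0 := by
  refine max_eq_left ?_
  have : 1 ≤ ‖x - y‖ ^ 2 / R ^ 2 := by
    rw [one_le_div (by positivity)]
    gcongr
  linarith

lemma hasDerivAt_cut_sq (R : ℝ) (y x : E3) (j : Fin 3) :
    HasDerivAt (fun s : ℝ => cut R y (x + s • bv j) ^ 2)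
      (2 * cut R y x * (-(2 * (x j - y j) / R ^ 2))) 0 := by
  have h1 := ((hasDerivAt_norm_sub_sq x y j).div_const (R ^ 2)).const_sub 1
  have h2 := (hasDerivAt_max_zero_sq _).comp (0 : ℝ) h1
  simp only [zero_smul, add_zero] at h2
  exact h2

lemma abs_coord_sub_le (x y : E3) (j : Fin 3) : |x j - y j| ≤ ‖x - y‖ := by
  simpa using PiLp.norm_apply_le (x - y) j

lemma integral_edens_add_le (hu : IsNLW u) {E A : ℝ} (hA : 0 < A) (hE : ∀ t, energy u t ≤ E)
    (hAP : APriori u A) (hρ : 0 < ρ) (hρE : A ^ 2 ≤ E * ρ ^ 2) (t : ℝ) (y : E3) (R : ℝ) :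
    ∫ x in Metric.closedBall y R, (edens u t x + u t x ^ 2 / ρ ^ 2) ≤ 2 * E := by
  have h1 := hu.integrable_edens t
  have h2 := (hu.2.1 t (mem_univ _)).1.integrable_sq
  have h3 : ∫ x, u t x ^ 2 ≤ A ^ 2 := by
    have h := hAP.lintegral_sq_le hA.le t
    rw [← ofReal_integral_eq_lintegral_ofReal h2 (Filter.Eventually.of_forall fun x => sq_nonneg _)]
      at h
    exact (ENNReal.ofReal_le_ofReal_iff (by positivity)).1 h
  calc _ ≤ ∫ x, (edens u t x + u t x ^ 2 / ρ ^ 2) := by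
        refine setIntegral_le_integral (h1.add (h2.div_const _))
          (Filter.Eventually.of_forall fun x => ?_)
        have := edens_nonneg (u := u) t x
        simp only [Pi.zero_apply]
        positivity
    _ = (∫ x, edens u t x) + (∫ x, u t x ^ 2) / ρ ^ 2 := by
        rw [integral_add h1 (h2.div_const _), integral_div]
    _ ≤ E + A ^ 2 / ρ ^ 2 := by
        rw [← energy_eq hu.contDiff]
        gcongr
        exact hE t
    _ ≤ _ := by
        have : A ^ 2 / ρ ^ 2 ≤ E := (div_le_iff₀ (by positivity)).2 hρE
        linarith

lemma IsNLW.morawetz_ball (hu : IsNLW u) {E A : ℝ} (hA : 0 < A) (hE : ∀ t, energy u t ≤ E)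
    (hAP : APriori u A) (hρ : 0 < ρ) (hρE : A ^ 2 ≤ E * ρ ^ 2) {t₁ t₂ : ℝ} (h12 : t₁ ≤ t₂)
    (y : E3) {R : ℝ} (hR : 0 < R) :
    ∫ t in t₁..t₂, ∫ x in Metric.closedBall y R, 2 / 3 * (mw ρ y x * u t x ^ 6) * cut R y x ^ 2 ≤
      12 * E + 240 * E / R * (t₂ - t₁) := by
  have hs := hu.contDiff
  have hcc : Continuous fun p : ℝ × E3 => cut R y p.2 := (continuous_cut R y).comp continuous_snd
  have hwc : Continuous fun p : ℝ × E3 => mw ρ y p.2 := (continuous_mw hρ y).comp continuous_snd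
  have hUc : Continuous fun p : ℝ × E3 => u p.1 p.2 := hs.continuous
  set k : ℝ → E3 → ℝ := fun t x => edens u t x + u t x ^ 2 / ρ ^ 2 with hk
  have hkc : Continuous (uncurry k) := by
    have := continuous_edens hs
    simp only [uncurry_def] at this
    simp only [hk, uncurry_def]
    fun_prop
  have hk0 : ∀ t x, 0 ≤ k t x := fun t x => by
    have := edens_nonneg (u := u) t x
    simp only [hk]
    positivity
  have hkE : ∀ t, ∫ x in Metric.closedBall y R, k t x ≤ 2 * E := fun t =>
    integral_edens_add_le hu hA hE hAP hρ hρE t y R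
  set g : ℝ → E3 → ℝ := fun t x => morN ρ y u t x * cut R y x ^ 2 with hg
  set g' : ℝ → E3 → ℝ := fun t x => morN' ρ y u t x * cut R y x ^ 2 with hg'
  set V : Fin 3 → ℝ → E3 → ℝ := fun j t x => -(morJ ρ y u j t x * cut R y x ^ 2) with hV
  set V' : Fin 3 → ℝ → E3 → ℝ := fun j t x => -(morJ' ρ y u j t x * cut R y x ^ 2 +
    morJ ρ y u j t x * (2 * cut R y x * (-(2 * (x j - y j) / R ^ 2)))) with hV'
  have hgc : Continuous (uncurry g) := (continuous_morN hs hρ y).mul (hcc.pow 2)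
  have hgc' : Continuous (uncurry g') := (continuous_morN' hs hρ y).mul (hcc.pow 2)
  have hVc' : ∀ j, Continuous (uncurry (V' j)) := fun j =>
    (((continuous_morJ' hs hρ y j).mul (hcc.pow 2)).add ((continuous_morJ hs hρ y j).mul
        ((continuous_const.mul hcc).mul (by fun_prop)))).neg
  have hflux := integral_ball_sub_eq (g := g) (g' := g') (V := V) (V' := V') (R := R) (t₁ := t₁)
    (t₂ := t₂) hgc hgc' (fun j => ((continuous_morJ hs hρ y j).mul (hcc.pow 2)).neg) hVc'
    (fun t x => (hasDerivAt_morN hs y t x).mul_const _)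
    (fun j t x => by
      have h := ((hasDerivAt_morJ hs hρ y j t x).mul (hasDerivAt_cut_sq R y x j)).neg
      simp only [zero_smul, add_zero] at h
      exact h)
    y h12
    (fun j t _ x hx => by simp [hV, cut_eq_zero hR hx])
  set f : ℝ → E3 → ℝ := fun t x => 2 / 3 * (mw ρ y x * u t x ^ 6) * cut R y x ^ 2 with hf
  have hfc : Continuous (uncurry f) := by
    simp only [hf, uncurry_def]
    fun_prop
  have hD : ∀ t, ∀ x ∈ Metric.closedBall y R,
      g' t x + ∑ j, V' j t x ≤ 120 / R * k t x - f t x := by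
    intro t x hx
    have hxR : ‖x - y‖ ≤ R := by rw [← dist_eq_norm]; exact hx
    have h1 := morN'_sub_sum_morJ' hu hρ y t x
    have h2 : ∀ j, -(morJ ρ y u j t x * (2 * cut R y x * (-(2 * (x j - y j) / R ^ 2)))) ≤
        40 / R * k t x := by
      intro j
      have h3 := (abs_coord_sub_le x y j).trans hxR
      refine (neg_le_abs _).trans ?_
      have h4 : |2 * cut R y x * (-(2 * (x j - y j) / R ^ 2))| ≤ 4 / R := by
        rw [abs_mul, abs_neg, abs_div, abs_mul, abs_mul, abs_of_nonneg (cut_nonneg R y x),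
          abs_of_nonneg (by positivity : 0 ≤ R ^ 2), abs_two]
        calc _ ≤ 2 * 1 * (2 * R / R ^ 2) := by
              gcongr
              exact cut_le_one R y x
          _ = _ := by field_simp; norm_num
      rw [abs_mul]
      calc _ ≤ (10 * k t x) * (4 / R) := by
            gcongr
            · exact mul_nonneg (by norm_num) (hk0 t x)
            · exact abs_morJ_le hρ y j t x
        _ = _ := by ring
    have h5 : g' t x + ∑ j, V' j t x = (morN' ρ y u t x - ∑ j, morJ' ρ y u j t x) * cut R y x ^ 2 +
        ∑ j, -(morJ ρ y u j t x * (2 * cut R y x * (-(2 * (x j - y j) / R ^ 2)))) := by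
      simp only [hg', hV', Fin.sum_univ_three]
      ring
    rw [h5]
    have h6 : ∑ j, -(morJ ρ y u j t x * (2 * cut R y x * (-(2 * (x j - y j) / R ^ 2)))) ≤
        ∑ _j : Fin 3, 40 / R * k t x := Finset.sum_le_sum fun j _ => h2 j
    have h7 : (morN' ρ y u t x - ∑ j, morJ' ρ y u j t x) * cut R y x ^ 2 ≤
        -(2 / 3 * (mw ρ y x * u t x ^ 6)) * cut R y x ^ 2 := by gcongr
    rw [Fin.sum_const] at h6
    simp only [hf]
    calc _ ≤ _ := add_le_add h7 h6
      _ = _ := by simp; ring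
  have slice : ∀ {f : ℝ → E3 → ℝ}, Continuous (uncurry f) → ∀ t,
      IntegrableOn (f t) (Metric.closedBall y R) := fun hf t =>
    (hf.comp (by fun_prop : Continuous fun x : E3 => (t, x))).continuousOn.integrableOn_compact
      (isCompact_closedBall y R)
  have hDint : ∀ t, ∫ x in Metric.closedBall y R, (g' t x + ∑ j, V' j t x) ≤
      240 * E / R - ∫ x in Metric.closedBall y R, f t x := by
    intro t
    calc _ ≤ ∫ x in Metric.closedBall y R, (120 / R * k t x - f t x) :=
          setIntegral_mono_on ((slice hgc' t).add (integrable_finsetSum _ fun j _ =>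
            slice (hVc' j) t)) (((slice hkc t).const_mul _).sub (slice hfc t))
            measurableSet_closedBall (hD t)
      _ = 120 / R * (∫ x in Metric.closedBall y R, k t x) - ∫ x in Metric.closedBall y R, f t x := by
          rw [integral_sub ((slice hkc t).const_mul _) (slice hfc t), integral_const_mul]
      _ ≤ 120 / R * (2 * E) - ∫ x in Metric.closedBall y R, f t x := by
          gcongr
          exact hkE t
      _ = _ := by ring
  have hgb : ∀ t, |∫ x in Metric.closedBall y R, g t x| ≤ 6 * E := by
    intro t
    calc _ ≤ ∫ x in Metric.closedBall y R, |g t x| := abs_integral_le_integral_abs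
      _ ≤ ∫ x in Metric.closedBall y R, 3 * k t x := by
          refine setIntegral_mono_on (slice hgc t).abs ((slice hkc t).const_mul _)
            measurableSet_closedBall fun x _ => ?_
          simp only [hg]
          rw [abs_mul, abs_of_nonneg (sq_nonneg (cut R y x))]
          calc _ ≤ (3 * k t x) * 1 ^ 2 := by
                gcongr
                · exact mul_nonneg (by norm_num) (hk0 t x)
                · exact abs_morN_le hρ y t x
                · exact cut_nonneg R y x
                · exact cut_le_one R y x
            _ = _ := by ring
      _ ≤ _ := by
          rw [integral_const_mul]
          linarith [hkE t]
  have hfic := continuous_setIntegral_closedBall hfc y R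
  have hmono : ∫ t in t₁..t₂, ∫ x in Metric.closedBall y R, (g' t x + ∑ j, V' j t x) ≤
      ∫ t in t₁..t₂, (240 * E / R - ∫ x in Metric.closedBall y R, f t x) := by
    refine intervalIntegral.integral_mono_on h12 ?_ ?_ fun t _ => hDint t
    · refine (continuous_setIntegral_closedBall (f := fun t x => g' t x + ∑ j, V' j t x) ?_
        y R).intervalIntegrable _ _
      exact hgc'.add (continuous_finsetSum _ fun j _ => hVc' j)
    · exact (continuous_const.sub hfic).intervalIntegrable _ _
  rw [intervalIntegral.integral_sub (by simp) (hfic.intervalIntegrable _ _),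
    intervalIntegral.integral_const, smul_eq_mul] at hmono
  have h1 := (abs_le.1 (hgb t₂)).1
  have h2 := (abs_le.1 (hgb t₁)).2
  linarith

end morawetz

section morawetz_global
variable {u : ℝ → E3 → ℝ} {ρ : ℝ}

lemma ofReal_integral_closedBall_eq {f : ℝ → E3 → ℝ} (hf : Continuous (uncurry f))
    (h0 : ∀ t x, 0 ≤ f t x) {t₁ t₂ : ℝ} (h12 : t₁ ≤ t₂) (y : E3) (R : ℝ) :
    ENNReal.ofReal (∫ t in t₁..t₂, ∫ x in Metric.closedBall y R, f t x) =
      ∫⁻ t in Icc t₁ t₂, ∫⁻ x in Metric.closedBall y R, ENNReal.ofReal (f t x) := by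
  have hc := continuous_setIntegral_closedBall hf y R
  rw [intervalIntegral.integral_of_le h12, ← integral_Icc_eq_integral_Ioc,
    ofReal_integral_eq_lintegral_ofReal
      (hc.continuousOn.integrableOn_compact isCompact_Icc)
      (Filter.Eventually.of_forall fun t => integral_nonneg fun x => h0 t x)]
  refine lintegral_congr fun t => ?_
  refine ofReal_integral_eq_lintegral_ofReal ?_ (Filter.Eventually.of_forall fun x => h0 t x)
  exact (hf.comp (by fun_prop : Continuous fun x : E3 => (t, x))).continuousOn.integrableOn_compact
    (isCompact_closedBall y R)

lemma tendsto_cut (y x : E3) :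
    Filter.Tendsto (fun n : ℕ => cut ((n : ℝ) + 1) y x) Filter.atTop (nhds 1) := by
  unfold cut
  have h1 : Filter.Tendsto (fun n : ℕ => ((n : ℝ) + 1) ^ 2) Filter.atTop Filter.atTop :=
    (Filter.tendsto_pow_atTop (by norm_num)).comp
      (Filter.tendsto_atTop_add_const_right _ _ tendsto_natCast_atTop_atTop)
  have h2 := (h1.const_div_atTop (‖x - y‖ ^ 2)).const_sub 1
  simpa using (tendsto_const_nhds (x := (0 : ℝ))).max h2

/-- Fatou's lemma for iterated integrals over spacetime. -/
lemma lintegral_lintegral_le_of_tendsto {F : ℕ → ℝ → E3 → ℝ≥0∞} {G : ℝ → E3 → ℝ≥0∞} {s : Set ℝ}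
    (hF : ∀ n, Measurable fun p : ℝ × E3 => F n p.1 p.2)
    (hpt : ∀ t x, Filter.Tendsto (fun n => F n t x) Filter.atTop (nhds (G t x)))
    {B : ℕ → ℝ≥0∞} {b : ℝ≥0∞} (hB : ∀ n, ∫⁻ t in s, ∫⁻ x, F n t x ≤ B n)
    (hb : Filter.Tendsto B Filter.atTop (nhds b)) : ∫⁻ t in s, ∫⁻ x, G t x ≤ b := by
  have h1 : ∀ n, Measurable fun t => ∫⁻ x, F n t x := fun n => (hF n).lintegral_prod_right'
  have h2 : ∀ t n, Measurable fun x => F n t x :=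
    fun t n => (hF n).comp (by fun_prop : Measurable fun x : E3 => (t, x))
  calc _ = ∫⁻ t in s, ∫⁻ x, Filter.liminf (fun n => F n t x) Filter.atTop := by
        simp only [fun t x => (hpt t x).liminf_eq]
    _ ≤ ∫⁻ t in s, Filter.liminf (fun n => ∫⁻ x, F n t x) Filter.atTop :=
        lintegral_mono fun t => lintegral_liminf_le (h2 t)
    _ ≤ Filter.liminf (fun n => ∫⁻ t in s, ∫⁻ x, F n t x) Filter.atTop := lintegral_liminf_le h1
    _ ≤ Filter.liminf B Filter.atTop := Filter.liminf_le_liminf (Filter.Eventually.of_forall hB)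
    _ = _ := hb.liminf_eq

/-- Global Morawetz estimate with a regularised centre. -/
lemma IsNLW.morawetz (hu : IsNLW u) {E A : ℝ} (hA : 0 < A)
    (hE : ∀ t, energy u t ≤ E)
    (hAP : APriori u A) (hρ : 0 < ρ) (hρE : A ^ 2 ≤ E * ρ ^ 2) {t₁ t₂ : ℝ} (h12 : t₁ ≤ t₂)
    (y : E3) :
    ∫⁻ t in Icc t₁ t₂, ∫⁻ x, ENNReal.ofReal (mw ρ y x * u t x ^ 6) ≤ ENNReal.ofReal (18 * E) := by
  have hs := hu.contDiff
  have hwc : Continuous fun p : ℝ × E3 => mw ρ y p.2 := (continuous_mw hρ y).comp continuous_snd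
  have hUc : Continuous fun p : ℝ × E3 => u p.1 p.2 := hs.continuous
  set F : ℕ → ℝ → E3 → ℝ := fun n t x =>
    mw ρ y x * u t x ^ 6 * cut ((n : ℝ) + 1) y x ^ 2 with hF
  have hFc : ∀ n, Continuous (uncurry (F n)) := fun n => by
    have hcc : Continuous fun p : ℝ × E3 => cut ((n : ℝ) + 1) y p.2 :=
      (continuous_cut _ y).comp continuous_snd
    simp only [hF, uncurry_def]
    fun_prop
  have hF0 : ∀ n t x, 0 ≤ F n t x := fun n t x => by
    have := mw_pos hρ y x
    simp only [hF]
    positivity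
  have hFm : ∀ n, Measurable fun p : ℝ × E3 => ENNReal.ofReal (F n p.1 p.2) := fun n =>
    (hFc n).measurable.ennreal_ofReal
  have hbound : ∀ n : ℕ, ∫⁻ t in Icc t₁ t₂, ∫⁻ x, ENNReal.ofReal (F n t x) ≤
      ENNReal.ofReal (18 * E + 360 * E / ((n : ℝ) + 1) * (t₂ - t₁)) := by
    intro n
    have hn : (0 : ℝ) < (n : ℝ) + 1 := by positivity
    have h1 : ∀ t, ∫⁻ x, ENNReal.ofReal (F n t x) =
        ∫⁻ x in Metric.closedBall y ((n : ℝ) + 1), ENNReal.ofReal (F n t x) := by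
      intro t
      rw [setLIntegral_eq_of_support_subset]
      intro x hx
      by_contra hcon
      have h2 : (n : ℝ) + 1 ≤ ‖x - y‖ := by
        have : ¬ dist x y ≤ (n : ℝ) + 1 := hcon
        rw [← dist_eq_norm]
        linarith
      exact hx (by simp [hF, cut_eq_zero hn h2])
    simp only [h1]
    rw [← ofReal_integral_closedBall_eq (hFc n) (hF0 n) h12]
    refine ENNReal.ofReal_le_ofReal ?_
    have h3 := hu.morawetz_ball hA hE hAP hρ hρE h12 y hn
    simp only [mul_assoc, integral_const_mul, intervalIntegral.integral_const_mul] at h3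
    simp only [hF, mul_assoc]
    have h4 : 360 * (E / ((n : ℝ) + 1) * (t₂ - t₁)) =
      3 / 2 * (240 * E / ((n : ℝ) + 1) * (t₂ - t₁)) := by ring
    have h5 : 360 * E / ((n : ℝ) + 1) * (t₂ - t₁) = 360 * (E / ((n : ℝ) + 1) * (t₂ - t₁)) := by ring
    linarith
  have hlim : Filter.Tendsto (fun n : ℕ => ENNReal.ofReal
      (18 * E + 360 * E / ((n : ℝ) + 1) * (t₂ - t₁))) Filter.atTop
      (nhds (ENNReal.ofReal (18 * E))) := by
    refine ENNReal.tendsto_ofReal ?_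
    have h1 : Filter.Tendsto (fun n : ℕ => (n : ℝ) + 1) Filter.atTop Filter.atTop :=
      Filter.tendsto_atTop_add_const_right _ _ tendsto_natCast_atTop_atTop
    simpa using ((h1.const_div_atTop (360 * E)).mul_const (t₂ - t₁)).const_add (18 * E)
  have hpt : ∀ t x, Filter.Tendsto (fun n => ENNReal.ofReal (F n t x)) Filter.atTop
      (nhds (ENNReal.ofReal (mw ρ y x * u t x ^ 6))) := by
    intro t x
    refine ENNReal.tendsto_ofReal ?_
    simpa using ((tendsto_cut y x).pow 2).const_mul (mw ρ y x * u t x ^ 6)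
  exact lintegral_lintegral_le_of_tendsto (s := Icc t₁ t₂) hFm hpt hbound hlim

end morawetz_global

section interaction
variable {u : ℝ → E3 → ℝ} {ρ : ℝ}

/-- The energy in the ball of radius `3ρ` about `x`. -/
def locE (u : ℝ → E3 → ℝ) (ρ t : ℝ) (x : E3) : ℝ≥0∞ :=
  ∫⁻ z in Metric.closedBall x (3 * ρ), ENNReal.ofReal (edens u t z)

lemma locE_le (hu : IsNLW u) (hρ : 0 < ρ) {a t : ℝ} (hat : a ≤ t) (x : E3) :
    locE u ρ t x ≤ 84 * ∫⁻ z in Metric.closedBall x (2 * (t - a) + 4 * ρ),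
      ENNReal.ofReal (edens u a z) := by
  have conv : ∀ s R, ∫⁻ z in Metric.closedBall x R, ENNReal.ofReal (edens u s z) =
      ENNReal.ofReal (∫ z in Metric.closedBall x R, edens u s z) := fun s R =>
    (ofReal_integral_eq_lintegral_ofReal (hu.integrable_edens s).integrableOn
      (Filter.Eventually.of_forall fun z => edens_nonneg s z)).symm
  rw [locE, conv, conv, show (84 : ℝ≥0∞) = ENNReal.ofReal 84 by norm_num,
    ← ENNReal.ofReal_mul (by norm_num)]
  exact ENNReal.ofReal_le_ofReal (hu.setIntegral_edens_le hat hρ x)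

lemma inv_le_mw (hρ : 0 < ρ) {τ : ℝ} (hτ : 0 ≤ τ) {x y : E3} (h : ‖x - y‖ ≤ 2 * τ + 4 * ρ) :
    1 / (τ + ρ) ≤ 5 * mw ρ y x := by
  have h1 : √(ρ ^ 2 + ‖x - y‖ ^ 2) ≤ 5 * (τ + ρ) := by
    rw [Real.sqrt_le_left (by positivity)]
    have := norm_nonneg (x - y)
    nlinarith [mul_nonneg hτ hρ.le, sq_nonneg τ]
  have h2 : 0 < √(ρ ^ 2 + ‖x - y‖ ^ 2) := by positivity
  unfold mw
  rw [← div_eq_mul_inv, div_le_div_iff₀ (by positivity) h2]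
  linarith

lemma locE_weight_le (hu : IsNLW u) (hρ : 0 < ρ) {a t : ℝ} (hat : a ≤ t) (x : E3) :
    ENNReal.ofReal (1 / (t - a + ρ)) * locE u ρ t x ≤
      420 * ∫⁻ y, ENNReal.ofReal (mw ρ y x) * ENNReal.ofReal (edens u a y) := by
  have hec : Continuous fun y => edens u a y :=
    (continuous_edens hu.contDiff).comp (by fun_prop : Continuous fun x : E3 => (a, x))
  have hm := hec.measurable.ennreal_ofReal
  calc _ ≤ ENNReal.ofReal (1 / (t - a + ρ)) *
        (84 * ∫⁻ z in Metric.closedBall x (2 * (t - a) + 4 * ρ), ENNReal.ofReal (edens u a z)) := by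
        gcongr
        exact locE_le hu hρ hat x
    _ = 84 * ∫⁻ z in Metric.closedBall x (2 * (t - a) + 4 * ρ),
        ENNReal.ofReal (1 / (t - a + ρ)) * ENNReal.ofReal (edens u a z) := by
        rw [lintegral_const_mul _ hm]
        ring
    _ ≤ 84 * ∫⁻ z in Metric.closedBall x (2 * (t - a) + 4 * ρ),
        5 * (ENNReal.ofReal (mw ρ z x) * ENNReal.ofReal (edens u a z)) := by
        refine mul_le_mul' le_rfl (setLIntegral_mono' measurableSet_closedBall fun z hz => ?_)
        rw [← mul_assoc]
        refine mul_le_mul' ?_ le_rfl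
        rw [show (5 : ℝ≥0∞) = ENNReal.ofReal 5 by norm_num, ← ENNReal.ofReal_mul (by norm_num)]
        refine ENNReal.ofReal_le_ofReal (inv_le_mw hρ (by linarith) ?_)
        rw [← dist_eq_norm, dist_comm]
        exact hz
    _ ≤ 84 * ∫⁻ z, 5 * (ENNReal.ofReal (mw ρ z x) * ENNReal.ofReal (edens u a z)) :=
        mul_le_mul' le_rfl (setLIntegral_le_lintegral _ _)
    _ = _ := by
        rw [lintegral_const_mul' _ _ (by norm_num), ← mul_assoc]
        norm_num

lemma lintegral_rotate {G : ℝ → E3 → E3 → ℝ≥0∞} {s : Set ℝ}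
    (hG : Measurable fun p : (ℝ × E3) × E3 => G p.1.1 p.1.2 p.2) :
    ∫⁻ t in s, ∫⁻ x, ∫⁻ y, G t x y = ∫⁻ y, ∫⁻ t in s, ∫⁻ x, G t x y := by
  have h1 : ∀ t, ∫⁻ x, ∫⁻ y, G t x y = ∫⁻ y, ∫⁻ x, G t x y := fun t =>
    lintegral_lintegral_swap (Measurable.aemeasurable
      (hG.comp (by fun_prop : Measurable fun p : E3 × E3 => ((t, p.1), p.2))))
  have h2 : Measurable fun q : (ℝ × E3) × E3 => G q.1.1 q.2 q.1.2 :=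
    hG.comp (by fun_prop : Measurable fun q : (ℝ × E3) × E3 => ((q.1.1, q.2), q.1.2))
  have h3 : Measurable fun q : ℝ × E3 => ∫⁻ x, G q.1 x q.2 := h2.lintegral_prod_right'
  simp only [h1]
  exact lintegral_lintegral_swap h3.aemeasurable

/-- The interaction functional between the potential energy and the local energy. -/
def inter (u : ℝ → E3 → ℝ) (ρ t : ℝ) : ℝ≥0∞ :=
  ∫⁻ x, ENNReal.ofReal (u t x ^ 6) * locE u ρ t x

lemma continuous_mw_uncurry (hρ : 0 < ρ) : Continuous fun p : E3 × E3 => mw ρ p.1 p.2 := by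
  unfold mw
  refine Continuous.inv₀ (by fun_prop) fun x => ?_
  positivity

lemma IsNLW.inter_le (hu : IsNLW u) {E A : ℝ} (hA : 0 < A)
    (hE : ∀ t, energy u t ≤ E) (hAP : APriori u A) (hρ : 0 < ρ) (hρE : A ^ 2 ≤ E * ρ ^ 2)
    {a b : ℝ} (hab : a ≤ b) :
    ∫⁻ t in Icc a b, ENNReal.ofReal (1 / (t - a + ρ)) * inter u ρ t ≤
      420 * (ENNReal.ofReal (18 * E) * ENNReal.ofReal E) := by
  have hs := hu.contDiff
  have hUc : Continuous fun p : ℝ × E3 => u p.1 p.2 := hs.continuous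
  have hUx : ∀ t, Continuous (u t) := fun t =>
    hUc.comp (by fun_prop : Continuous fun x : E3 => (t, x))
  have hec : Continuous fun y => edens u a y :=
    (continuous_edens hs).comp (by fun_prop : Continuous fun x : E3 => (a, x))
  have hmw := continuous_mw_uncurry hρ
  set G : E3 → ℝ → E3 → ℝ≥0∞ := fun y t x =>
    ENNReal.ofReal (edens u a y) * ENNReal.ofReal (mw ρ y x * u t x ^ 6) with hG
  have hGm : Measurable fun p : (ℝ × E3) × E3 => G p.2 p.1.1 p.1.2 := by
    refine Measurable.mul (hec.measurable.ennreal_ofReal.comp measurable_snd) ?_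
    refine (Continuous.measurable ?_).ennreal_ofReal
    exact (hmw.comp (by fun_prop : Continuous fun p : (ℝ × E3) × E3 => (p.2, p.1.2))).mul
      ((hUc.comp continuous_fst).pow 6)
  have hpt : ∀ t ∈ Icc a b, ENNReal.ofReal (1 / (t - a + ρ)) * inter u ρ t ≤
      420 * ∫⁻ x, ∫⁻ y, G y t x := by
    intro t ht
    rw [inter, ← lintegral_const_mul' _ _ ENNReal.ofReal_ne_top,
      ← lintegral_const_mul' _ _ (by norm_num)]
    refine lintegral_mono fun x => ?_
    calc _ = ENNReal.ofReal (u t x ^ 6) * (ENNReal.ofReal (1 / (t - a + ρ)) * locE u ρ t x) := by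
          ring
      _ ≤ ENNReal.ofReal (u t x ^ 6) *
          (420 * ∫⁻ y, ENNReal.ofReal (mw ρ y x) * ENNReal.ofReal (edens u a y)) := by
          exact mul_le_mul' le_rfl (locE_weight_le hu hρ ht.1 x)
      _ = 420 * (ENNReal.ofReal (u t x ^ 6) *
          ∫⁻ y, ENNReal.ofReal (mw ρ y x) * ENNReal.ofReal (edens u a y)) := by ring
      _ = _ := by
          rw [← lintegral_const_mul' _ _ ENNReal.ofReal_ne_top]
          congr 1
          refine lintegral_congr fun y => ?_
          simp only [hG]
          rw [ENNReal.ofReal_mul (mw_pos hρ y x).le]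
          ring
  calc _ ≤ ∫⁻ t in Icc a b, 420 * ∫⁻ x, ∫⁻ y, G y t x :=
        setLIntegral_mono' measurableSet_Icc hpt
    _ = 420 * ∫⁻ t in Icc a b, ∫⁻ x, ∫⁻ y, G y t x := lintegral_const_mul' _ _ (by norm_num)
    _ = 420 * ∫⁻ y, ∫⁻ t in Icc a b, ∫⁻ x, G y t x := by
        rw [lintegral_rotate (G := fun t x y => G y t x) hGm]
    _ ≤ 420 * ∫⁻ y, ENNReal.ofReal (18 * E) * ENNReal.ofReal (edens u a y) := by
        refine mul_le_mul' le_rfl (lintegral_mono fun y => ?_)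
        simp only [hG, lintegral_const_mul' _ _ ENNReal.ofReal_ne_top]
        rw [mul_comm]
        exact mul_le_mul' (hu.morawetz hA hE hAP hρ hρE hab y) le_rfl
    _ ≤ _ := by
        rw [lintegral_const_mul' _ _ ENNReal.ofReal_ne_top]
        gcongr
        exact hu.lintegral_edens_le hE a

end interaction

section local_sobolev
variable {u : ℝ → E3 → ℝ} {ρ : ℝ}

/-- The constant in the sixth power of the Sobolev inequality `Ḣ¹ ⊆ L⁶` on `ℝ³`. -/
def sobK : ℝ≥0 := eLpNormLESNormFDerivOfEqInnerConst (volume : Measure E3) (2 : ℝ≥0) ^ 6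

lemma lintegral_pow_six_le {f : E3 → ℝ} (hf : ContDiff ℝ 1 f) (hc : HasCompactSupport f) :
    ∫⁻ x, ‖f x‖ₑ ^ 6 ≤ sobK * (∫⁻ x, ‖fderiv ℝ f x‖ₑ ^ 2) ^ 3 := by
  have h := eLpNorm_le_eLpNorm_fderiv_of_eq_inner (μ := (volume : Measure E3)) hf hc
    (p := 2) (p' := 6) (by norm_num) (by simp) (by norm_num [finrank_euclideanSpace])
  rw [eLpNorm_nnreal_eq_lintegral (by norm_num), eLpNorm_nnreal_eq_lintegral (by norm_num)] at h
  have h2 := pow_le_pow_left' h 6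
  rw [mul_pow, ← ENNReal.rpow_natCast, ← ENNReal.rpow_mul,
    ← ENNReal.rpow_natCast ((∫⁻ x, ‖fderiv ℝ f x‖ₑ ^ ((2 : ℝ≥0) : ℝ)) ^ _), ← ENNReal.rpow_mul]
    at h2
  norm_num at h2
  simpa [sobK] using h2

lemma norm_fderiv_sq {f : E3 → ℝ} (x : E3) (hf : DifferentiableAt ℝ f x) :
    ‖fderiv ℝ f x‖ ^ 2 = ∑ i : Fin 3, (fderiv ℝ f x (bv i)) ^ 2 := by
  rw [← norm_gradient_sq x hf]
  unfold gradient
  rw [LinearIsometryEquiv.norm_map]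

lemma contDiff_max_zero_sq : ContDiff ℝ 1 fun s : ℝ => max 0 s ^ 2 := by
  rw [contDiff_one_iff_deriv]
  refine ⟨fun s => (hasDerivAt_max_zero_sq s).differentiableAt, ?_⟩
  have : deriv (fun s : ℝ => max 0 s ^ 2) = fun s => 2 * max 0 s :=
    funext fun s => (hasDerivAt_max_zero_sq s).deriv
  rw [this]
  fun_prop

lemma contDiff_cut_sq (R : ℝ) (z : E3) : ContDiff ℝ 1 fun x => cut R z x ^ 2 := by
  have h : ContDiff ℝ 1 fun x : E3 => 1 - ‖x - z‖ ^ 2 / R ^ 2 :=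
    contDiff_const.sub (((contDiff_id.sub contDiff_const).norm_sq ℝ).div_const _)
  exact contDiff_max_zero_sq.comp h

/-- The energy and rescaled mass densities in a ball control the potential energy in a smaller
ball. -/
lemma IsNLW.lintegral_closedBall_pow_six_le (hu : IsNLW u) (hρ : 0 < ρ) (t : ℝ) (z : E3) :
    ∫⁻ x in Metric.closedBall z ρ, ‖u t x‖ₑ ^ 6 ≤
      64 * (sobK * (∫⁻ x in Metric.closedBall z (2 * ρ),
        8 * ENNReal.ofReal (edens u t x + u t x ^ 2 / ρ ^ 2)) ^ 3) := by
  have hs := hu.contDiff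
  set R := 2 * ρ with hR
  have hR0 : 0 < R := by positivity
  set f : E3 → ℝ := fun x => cut R z x ^ 2 * u t x with hf
  have hut : ContDiff ℝ 1 (u t) := (contDiff_slice hs t).of_le (by simp)
  have hfd : ContDiff ℝ 1 f := (contDiff_cut_sq R z).mul hut
  have hout : ∀ x, x ∉ Metric.closedBall z R → cut R z x = 0 := by
    intro x hx
    refine cut_eq_zero hR0 ?_
    have : ¬ dist x z ≤ R := hx
    rw [← dist_eq_norm]
    linarith
  have hfc : HasCompactSupport f := HasCompactSupport.intro (isCompact_closedBall z R) fun x hx => by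
    simp [hf, hout x hx]
  have hpart : ∀ x j, fderiv ℝ f x (bv j) = 2 * cut R z x * (-(2 * (x j - z j) / R ^ 2)) * u t x +
      cut R z x ^ 2 * pd (ex j) (uncurry u) (t, x) := by
    intro x j
    have h1 : HasDerivAt (fun s : ℝ => u t (x + s • bv j)) _ 0 := hasDerivAt_coord_line hs j t x
    have h2 := (hasDerivAt_cut_sq R z x j).mul h1
    have h3 : HasDerivAt (fun s : ℝ => f (x + s • bv j)) (fderiv ℝ f x (bv j)) 0 :=
      (hfd.differentiable (by norm_num) x).hasFDerivAt.hasLineDerivAt (bv j)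
    have h4 := h3.unique h2
    simpa using h4
  have hder : ∀ x, ‖fderiv ℝ f x‖ₑ ^ 2 ≤ (Metric.closedBall z R).indicator
      (fun x => 8 * ENNReal.ofReal (edens u t x + u t x ^ 2 / ρ ^ 2)) x := by
    intro x
    by_cases hx : x ∈ Metric.closedBall z R
    · rw [indicator_of_mem hx, ← ofReal_norm, ← ENNReal.ofReal_pow (norm_nonneg _),
        show (8 : ℝ≥0∞) = ENNReal.ofReal 8 by norm_num, ← ENNReal.ofReal_mul (by norm_num)]
      refine ENNReal.ofReal_le_ofReal ?_
      rw [norm_fderiv_sq x (hfd.differentiable (by norm_num) x), edens, Fin.sum_univ_three,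
        Fin.sum_univ_three, hpart, hpart, hpart]
      have hxR : ‖x - z‖ ≤ R := by rw [← dist_eq_norm]; exact hx
      have hn : (x 0 - z 0) ^ 2 + (x 1 - z 1) ^ 2 + (x 2 - z 2) ^ 2 ≤ R ^ 2 := by
        rw [← norm_sub_sq_eq]
        gcongr
      have hc0 := cut_nonneg R z x
      have hc1 := cut_le_one R z x
      set c := cut R z x
      have key : ∀ r q : ℝ, (2 * c * (-(2 * r / R ^ 2)) * u t x + c ^ 2 * q) ^ 2 ≤
          32 / R ^ 4 * r ^ 2 * u t x ^ 2 + 2 * q ^ 2 := by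
        intro r q
        have e1 : (2 * c * (-(2 * r / R ^ 2)) * u t x) ^ 2 ≤ 16 / R ^ 4 * r ^ 2 * u t x ^ 2 := by
          calc _ = c ^ 2 * (16 / R ^ 4 * r ^ 2 * u t x ^ 2) := by field_simp; ring
            _ ≤ 1 ^ 2 * (16 / R ^ 4 * r ^ 2 * u t x ^ 2) := by gcongr
            _ = _ := by ring
        have e2 : (c ^ 2 * q) ^ 2 ≤ q ^ 2 := by
          calc _ = c ^ 4 * q ^ 2 := by ring
            _ ≤ 1 ^ 4 * q ^ 2 := by gcongr
            _ = _ := by ring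
        have e3 : ∀ α β : ℝ, (α + β) ^ 2 ≤ 2 * α ^ 2 + 2 * β ^ 2 := fun α β => by
          linarith [sq_nonneg (α - β), add_sq α β, sub_sq α β]
        have e4 : 32 / R ^ 4 * r ^ 2 * u t x ^ 2 = 2 * (16 / R ^ 4 * r ^ 2 * u t x ^ 2) := by ring
        linarith [e3 (2 * c * (-(2 * r / R ^ 2)) * u t x) (c ^ 2 * q)]
      have hu2 : 32 / R ^ 4 * ((x 0 - z 0) ^ 2 + (x 1 - z 1) ^ 2 + (x 2 - z 2) ^ 2) * u t x ^ 2 ≤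
          8 * (u t x ^ 2 / ρ ^ 2) := by
        calc _ ≤ 32 / R ^ 4 * R ^ 2 * u t x ^ 2 := by gcongr
          _ = _ := by rw [hR]; field_simp; ring
      have hv : 0 ≤ u t x ^ 6 := by positivity
      linarith [key (x 0 - z 0) (pd (ex 0) (uncurry u) (t, x)),
        key (x 1 - z 1) (pd (ex 1) (uncurry u) (t, x)),
        key (x 2 - z 2) (pd (ex 2) (uncurry u) (t, x)),
        sq_nonneg (pd et (uncurry u) (t, x)), sq_nonneg (pd (ex 0) (uncurry u) (t, x)),
        sq_nonneg (pd (ex 1) (uncurry u) (t, x)), sq_nonneg (pd (ex 2) (uncurry u) (t, x))]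
    · have h0 : ‖fderiv ℝ f x‖ ^ 2 = 0 := by
        rw [norm_fderiv_sq x (hfd.differentiable (by norm_num) x)]
        simp [hpart, hout x hx]
      rw [indicator_of_notMem hx, ← ofReal_norm, ← ENNReal.ofReal_pow (norm_nonneg _), h0,
        ENNReal.ofReal_zero]
  calc _ ≤ ∫⁻ x in Metric.closedBall z ρ, 64 * ‖f x‖ₑ ^ 6 := by
        refine setLIntegral_mono' measurableSet_closedBall fun x hx => ?_
        have hxR : ‖x - z‖ ≤ ρ := by rw [← dist_eq_norm]; exact hx
        have hc : 3 / 4 ≤ cut R z x := by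
          refine le_trans ?_ (le_max_right _ _)
          have : ‖x - z‖ ^ 2 / R ^ 2 ≤ 1 / 4 := by
            rw [div_le_div_iff₀ (by positivity) (by norm_num), hR]
            nlinarith [norm_nonneg (x - z)]
          linarith
        rw [← ofReal_norm, ← ofReal_norm, ← ENNReal.ofReal_pow (norm_nonneg _),
          ← ENNReal.ofReal_pow (norm_nonneg _),
          show (64 : ℝ≥0∞) = ENNReal.ofReal 64 by norm_num, ← ENNReal.ofReal_mul (by norm_num)]
        refine ENNReal.ofReal_le_ofReal ?_
        simp only [hf, norm_mul, norm_pow, mul_pow, Real.norm_eq_abs,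
          abs_of_nonneg (cut_nonneg R z x)]
        have h1 : (1 : ℝ) ≤ 64 * (cut R z x ^ 2) ^ 6 := by
          calc (1 : ℝ) ≤ 64 * ((3 / 4) ^ 2) ^ 6 := by norm_num
            _ ≤ _ := by gcongr
        have h2 : 0 ≤ |u t x| ^ 6 := by positivity
        nlinarith
    _ = 64 * ∫⁻ x in Metric.closedBall z ρ, ‖f x‖ₑ ^ 6 := lintegral_const_mul' _ _ (by norm_num)
    _ ≤ 64 * ∫⁻ x, ‖f x‖ₑ ^ 6 := mul_le_mul' le_rfl (setLIntegral_le_lintegral _ _)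
    _ ≤ 64 * (sobK * (∫⁻ x, ‖fderiv ℝ f x‖ₑ ^ 2) ^ 3) :=
        mul_le_mul' le_rfl (lintegral_pow_six_le hfd hfc)
    _ ≤ _ := by
        refine mul_le_mul' le_rfl (mul_le_mul' le_rfl (pow_le_pow_left' ?_ 3))
        rw [← lintegral_indicator measurableSet_closedBall]
        exact lintegral_mono hder

end local_sobolev

section potential_bound
variable {u : ℝ → E3 → ℝ} {ρ : ℝ}

lemma measurableSet_dist_le (r : ℝ) : MeasurableSet {p : E3 × E3 | dist p.2 p.1 ≤ r} :=
  (isClosed_le (continuous_snd.dist continuous_fst) continuous_const).measurableSet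

lemma setLIntegral_closedBall_eq (h : E3 → ℝ≥0∞) (r : ℝ) (z : E3) :
    ∫⁻ x in Metric.closedBall z r, h x =
      ∫⁻ x, {p : E3 × E3 | dist p.2 p.1 ≤ r}.indicator (fun p => h p.2) (z, x) := by
  rw [← lintegral_indicator measurableSet_closedBall]
  rfl

lemma measurable_setLIntegral_closedBall {h : E3 → ℝ≥0∞} (hh : Measurable h) (r : ℝ) :
    Measurable fun z => ∫⁻ x in Metric.closedBall z r, h x := by
  simp only [setLIntegral_closedBall_eq]
  exact ((hh.comp measurable_snd).indicator (measurableSet_dist_le r)).lintegral_prod_right'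

lemma lintegral_setLIntegral_closedBall {h : E3 → ℝ≥0∞} (hh : Measurable h) (r : ℝ) :
    ∫⁻ z, ∫⁻ x in Metric.closedBall z r, h x =
      volume (Metric.closedBall (0 : E3) r) * ∫⁻ x, h x := by
  have hm : Measurable (uncurry fun z x : E3 =>
      {p : E3 × E3 | dist p.2 p.1 ≤ r}.indicator (fun p => h p.2) (z, x)) :=
    (hh.comp measurable_snd).indicator (measurableSet_dist_le r)
  simp only [setLIntegral_closedBall_eq]
  rw [lintegral_lintegral_swap hm.aemeasurable, ← lintegral_const_mul _ hh]
  refine lintegral_congr fun x => ?_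
  have h1 : ∀ z, {p : E3 × E3 | dist p.2 p.1 ≤ r}.indicator (fun p => h p.2) (z, x) =
      (Metric.closedBall x r).indicator (fun _ => h x) z := fun z => by
    simp only [indicator, Metric.mem_closedBall, dist_comm z x]
    rfl
  simp only [h1]
  rw [lintegral_indicator_const measurableSet_closedBall, Measure.addHaar_closedBall_center,
    mul_comm]

lemma le_add_of_le_cube {f e w θ K : ℝ≥0∞} (hθ : θ ≠ 0) (hθ' : θ ≠ ⊤) (hw : w ≤ θ)
    (h : f ≤ K * (e + w) ^ 3) : f ≤ θ⁻¹ * (f * e) + K * 4 * θ ^ 2 * (e + w) := by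
  rcases le_total θ e with h1 | h1
  · refine le_add_right ?_
    calc f = θ⁻¹ * (f * θ) := by
          rw [mul_comm f, ← mul_assoc, ENNReal.inv_mul_cancel hθ hθ', one_mul]
      _ ≤ _ := by gcongr
  · refine le_add_left (h.trans ?_)
    calc K * (e + w) ^ 3 = K * ((e + w) ^ 2 * (e + w)) := by ring
      _ ≤ K * ((θ + θ) ^ 2 * (e + w)) := by gcongr
      _ = _ := by ring

/-- The potential energy is controlled by the interaction functional and a small remainder. -/
lemma IsNLW.pot_le (hu : IsNLW u) {E A θ : ℝ} (hA : 0 < A) (hE : ∀ t, energy u t ≤ E)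
    (hAP : APriori u A) (hρ : 0 < ρ) (hθ : 0 < θ) (hρE : A ^ 2 ≤ E * ρ ^ 2)
    (hρθ : A ^ 2 ≤ θ * ρ ^ 2) (t : ℝ) :
    pot u t ≤ ENNReal.ofReal θ⁻¹ * inter u ρ t +
      2097152 * sobK * ENNReal.ofReal (θ ^ 2 * E) := by
  have hs := hu.contDiff
  have hsl : Continuous (u t) := (contDiff_slice hs t).continuous
  have hec : Continuous fun y => edens u t y :=
    (continuous_edens hs).comp (by fun_prop : Continuous fun x : E3 => (t, x))
  set Θ := ENNReal.ofReal θ with hΘ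
  have hΘ0 : Θ ≠ 0 := by simpa [hΘ] using hθ
  have hΘT : Θ ≠ ⊤ := ENNReal.ofReal_ne_top
  set V := volume (Metric.closedBall (0 : E3) ρ) with hV
  have hV0 : V ≠ 0 := (Metric.measure_closedBall_pos _ _ hρ).ne'
  have hVT : V ≠ ⊤ := measure_closedBall_lt_top.ne
  have hV2 : volume (Metric.closedBall (0 : E3) (2 * ρ)) = 8 * V := by
    rw [Measure.addHaar_closedBall_mul _ _ (by norm_num) hρ.le, finrank_euclideanSpace,
      Fintype.card_fin, show (8 : ℝ≥0∞) = ENNReal.ofReal (2 ^ 3) by norm_num]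
  have hgm : Measurable fun x => ‖u t x‖ₑ ^ 6 := hsl.enorm.measurable.pow_const 6
  have hem : Measurable fun x => ENNReal.ofReal (edens u t x) := hec.measurable.ennreal_ofReal
  have hwm : Measurable fun x => ENNReal.ofReal (u t x ^ 2 / ρ ^ 2) :=
    ((hsl.pow 2).div_const _).measurable.ennreal_ofReal
  set f : E3 → ℝ≥0∞ := fun z => ∫⁻ x in Metric.closedBall z ρ, ‖u t x‖ₑ ^ 6 with hf
  set e : E3 → ℝ≥0∞ := fun z => ∫⁻ x in Metric.closedBall z (2 * ρ), ENNReal.ofReal (edens u t x)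
    with he
  set w : E3 → ℝ≥0∞ := fun z => ∫⁻ x in Metric.closedBall z (2 * ρ),
    ENNReal.ofReal (u t x ^ 2 / ρ ^ 2) with hw
  have hfm : Measurable f := measurable_setLIntegral_closedBall hgm ρ
  have hem' : Measurable e := measurable_setLIntegral_closedBall hem (2 * ρ)
  have hwm' : Measurable w := measurable_setLIntegral_closedBall hwm (2 * ρ)
  have hwtot : ∫⁻ x, ENNReal.ofReal (u t x ^ 2 / ρ ^ 2) ≤ ENNReal.ofReal (A ^ 2 / ρ ^ 2) := by
    have : ∀ v : ℝ, ENNReal.ofReal (v / ρ ^ 2) =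
        ENNReal.ofReal (ρ ^ 2)⁻¹ * ENNReal.ofReal v := fun v => by
      rw [← ENNReal.ofReal_mul (by positivity), div_eq_inv_mul]
    simp only [this]
    rw [lintegral_const_mul' _ _ ENNReal.ofReal_ne_top]
    exact mul_le_mul' le_rfl (hAP.lintegral_sq_le hA.le t)
  have hwle : ∀ z, w z ≤ Θ := fun z =>
    (setLIntegral_le_lintegral _ _).trans (hwtot.trans (ENNReal.ofReal_le_ofReal (by
      rw [div_le_iff₀ (by positivity)]; exact hρθ)))
  have hcube : ∀ z, f z ≤ 64 * sobK * 512 * (e z + w z) ^ 3 := fun z => by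
    refine (hu.lintegral_closedBall_pow_six_le hρ t z).trans (le_of_eq ?_)
    have : ∫⁻ x in Metric.closedBall z (2 * ρ),
        8 * ENNReal.ofReal (edens u t x + u t x ^ 2 / ρ ^ 2) = 8 * (e z + w z) := by
      rw [lintegral_const_mul' _ _ (by norm_num), he, hw]
      simp only [ENNReal.ofReal_add (edens_nonneg t _) (by positivity : 0 ≤ u t _ ^ 2 / ρ ^ 2)]
      rw [lintegral_add_left hem]
    rw [this]
    ring
  have hfe : ∫⁻ z, f z * e z ≤ V * inter u ρ t := by
    calc _ ≤ ∫⁻ z, ∫⁻ x in Metric.closedBall z ρ, ‖u t x‖ₑ ^ 6 * locE u ρ t x := by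
          refine lintegral_mono fun z => ?_
          simp only [hf]
          rw [← lintegral_mul_const _ hgm]
          refine setLIntegral_mono' measurableSet_closedBall fun x hx => ?_
          refine mul_le_mul' le_rfl (lintegral_mono_set ?_)
          refine Metric.closedBall_subset_closedBall' ?_
          have : dist x z ≤ ρ := hx
          rw [dist_comm]
          linarith
      _ = V * ∫⁻ x, ‖u t x‖ₑ ^ 6 * locE u ρ t x :=
          lintegral_setLIntegral_closedBall
            (hgm.mul (measurable_setLIntegral_closedBall hem (3 * ρ))) ρ
      _ = _ := by
          rw [inter]
          congr 1
          refine lintegral_congr fun x => ?_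
          rw [← ofReal_norm, ← ENNReal.ofReal_pow (norm_nonneg _), Real.norm_eq_abs,
            Even.pow_abs (by decide)]
  have hVp : V * pot u t ≤ V * (Θ⁻¹ * inter u ρ t +
      2097152 * sobK * ENNReal.ofReal (θ ^ 2 * E)) := by
    calc V * pot u t = ∫⁻ z, f z := (lintegral_setLIntegral_closedBall hgm ρ).symm
      _ ≤ ∫⁻ z, (Θ⁻¹ * (f z * e z) + 64 * sobK * 512 * 4 * Θ ^ 2 * (e z + w z)) :=
          lintegral_mono fun z => le_add_of_le_cube hΘ0 hΘT (hwle z) (hcube z)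
      _ = Θ⁻¹ * (∫⁻ z, f z * e z) +
          64 * sobK * 512 * 4 * Θ ^ 2 * ((8 * V * ∫⁻ x, ENNReal.ofReal (edens u t x)) +
            8 * V * ∫⁻ x, ENNReal.ofReal (u t x ^ 2 / ρ ^ 2)) := by
          rw [lintegral_add_left (by exact (hfm.mul hem').const_mul _), lintegral_const_mul _ (by exact hfm.mul hem'),
            lintegral_const_mul _ (by exact hem'.add hwm'), lintegral_add_left hem', ← hV2,
            ← lintegral_setLIntegral_closedBall hem, ← lintegral_setLIntegral_closedBall hwm]
      _ ≤ Θ⁻¹ * (V * inter u ρ t) +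
          64 * sobK * 512 * 4 * Θ ^ 2 * (8 * V * ENNReal.ofReal E + 8 * V * ENNReal.ofReal E) := by
          have h1 := hu.lintegral_edens_le hE t
          have h2 : ∫⁻ x, ENNReal.ofReal (u t x ^ 2 / ρ ^ 2) ≤ ENNReal.ofReal E :=
            hwtot.trans (ENNReal.ofReal_le_ofReal (by
              rw [div_le_iff₀ (by positivity)]; exact hρE))
          exact add_le_add (mul_le_mul' le_rfl hfe)
            (mul_le_mul' le_rfl (add_le_add (mul_le_mul' le_rfl h1) (mul_le_mul' le_rfl h2)))
      _ = _ := by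
          rw [ENNReal.ofReal_mul (by positivity), ENNReal.ofReal_pow hθ.le]
          ring
  rw [ENNReal.ofReal_inv_of_pos hθ]
  exact (ENNReal.mul_le_mul_iff_right hV0 hVT).1 hVp

end potential_bound

section pigeonhole

lemma setLIntegral_Icc_sub_left {g : ℝ → ℝ≥0∞} (hg : Measurable g) (t T : ℝ) :
    ∫⁻ s in Icc 0 T, g (t - s) = ∫⁻ τ in Icc (t - T) t, g τ := by
  have h := (Measure.measurePreserving_sub_left volume t).setLIntegral_comp_preimage
    (measurableSet_Icc (a := t - T) (b := t)) hg
  rw [← h]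
  simp

lemma setLIntegral_Icc_sub_right_le {g : ℝ → ℝ≥0∞} (hg : Measurable g) {a T L s : ℝ}
    (hs : s ∈ Icc 0 T) :
    ∫⁻ t in Icc (a + T) (a + T + L), g (t - s) ≤ ∫⁻ τ in Icc a (a + T + L), g τ := by
  have h := (measurePreserving_sub_right volume s).setLIntegral_comp_preimage
    (measurableSet_Icc (a := a + T - s) (b := a + T + L - s)) hg
  have h2 : (fun x => x - s) ⁻¹' Icc (a + T - s) (a + T + L - s) = Icc (a + T) (a + T + L) := by
    simp
  rw [h2] at h
  rw [h]
  exact lintegral_mono_set (Icc_subset_Icc (by linarith [hs.2]) (by linarith [hs.1]))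

lemma lintegral_Icc_one_div {p q : ℝ} (hp : 0 < p) (hpq : p ≤ q) (d : ℝ) :
    ∫⁻ t in Icc (d + p) (d + q), ENNReal.ofReal (1 / (t - d)) =
      ENNReal.ofReal (log (q / p)) := by
  have hi : IntervalIntegrable (fun t => 1 / (t - d)) volume (d + p) (d + q) := by
    refine ContinuousOn.intervalIntegrable ?_
    rw [uIcc_of_le (by linarith)]
    refine ContinuousOn.div continuousOn_const (by fun_prop) fun t ht => ?_
    have : 0 < t - d := by linarith [ht.1]
    exact this.ne'
  rw [← restrict_Ioc_eq_restrict_Icc, ← ofReal_integral_eq_lintegral_ofReal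
    ((intervalIntegrable_iff_integrableOn_Ioc_of_le (by linarith)).1 hi),
    ← intervalIntegral.integral_of_le (by linarith),
    intervalIntegral.integral_comp_sub_right (fun t => 1 / t)]
  · rw [show d + p - d = p by ring, show d + q - d = q by ring,
      integral_one_div_of_pos hp (hp.trans_le hpq)]
  · refine (ae_restrict_mem measurableSet_Ioc).mono fun t ht => ?_
    have : 0 < t - d := by linarith [ht.1]
    positivity

/-- If `Q` has a finite integral against a weight comparable to `dt / t`, then some time window
of fixed length carries little of `Q`. -/
lemma exists_window_le {Q : ℝ → ℝ≥0∞} (hQ : Measurable Q) {a T L ρ : ℝ} (hT : 0 < T)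
    (hL : 0 < L) (hρ : 0 < ρ) {B : ℝ≥0∞} (hB0 : B ≠ 0) (hB : B ≠ ⊤)
    (h : ∫⁻ τ in Icc a (a + T + L), ENNReal.ofReal (1 / (τ - a + ρ)) * Q τ ≤ B) :
    ∃ t₀ ∈ Icc (a + T) (a + T + L), ENNReal.ofReal (log ((T + L + ρ) / (T + ρ))) *
      ∫⁻ τ in Icc (t₀ - T) t₀, Q τ ≤ 2 * (ENNReal.ofReal T * B) := by
  by_contra! hc
  set w : ℝ → ℝ≥0∞ := fun t => ENNReal.ofReal (1 / (t - a + ρ)) with hw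
  have hwm : Measurable w := by rw [hw]; fun_prop
  have hgm : Measurable fun t => w t * Q t := hwm.mul hQ
  set Λ := ENNReal.ofReal (log ((T + L + ρ) / (T + ρ))) with hΛ
  have hΛ0 : Λ ≠ 0 := by
    simp only [hΛ, ne_eq, ENNReal.ofReal_eq_zero, not_le]
    exact log_pos ((one_lt_div (by positivity)).2 (by linarith))
  have hwint : ∫⁻ t in Icc (a + T) (a + T + L), w t = Λ := by
    have := lintegral_Icc_one_div (p := T + ρ) (q := T + L + ρ) (by positivity) (by linarith)
      (a - ρ)
    rw [show a - ρ + (T + ρ) = a + T by ring, show a - ρ + (T + L + ρ) = a + T + L by ring] at this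
    rw [hΛ, ← this]
    simp only [hw, sub_sub_eq_add_sub, sub_add_eq_add_sub]
  have hTB0 : ENNReal.ofReal T * B ≠ 0 := mul_ne_zero (by simpa using hT) hB0
  have hTB : ENNReal.ofReal T * B ≠ ⊤ := ENNReal.mul_ne_top ENNReal.ofReal_ne_top hB
  have key : ∫⁻ t in Icc (a + T) (a + T + L), w t * ∫⁻ τ in Icc (t - T) t, Q τ ≤
      ENNReal.ofReal T * B := by
    calc _ ≤ ∫⁻ t in Icc (a + T) (a + T + L), ∫⁻ s in Icc 0 T, w (t - s) * Q (t - s) := by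
          refine setLIntegral_mono' measurableSet_Icc fun t ht => ?_
          rw [setLIntegral_Icc_sub_left hgm, ← lintegral_const_mul _ hQ]
          refine setLIntegral_mono' measurableSet_Icc fun τ hτ => ?_
          refine mul_le_mul' (ENNReal.ofReal_le_ofReal ?_) le_rfl
          exact one_div_le_one_div_of_le (by linarith [ht.1, hτ.1]) (by linarith [hτ.2])
      _ = ∫⁻ s in Icc 0 T, ∫⁻ t in Icc (a + T) (a + T + L), w (t - s) * Q (t - s) :=
          lintegral_lintegral_swap
            (hgm.comp (measurable_fst.sub measurable_snd)).aemeasurable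
      _ ≤ ∫⁻ s in Icc 0 T, B := by
          refine setLIntegral_mono' measurableSet_Icc fun s hs => ?_
          exact (setLIntegral_Icc_sub_right_le hgm hs).trans h
      _ = _ := by
          rw [setLIntegral_const, Real.volume_Icc, sub_zero, mul_comm]
  have key2 : Λ * (2 * (ENNReal.ofReal T * B)) ≤ Λ * (ENNReal.ofReal T * B) := by
    calc _ = ∫⁻ t in Icc (a + T) (a + T + L), w t * (2 * (ENNReal.ofReal T * B)) := by
          rw [lintegral_mul_const _ hwm, hwint]
      _ ≤ ∫⁻ t in Icc (a + T) (a + T + L), Λ * (w t * ∫⁻ τ in Icc (t - T) t, Q τ) := by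
          refine setLIntegral_mono' measurableSet_Icc fun t ht => ?_
          exact (mul_le_mul' le_rfl (hc t ht).le).trans_eq (mul_left_comm _ _ _)
      _ ≤ _ := by
          rw [lintegral_const_mul' _ _ ENNReal.ofReal_ne_top]
          exact mul_le_mul' le_rfl key
  have key3 := (ENNReal.mul_le_mul_iff_right hΛ0 ENNReal.ofReal_ne_top).1 key2
  rw [two_mul] at key3
  exact absurd key3 (not_le.2 (ENNReal.lt_add_right hTB hTB0))

variable {u : ℝ → E3 → ℝ} {ρ : ℝ}

lemma measurable_inter (hs : ContDiff ℝ (⊤ : ℕ∞) (uncurry u)) : Measurable (inter u ρ) := by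
  have he : Measurable fun p : (ℝ × E3) × E3 => ENNReal.ofReal (edens u p.1.1 p.2) :=
    ((continuous_edens hs).comp (by fun_prop :
      Continuous fun p : (ℝ × E3) × E3 => (p.1.1, p.2))).measurable.ennreal_ofReal
  have hset : MeasurableSet {p : (ℝ × E3) × E3 | dist p.2 p.1.2 ≤ 3 * ρ} :=
    (isClosed_le (by fun_prop) continuous_const).measurableSet
  have hl : Measurable fun q : ℝ × E3 => locE u ρ q.1 q.2 := by
    have : (fun q : ℝ × E3 => locE u ρ q.1 q.2) = fun q => ∫⁻ z,
        {p : (ℝ × E3) × E3 | dist p.2 p.1.2 ≤ 3 * ρ}.indicator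
          (fun p => ENNReal.ofReal (edens u p.1.1 p.2)) (q, z) := by
      funext q
      rw [locE, ← lintegral_indicator measurableSet_closedBall]
      rfl
    rw [this]
    exact (he.indicator hset).lintegral_prod_right'
  have hv : Measurable fun q : ℝ × E3 => ENNReal.ofReal (u q.1 q.2 ^ 6) :=
    (hs.continuous.pow 6).measurable.ennreal_ofReal
  exact Measurable.lintegral_prod_right' (hv.mul hl)

/-- The constant in the bound for the potential energy over a good time window. -/
def windowK : ℝ := 15120 + 2097152 * sobK

/-- On every long time interval there is a window over which the potential energy is small. -/
lemma IsNLW.exists_window (hu : IsNLW u) {E A θ a T L Λ : ℝ} (hE0 : 0 < E) (hA : 0 < A)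
    (hE : ∀ t, energy u t ≤ E) (hAP : APriori u A) (hρ : 0 < ρ) (hθ : 0 < θ) (hT : 0 < T)
    (hL : 0 < L) (hΛ : 0 < Λ) (hρE : A ^ 2 ≤ E * ρ ^ 2) (hρθ : A ^ 2 ≤ θ * ρ ^ 2)
    (hΛθ : θ ^ 3 * Λ = E) (hΛL : Λ ≤ log ((T + L + ρ) / (T + ρ))) :
    ∃ t₀ ∈ Icc (a + T) (a + T + L),
      ∫⁻ τ in Icc (t₀ - T) t₀, pot u τ ≤ ENNReal.ofReal (windowK * (T * (θ ^ 2 * E))) := by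
  have hEp : ENNReal.ofReal E ≠ 0 := by simpa using hE0
  obtain ⟨t₀, ht₀, h⟩ := exists_window_le (measurable_inter hu.contDiff) hT hL hρ
    (B := 420 * (ENNReal.ofReal (18 * E) * ENNReal.ofReal E)) (by simp [hE0])
    (by finiteness) (hu.inter_le hA hE hAP hρ hρE (by linarith : a ≤ a + T + L))
  refine ⟨t₀, ht₀, ?_⟩
  set I := ∫⁻ τ in Icc (t₀ - T) t₀, inter u ρ τ
  have hI : I ≤ ENNReal.ofReal (15120 * (T * E ^ 2) / Λ) := by
    rw [ENNReal.ofReal_div_of_pos hΛ, ENNReal.le_div_iff_mul_le (by simp [hΛ]) (by simp), mul_comm]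
    calc _ ≤ _ := (mul_le_mul' (ENNReal.ofReal_le_ofReal hΛL) le_rfl).trans h
      _ = _ := by
        rw [show (420 : ℝ≥0∞) = ENNReal.ofReal 420 by norm_num,
          show (2 : ℝ≥0∞) = ENNReal.ofReal 2 by norm_num, ← ENNReal.ofReal_mul (by positivity),
          ← ENNReal.ofReal_mul (by positivity), ← ENNReal.ofReal_mul (by positivity),
          ← ENNReal.ofReal_mul (by positivity)]
        congr 1
        ring
  have hsob : (2097152 * (sobK : ℝ≥0∞)) = ENNReal.ofReal (2097152 * sobK) := by
    rw [ENNReal.ofReal_mul (by norm_num), ENNReal.ofReal_coe_nnreal]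
    norm_num
  calc _ ≤ ∫⁻ τ in Icc (t₀ - T) t₀, (ENNReal.ofReal θ⁻¹ * inter u ρ τ +
        2097152 * sobK * ENNReal.ofReal (θ ^ 2 * E)) :=
        lintegral_mono fun τ => hu.pot_le hA hE hAP hρ hθ hρE hρθ τ
    _ = ENNReal.ofReal θ⁻¹ * I +
        2097152 * sobK * ENNReal.ofReal (θ ^ 2 * E) * ENNReal.ofReal T := by
        rw [lintegral_add_right _ measurable_const,
          lintegral_const_mul' _ _ ENNReal.ofReal_ne_top, setLIntegral_const, Real.volume_Icc,
          sub_sub_cancel]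
    _ ≤ ENNReal.ofReal θ⁻¹ * ENNReal.ofReal (15120 * (T * E ^ 2) / Λ) +
        2097152 * sobK * ENNReal.ofReal (θ ^ 2 * E) * ENNReal.ofReal T :=
        add_le_add (mul_le_mul' le_rfl hI) le_rfl
    _ = _ := by
        rw [hsob, ← ENNReal.ofReal_mul (by positivity), ← ENNReal.ofReal_mul (by positivity),
          ← ENNReal.ofReal_mul (by positivity), ← ENNReal.ofReal_add (by positivity)
            (by positivity)]
        congr 1
        rw [windowK, ← hΛθ]
        field_simp

end pigeonhole

section endgame
variable {u : ℝ → E3 → ℝ}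

/-- The constant in the bound of the Duhamel integral by the potential energy. -/
def duhK : ℝ := 145800 ^ 3 * 216 ^ 2 * 60 ^ 5 * 20000

lemma IsNLW.mixNorm_duh_le_of_pot (hu : IsNLW u) {E A T t₀ m η : ℝ} (b : ℝ) (hE0 : 0 < E)
    (hA : 0 < A) (hE : ∀ t, energy u t ≤ E) (hAP : APriori u A) (hT : 0 < T) (hm : 0 ≤ m)
    (hη : 0 ≤ η) (hpot : ∫⁻ τ in Icc (t₀ - T) t₀, pot u τ ≤ ENNReal.ofReal m)
    (h : duhK * (A * √E) ^ 5 * E ^ 3 * (m ^ 4 * T) ≤ η ^ 8) :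
    mixNorm 8 8 (Icc t₀ b) (fun t x => duh u (t₀ - T) t₀ t x) ≤ ENNReal.ofReal η := by
  have hM : ∀ t x, ‖u t x‖ₑ ≤ ENNReal.ofReal (√(60 * A * √E)) := fun t x => by
    have h2 := hu.enorm_sq_le hE0 hA hE hAP t x
    refine (ENNReal.pow_le_pow_left_iff two_ne_zero).1 ?_
    rwa [← ENNReal.ofReal_pow (by positivity), Real.sq_sqrt (by positivity)]
  refine (mixNorm_duh_le hu.contDiff (fun t => (hu.2.1 t (mem_univ t)).1) hM
    (hu.lintegral_edens_le hE) ENNReal.ofReal_ne_top ENNReal.ofReal_ne_top hT t₀ b).trans ?_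
  rw [one_div, ENNReal.rpow_inv_le_iff (by norm_num)]
  have h8 : ENNReal.ofReal η ^ (8 : ℝ) = ENNReal.ofReal (η ^ 8) := by
    rw [ENNReal.ofReal_pow hη, ← ENNReal.rpow_natCast]
    norm_num
  rw [h8]
  have hM10 : ENNReal.ofReal √(60 * A * √E) ^ 10 = ENNReal.ofReal ((60 * A * √E) ^ 5) := by
    rw [← ENNReal.ofReal_pow (by positivity)]
    congr 1
    rw [show √(60 * A * √E) ^ 10 = (√(60 * A * √E) ^ 2) ^ 5 by ring,
      Real.sq_sqrt (by positivity)]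
  rw [hM10]
  calc _ ≤ 145800 ^ 3 * 216 ^ 2 * ENNReal.ofReal ((60 * A * √E) ^ 5) * ENNReal.ofReal E ^ 3 *
        (ENNReal.ofReal m ^ 4 * ENNReal.ofReal (20000 * T)) :=
        mul_le_mul' le_rfl (mul_le_mul' (pow_le_pow_left' hpot 4) le_rfl)
    _ = ENNReal.ofReal (duhK * (A * √E) ^ 5 * E ^ 3 * (m ^ 4 * T)) := by
        rw [show (145800 : ℝ≥0∞) = ENNReal.ofReal 145800 by norm_num,
          show (216 : ℝ≥0∞) = ENNReal.ofReal 216 by norm_num,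
          ← ENNReal.ofReal_pow (by positivity), ← ENNReal.ofReal_pow (by positivity),
          ← ENNReal.ofReal_pow (by positivity), ← ENNReal.ofReal_pow (by positivity),
          ← ENNReal.ofReal_mul (by positivity), ← ENNReal.ofReal_mul (by positivity),
          ← ENNReal.ofReal_mul (by positivity), ← ENNReal.ofReal_mul (by positivity),
          ← ENNReal.ofReal_mul (by positivity), duhK]
        congr 1
        ring
    _ ≤ _ := ENNReal.ofReal_le_ofReal h

lemma IsNLW.pot_le_energy (hu : IsNLW u) {E : ℝ} (hE : ∀ t, energy u t ≤ E) (t : ℝ) :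
    pot u t ≤ ENNReal.ofReal (6 * E) := by
  have h6 : (6 : ℝ≥0∞) = ENNReal.ofReal 6 := by norm_num
  calc pot u t ≤ ∫⁻ x, 6 * ENNReal.ofReal (edens u t x) := by
        refine lintegral_mono fun x => ?_
        rw [← ofReal_norm, ← ENNReal.ofReal_pow (norm_nonneg _), Real.norm_eq_abs,
          Even.pow_abs (by decide), h6, ← ENNReal.ofReal_mul (by norm_num)]
        refine ENNReal.ofReal_le_ofReal ?_
        rw [edens, Fin.sum_univ_three]
        linarith [sq_nonneg (pd et (uncurry u) (t, x)), sq_nonneg (pd (ex 0) (uncurry u) (t, x)),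
          sq_nonneg (pd (ex 1) (uncurry u) (t, x)), sq_nonneg (pd (ex 2) (uncurry u) (t, x))]
    _ = 6 * ∫⁻ x, ENNReal.ofReal (edens u t x) := lintegral_const_mul' _ _ (by norm_num)
    _ ≤ _ := by
        rw [ENNReal.ofReal_mul (by norm_num), ← h6]
        exact mul_le_mul' le_rfl (hu.lintegral_edens_le hE t)

lemma IsNLW.pot_le_mass (hu : IsNLW u) {E A : ℝ} (hE0 : 0 < E) (hA : 0 < A)
    (hE : ∀ t, energy u t ≤ E) (hAP : APriori u A) (t : ℝ) :
    pot u t ≤ ENNReal.ofReal (3600 * A ^ 4 * E) := by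
  calc pot u t ≤ ∫⁻ x, ENNReal.ofReal (60 * A * √E) ^ 2 * ENNReal.ofReal (u t x ^ 2) := by
        refine lintegral_mono fun x => ?_
        have h1 : ENNReal.ofReal (u t x ^ 2) = ‖u t x‖ₑ ^ 2 := by
          rw [← ofReal_norm, ← ENNReal.ofReal_pow (norm_nonneg _), Real.norm_eq_abs, sq_abs]
        rw [h1, show ‖u t x‖ₑ ^ 6 = (‖u t x‖ₑ ^ 2) ^ 2 * ‖u t x‖ₑ ^ 2 by ring]
        exact mul_le_mul' (pow_le_pow_left' (hu.enorm_sq_le hE0 hA hE hAP t x) 2) le_rfl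
    _ = ENNReal.ofReal (60 * A * √E) ^ 2 * ∫⁻ x, ENNReal.ofReal (u t x ^ 2) :=
        lintegral_const_mul' _ _ (by finiteness)
    _ ≤ ENNReal.ofReal (60 * A * √E) ^ 2 * ENNReal.ofReal (A ^ 2) :=
        mul_le_mul' le_rfl (hAP.lintegral_sq_le hA.le t)
    _ = _ := by
        rw [← ENNReal.ofReal_pow (by positivity), ← ENNReal.ofReal_mul (by positivity)]
        congr 1
        rw [mul_pow, Real.sq_sqrt hE0.le]
        ring

lemma setLIntegral_pot_le {F T t₀ : ℝ} (hF : 0 ≤ F) (hpot : ∀ t, pot u t ≤ ENNReal.ofReal F) :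
    ∫⁻ τ in Icc (t₀ - T) t₀, pot u τ ≤ ENNReal.ofReal (F * T) := by
  calc _ ≤ ∫⁻ τ in Icc (t₀ - T) t₀, ENNReal.ofReal F := lintegral_mono hpot
    _ = _ := by
      rw [setLIntegral_const, Real.volume_Icc, sub_sub_cancel, ENNReal.ofReal_mul hF]

lemma exp_monomial_le {k p q κ τ μ : ℝ} (hk : duhK * k ^ 4 * 256 ≤ exp (8 * κ))
    (h : 5 * q + 11 / 2 * p + 4 * μ + τ ≤ -(4 / 7) * p) :
    duhK * (exp q * √(exp p)) ^ 5 * exp p ^ 3 * ((k * exp μ) ^ 4 * exp τ) ≤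
      (exp (κ - p / 14) / 2) ^ 8 := by
  have e1 : (exp q * √(exp p)) ^ 5 = exp (5 * (q + p / 2)) := by
    rw [← exp_half, ← exp_add, ← exp_nat_mul]
    norm_num
  have e2 : exp p ^ 3 = exp (3 * p) := by
    rw [← exp_nat_mul]
    norm_num
  have e3 : exp μ ^ 4 = exp (4 * μ) := by
    rw [← exp_nat_mul]
    norm_num
  have e4 : exp (κ - p / 14) ^ 8 = exp (8 * κ) * exp (-(4 / 7) * p) := by
    rw [← exp_nat_mul, ← exp_add]
    congr 1
    push_cast
    ring
  have e5 : exp (5 * (q + p / 2)) * exp (3 * p) * exp (4 * μ) * exp τ =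
      exp (5 * q + 11 / 2 * p + 4 * μ + τ) := by
    rw [← exp_add, ← exp_add, ← exp_add]
    congr 1
    ring
  rw [e1, e2, mul_pow, e3, div_pow, e4]
  calc _ = duhK * k ^ 4 * 256 * (exp (5 * (q + p / 2)) * exp (3 * p) * exp (4 * μ) * exp τ) /
        2 ^ 8 := by ring
    _ ≤ _ := by
      rw [e5]
      gcongr

lemma IsNLW.mixNorm_duh_le_of_exp (hu : IsNLW u) {p q κ τ μ k t₀ : ℝ} (b : ℝ)
    (hE : ∀ t, energy u t ≤ exp p) (hAP : APriori u (exp q)) (hk0 : 0 ≤ k)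
    (hk : duhK * k ^ 4 * 256 ≤ exp (8 * κ))
    (h : 5 * q + 11 / 2 * p + 4 * μ + τ ≤ -(4 / 7) * p)
    (hpot : ∫⁻ s in Icc (t₀ - exp τ) t₀, pot u s ≤ ENNReal.ofReal (k * exp μ)) :
    mixNorm 8 8 (Icc t₀ b) (fun t x => duh u (t₀ - exp τ) t₀ t x) ≤
      ENNReal.ofReal (exp (κ - p / 14) / 2) :=
  hu.mixNorm_duh_le_of_pot b (exp_pos p) (exp_pos q) hE hAP (exp_pos τ) (by positivity)
    (by positivity) hpot (exp_monomial_le hk h)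

lemma le_log_window {C X T ρ : ℝ} (hC : 10 ≤ C) (hX : 1 ≤ X) (hT : 0 < T) (hTX : T ≤ X)
    (hρ : 0 < ρ) (hρX : ρ ≤ C * X ^ 2) :
    C * X / 2 ≤ log ((T + exp (C * X) + ρ) / (T + ρ)) := by
  rw [Real.le_log_iff_exp_le (by positivity), le_div_iff₀ (by positivity)]
  have h1 : (C * X / 2) ^ 3 / Nat.factorial 3 ≤ exp (C * X / 2) :=
    Real.pow_div_factorial_le_exp _ (by positivity) 3
  have h2 : T + ρ ≤ exp (C * X / 2) := by
    refine le_trans ?_ h1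
    have : (Nat.factorial 3 : ℝ) = 6 := by norm_num [Nat.factorial]
    rw [this]
    have hX2 : X ≤ X ^ 2 := by nlinarith
    have hCX : 100 * (C * X ^ 2) ≤ C ^ 2 * (C * X ^ 2) := by
      have : (100 : ℝ) ≤ C ^ 2 := by nlinarith
      gcongr
    have hX3 : C ^ 2 * (C * X ^ 2) ≤ C ^ 2 * (C * X ^ 2) * X :=
      le_mul_of_one_le_right (by positivity) hX
    have hCX2 : 10 * X ^ 2 ≤ C * X ^ 2 := by gcongr
    have : (C * X / 2) ^ 3 / 6 = C ^ 2 * (C * X ^ 2) * X / 48 := by ring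
    rw [this]
    linarith [sq_nonneg X]
  calc exp (C * X / 2) * (T + ρ) ≤ exp (C * X / 2) * exp (C * X / 2) := by gcongr
    _ = exp (C * X) := by rw [← exp_add]; congr 1; ring
    _ ≤ _ := by linarith

end endgame

section good_time
variable {u : ℝ → E3 → ℝ}

lemma good_time_exponents {p q x : ℝ} (hx : x = 11 * q + 317 / 21 * p)
    (h1 : 0 < 15 * q + 67 / 3 * p) (h2 : 0 < 31 * q + 67 / 3 * p) :
    0 ≤ x ∧ 2 * q + 103 / 42 * p ≤ x ∧ 2 * q ≤ p + 4 * x ∧ 6 * q ≤ p + 11 * x ∧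
      0 ≤ 43 / 3 * q + 961 / 63 * p := by
  subst hx
  refine ⟨by linarith, by linarith, by linarith, by linarith, by linarith⟩

lemma IsNLW.exists_good_time (hu : IsNLW u) {p q κ τ x : ℝ} (hE : ∀ t, energy u t ≤ exp p)
    (hAP : APriori u (exp q)) (hτ : τ = 2 * q + 103 / 42 * p)
    (hx : x = 11 * q + 317 / 21 * p) (hκ10 : 10 ≤ exp (4 * κ))
    (hκ1 : duhK * 3600 ^ 4 * 256 ≤ exp (8 * κ)) (hκ2 : duhK * windowK ^ 4 * 256 ≤ exp (8 * κ))
    (a b : ℝ) :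
    ∃ t₀ ∈ Icc (a + exp τ) (a + exp τ + exp (exp (4 * κ) * exp x)),
      mixNorm 8 8 (Icc t₀ b) (fun t x => duh u (t₀ - exp τ) t₀ t x) ≤
        ENNReal.ofReal (exp (κ - p / 14) / 2) := by
  have hmem : a + exp τ ∈ Icc (a + exp τ) (a + exp τ + exp (exp (4 * κ) * exp x)) :=
    ⟨le_rfl, by linarith [exp_pos (exp (4 * κ) * exp x)]⟩
  have hexp4 : exp (4 * q) = exp q ^ 4 := by
    rw [← exp_nat_mul]
    norm_num
  rcases le_or_gt (15 * q + 67 / 3 * p) 0 with h1 | h1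
  · refine ⟨a + exp τ, hmem, hu.mixNorm_duh_le_of_exp b hE hAP (by norm_num : (0 : ℝ) ≤ 3600) hκ1
      (μ := τ + p) (by linarith) ?_⟩
    refine (setLIntegral_pot_le (by positivity) (hu.pot_le_energy hE)).trans
      (ENNReal.ofReal_le_ofReal ?_)
    rw [exp_add]
    nlinarith [mul_pos (exp_pos τ) (exp_pos p)]
  rcases le_or_gt (31 * q + 67 / 3 * p) 0 with h2 | h2
  · refine ⟨a + exp τ, hmem, hu.mixNorm_duh_le_of_exp b hE hAP (by norm_num : (0 : ℝ) ≤ 3600) hκ1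
      (μ := τ + 4 * q + p) (by linarith) ?_⟩
    refine (setLIntegral_pot_le (by positivity)
      (hu.pot_le_mass (exp_pos p) (exp_pos q) hE hAP)).trans (ENNReal.ofReal_le_ofReal ?_)
    rw [exp_add, exp_add, hexp4]
    exact le_of_eq (by ring)
  obtain ⟨hx0, hτx, hq1, hq2, hlast⟩ := good_time_exponents hx h1 h2
  set C := exp (4 * κ) with hC
  set X := exp x with hX
  have hX1 : 1 ≤ X := one_le_exp hx0
  have hX2 : X ^ 2 = exp (2 * x) := by
    rw [hX, ← exp_nat_mul]
    norm_num
  set δ := (2 / C) ^ ((1 : ℝ) / 3) with hδ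
  have hC0 : 0 < C := exp_pos _
  have hδ3 : δ ^ 3 = 2 / C := by
    rw [hδ, ← rpow_natCast, ← rpow_mul (by positivity)]
    norm_num
  have hδ0 : 0 < δ := by positivity
  have hδ1 : δ ≤ 1 := by
    refine rpow_le_one (by positivity) ?_ (by norm_num)
    rw [div_le_one hC0]
    linarith
  set θ := exp ((p - x) / 3) * δ with hθ
  have hθ0 : 0 < θ := by positivity
  have hθ3 : θ ^ 3 = exp (p - x) * (2 / C) := by
    rw [hθ, mul_pow, hδ3, ← exp_nat_mul]
    congr 2
    push_cast
    ring
  have hρE : exp q ^ 2 ≤ exp p * (C * X ^ 2) ^ 2 := by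
    calc exp q ^ 2 = exp (2 * q) := by rw [← exp_nat_mul]; norm_num
      _ ≤ exp (p + 4 * x) := exp_le_exp.2 hq1
      _ = exp p * (1 * X ^ 2) ^ 2 := by
          rw [hX2, one_mul, ← exp_nat_mul, ← exp_add]
          congr 1
          push_cast
          ring
      _ ≤ _ := by gcongr; linarith
  have hρθ : exp q ^ 2 ≤ θ * (C * X ^ 2) ^ 2 := by
    refine (pow_le_pow_iff_left₀ (by positivity) (by positivity) (n := 3) (by norm_num)).1 ?_
    calc (exp q ^ 2) ^ 3 = exp (6 * q) := by rw [← exp_nat_mul, ← exp_nat_mul]; congr 1; push_cast; ring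
      _ ≤ exp (p + 11 * x) := exp_le_exp.2 hq2
      _ = exp (p - x) * exp (2 * x) ^ 6 := by
          rw [← exp_nat_mul, ← exp_add]
          congr 1
          push_cast
          ring
      _ ≤ exp (p - x) * exp (2 * x) ^ 6 * (2 * C ^ 5) := by
          refine le_mul_of_one_le_right (by positivity) ?_
          have : (1 : ℝ) ≤ C ^ 5 := one_le_pow₀ (by linarith)
          linarith
      _ = _ := by
          rw [mul_pow θ, hθ3, hX2]
          field_simp
  have hΛθ : θ ^ 3 * (C * X / 2) = exp p := by
    have : exp p = exp (p - x) * X := by rw [hX, ← exp_add]; congr 1; ring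
    rw [hθ3, this]
    field_simp
  obtain ⟨t₀, ht₀, h⟩ := hu.exists_window (a := a) (exp_pos p) (exp_pos q) hE hAP
    (by positivity : 0 < C * X ^ 2) hθ0 (exp_pos τ) (exp_pos (C * X)) (by positivity) hρE hρθ hΛθ
    (le_log_window hκ10 hX1 (exp_pos τ) (by rw [hX, exp_le_exp, hτ]; exact hτx) (by positivity)
      le_rfl)
  have hwK : 0 ≤ windowK := by
    unfold windowK
    positivity
  refine ⟨t₀, ht₀, hu.mixNorm_duh_le_of_exp b hE hAP hwK hκ2
    (μ := τ + 2 * ((p - x) / 3) + p) (by linarith) (h.trans (ENNReal.ofReal_le_ofReal ?_))⟩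
  have hθ2 : θ ^ 2 ≤ exp (2 * ((p - x) / 3)) := by
    calc θ ^ 2 ≤ (exp ((p - x) / 3) * 1) ^ 2 := by rw [hθ]; gcongr
      _ = _ := by rw [mul_one, ← exp_nat_mul]; norm_num
  rw [exp_add, exp_add, mul_assoc]
  gcongr

end good_time

/-- existence of a good time `t₀` near the left endpoint of a long interval at
which the recent-past Duhamel term is small in `L⁸_{t,x}`. -/
theorem stmt12 :
    ∃ c C : ℝ, 0 < c ∧ 0 < C ∧ ∀ (E A : ℝ), 0 < E → 0 < A →
      ∀ ε T 𝒯 : ℝ, ε = c * E ^ (-(1:ℝ)/14) → T = C * A ^ 2 * E ^ ((13:ℝ)/6) * ε ^ (-(4:ℝ)) →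
        𝒯 = Real.exp (C * E ^ ((85:ℝ)/6) * E ^ ((13:ℝ)/14) * A ^ 11) →
      ∀ u : ℝ → E3 → ℝ, IsNLW u → (∀ t : ℝ, energy u t ≤ E) → APriori u A →
      ∀ a b : ℝ, T ≤ a → 𝒯 ≤ b - a →
        ∃ t₀ : ℝ, 0 < t₀ - a ∧ t₀ - a ≤ 𝒯 + T ∧
          mixNorm 8 8 (Icc t₀ b) (fun t x => duh u (t₀ - T) t₀ t x) ≤
            ENNReal.ofReal (ε/2) := by
  have hd : 0 < duhK := by
    unfold duhK
    positivity
  have hw : 0 ≤ windowK := by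
    unfold windowK
    positivity
  set B := 10 + duhK * 3600 ^ 4 * 256 + duhK * windowK ^ 4 * 256 with hB
  have hB1 : 0 ≤ duhK * 3600 ^ 4 * 256 := by positivity
  have hB2 : 0 ≤ duhK * windowK ^ 4 * 256 := by positivity
  have hB0 : 0 < B := by linarith
  set κ := log B / 4 with hκ
  have h4 : exp (4 * κ) = B := by rw [hκ, mul_div_cancel₀ _ (by norm_num), exp_log hB0]
  have h8 : B ≤ exp (8 * κ) := by
    have : exp (8 * κ) = B ^ 2 := by
      rw [← h4, ← exp_nat_mul]
      congr 1
      push_cast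
      ring
    rw [this]
    nlinarith
  refine ⟨exp κ, exp (4 * κ), exp_pos _, exp_pos _, ?_⟩
  intro E A hE0 hA0 ε T 𝒯 hε hT h𝒯 u hu hE hAP a b _ _
  obtain ⟨p, rfl⟩ : ∃ p, exp p = E := ⟨log E, exp_log hE0⟩
  obtain ⟨q, rfl⟩ : ∃ q, exp q = A := ⟨log A, exp_log hA0⟩
  have hε' : ε = exp (κ - p / 14) := by
    rw [hε, ← exp_mul, ← exp_add]
    congr 1
    ring
  have hT' : T = exp (2 * q + 103 / 42 * p) := by
    rw [hT, hε', ← exp_mul, ← exp_mul, ← exp_nat_mul, ← exp_add, ← exp_add, ← exp_add]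
    congr 1
    push_cast
    ring
  have h𝒯' : 𝒯 = exp (exp (4 * κ) * exp (11 * q + 317 / 21 * p)) := by
    rw [h𝒯, ← exp_mul, ← exp_mul, ← exp_nat_mul, ← exp_add, ← exp_add, ← exp_add, ← exp_add]
    congr 2
    push_cast
    ring
  obtain ⟨t₀, ht₀, h⟩ := hu.exists_good_time hE hAP rfl rfl (by rw [h4]; linarith)
    (le_trans (by linarith) h8) (le_trans (by linarith) h8) a b
  rw [← hT', ← h𝒯'] at ht₀
  rw [← hT', ← hε'] at h
  have hT0 : 0 < T := hT' ▸ exp_pos _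
  exact ⟨t₀, by linarith [ht₀.1], by linarith [ht₀.2], h⟩

end
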